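/- For the TACI problem with a single observer (L = 1) and bandwidth ratio τ > 0, θ(τ) = sup_W I(V;W|Z), where the supremum is over all finite auxiliary random variables W jointly distributed with (U,V,Z) (under the H_0 distribution) such that (Z,V)−U−W is a Markov chain, |𝒲| ≤ |𝒰|+4, and I(U;W|Z) ≤ τC, with C = max_{P_X} I(X;Y) the capacity of the channel P_{Y|X}. -/

import Mathlib

open Filter Real

noncomputable section

namespace DHT

/-- Real-valued indicator of a proposition. -/
def ind (P : Prop) : ℝ := by classical exact if P then 1 else 0

/-- `p` is a probability mass function on the finite type `α`. -/
def IsPMF {α : Type*} [Fintype α] (p : α → ℝ) : Prop :=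
  (∀ a, 0 ≤ p a) ∧ ∑ a, p a = 1

/-- `f` is a stochastic kernel: every row is a pmf. -/
def IsKernel {α β : Type*} [Fintype β] (f : α → β → ℝ) : Prop :=
  ∀ a, (∀ b, 0 ≤ f a b) ∧ ∑ b, f a b = 1

/-- Pushforward of a pmf along a map. -/
def pushf {α β : Type*} [Fintype α] (p : α → ℝ) (f : α → β) : β → ℝ :=
  fun b => ∑ a, ind (f a = b) * p a

/-- Probability of a set under a pmf. -/
def probIn {α : Type*} [Fintype α] (p : α → ℝ) (A : Set α) : ℝ :=
  ∑ a, ind (a ∈ A) * p a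

/-- Shannon entropy, in bits. -/
def entropy {α : Type*} [Fintype α] (p : α → ℝ) : ℝ :=
  -∑ a, p a * Real.logb 2 (p a)

/-- Kullback–Leibler divergence, in bits. -/
def klDiv {α : Type*} [Fintype α] (p q : α → ℝ) : ℝ :=
  ∑ a, p a * Real.logb 2 (p a / q a)

/-- Conditional entropy `H(α | β)` of a joint pmf on `α × β`, in bits. -/
def condEntropy {α β : Type*} [Fintype α] [Fintype β] (p : α × β → ℝ) : ℝ :=
  -∑ x : α × β, p x * Real.logb 2 (p x / ∑ a, p (a, x.2))

/-- Mutual information `I(α;β)`, in bits. -/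
def mutualInfo {α β : Type*} [Fintype α] [Fintype β] (p : α × β → ℝ) : ℝ :=
  ∑ x : α × β, p x * Real.logb 2 (p x / ((∑ b, p (x.1, b)) * (∑ a, p (a, x.2))))

/-- Conditional mutual information `I(α;β|γ)`, in bits. -/
def condMI {α β γ : Type*} [Fintype α] [Fintype β] [Fintype γ] (p : α × β × γ → ℝ) : ℝ :=
  ∑ x : α × β × γ, p x * Real.logb 2
    (p x * (∑ a, ∑ b, p (a, b, x.2.2)) /
      ((∑ b, p (x.1, b, x.2.2)) * (∑ a, p (a, x.2.1, x.2.2))))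

/-- Markov chain `α − β − γ`: the first and third components are conditionally
independent given the middle one. -/
def MarkovChain {α β γ : Type*} [Fintype α] [Fintype γ] (p : α × β × γ → ℝ) : Prop :=
  ∀ a b c, p (a, b, c) * (∑ a', ∑ c', p (a', b, c')) =
    (∑ c', p (a, b, c')) * (∑ a', p (a', b, c))

/-- Shannon capacity of a discrete memoryless channel, in bits per use. -/
def capacity {X Y : Type*} [Fintype X] [Fintype Y] (Ch : X → Y → ℝ) : ℝ :=
  sSup {c | ∃ q : X → ℝ, IsPMF q ∧ c = mutualInfo (fun xy : X × Y => q xy.1 * Ch xy.1 xy.2)}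

/-- Empirical distribution (type) of a length-`j` sequence. -/
def empDist {α : Type*} [Fintype α] {j : ℕ} (w : Fin j → α) : α → ℝ :=
  fun a => (∑ i, ind (w i = a)) / j

/-- δ-typicality: the empirical distribution is within δ of `p` in every coordinate. -/
def IsTypical {α : Type*} [Fintype α] (p : α → ℝ) (δ : ℝ) {j : ℕ} (w : Fin j → α) : Prop :=
  ∀ a, |empDist w a - p a| ≤ δ

section System

variable {L : ℕ} {U X Y : Fin L → Type} {V Z : Type}
variable [∀ l, Fintype (U l)] [∀ l, Fintype (X l)] [∀ l, Fintype (Y l)]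
variable [Fintype V] [Fintype Z]

/-- Joint pmf of the channel outputs `(Y₁ⁿ,…,Y_Lⁿ)`, `V^k` and `Z^k` induced by `k` i.i.d.
copies of the source `R`, the stochastic encoders `f` and the memoryless channels `Ch`. -/
def inducedDist (R : (((l : Fin L) → U l) × V × Z) → ℝ)
    (Ch : (l : Fin L) → X l → Y l → ℝ) (k n : ℕ)
    (f : (l : Fin L) → (Fin k → U l) → (Fin n → X l) → ℝ) :
    (((l : Fin L) → Fin n → Y l) × (Fin k → V) × (Fin k → Z)) → ℝ :=
  fun yvz =>
    ∑ u : (l : Fin L) → Fin k → U l, ∑ x : (l : Fin L) → Fin n → X l,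
      (∏ i : Fin k, R ((fun l => u l i), yvz.2.1 i, yvz.2.2 i)) *
        ((∏ l, f l (u l) (x l)) * ∏ l, ∏ j : Fin n, Ch l (x l j) (yvz.1 l j))

/-- `P` and `Q` have the same single-variable marginals. -/
def SameMarginals (P Q : (((l : Fin L) → U l) × V × Z) → ℝ) : Prop :=
  (∀ (l : Fin L) (a : U l),
      (∑ x : ((l : Fin L) → U l) × V × Z, ind (x.1 l = a) * P x) =
        ∑ x : ((l : Fin L) → U l) × V × Z, ind (x.1 l = a) * Q x) ∧
  (∀ v : V, (∑ x : ((l : Fin L) → U l) × V × Z, ind (x.2.1 = v) * P x) =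
      ∑ x : ((l : Fin L) → U l) × V × Z, ind (x.2.1 = v) * Q x) ∧
  (∀ z : Z, (∑ x : ((l : Fin L) → U l) × V × Z, ind (x.2.2 = z) * P x) =
      ∑ x : ((l : Fin L) → U l) × V × Z, ind (x.2.2 = z) * Q x)

/-- Testing against conditional independence: `Q = P_{U_𝓛|Z} P_{V|Z} P_Z`. -/
def IsTACI (P Q : (((l : Fin L) → U l) × V × Z) → ℝ) : Prop :=
  ∀ x : ((l : Fin L) → U l) × V × Z,
    Q x = (∑ v : V, P (x.1, v, x.2.2)) * (∑ u : (l : Fin L) → U l, P (u, x.2.1, x.2.2)) /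
      (∑ u : (l : Fin L) → U l, ∑ v : V, P (u, v, x.2.2))

/-- Optimal type-2 error probability `β(k,τ,ε)`. -/
def beta (P Q : (((l : Fin L) → U l) × V × Z) → ℝ)
    (Ch : (l : Fin L) → X l → Y l → ℝ) (τ ε : ℝ) (k : ℕ) : ℝ :=
  sInf {b | ∃ n : ℕ, (n : ℝ) ≤ τ * k ∧
    ∃ f : (l : Fin L) → (Fin k → U l) → (Fin n → X l) → ℝ,
      (∀ l, IsKernel (f l)) ∧
      ∃ A : Set (((l : Fin L) → Fin n → Y l) × (Fin k → V) × (Fin k → Z)),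
        probIn (inducedDist P Ch k n f) Aᶜ ≤ ε ∧
        b = probIn (inducedDist Q Ch k n f) A}

/-- `θ(k,τ)`. -/
def thetaK (P Q : (((l : Fin L) → U l) × V × Z) → ℝ)
    (Ch : (l : Fin L) → X l → Y l → ℝ) (τ : ℝ) (k : ℕ) : ℝ :=
  sSup {d | ∃ n : ℕ, (n : ℝ) ≤ τ * k ∧
    ∃ f : (l : Fin L) → (Fin k → U l) → (Fin n → X l) → ℝ,
      (∀ l, IsKernel (f l)) ∧
      d = klDiv (inducedDist P Ch k n f) (inducedDist Q Ch k n f) / k}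

/-- `θ(τ) = sup_{k ≥ 1} θ(k,τ)`. -/
def theta (P Q : (((l : Fin L) → U l) × V × Z) → ℝ)
    (Ch : (l : Fin L) → X l → Y l → ℝ) (τ : ℝ) : ℝ :=
  sSup {d | ∃ k : ℕ, 1 ≤ k ∧ d = thetaK P Q Ch τ k}

/-- Optimal type-2 error exponent `κ(τ,ε)`. -/
def kappa (P Q : (((l : Fin L) → U l) × V × Z) → ℝ)
    (Ch : (l : Fin L) → X l → Y l → ℝ) (τ ε : ℝ) : ℝ :=
  sSup {κ : ℝ | 0 ≤ κ ∧ ∀ δ : ℝ, 0 < δ →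
    Filter.limsup (fun k : ℕ => Real.logb 2 (beta P Q Ch τ ε k) / k) Filter.atTop ≤ -(κ - δ)}

/-- `I(V^k; Y₁ⁿ,…,Y_Lⁿ | Z^k)` of the induced distribution. -/
def miVY (P : (((l : Fin L) → U l) × V × Z) → ℝ)
    (Ch : (l : Fin L) → X l → Y l → ℝ) (k n : ℕ)
    (f : (l : Fin L) → (Fin k → U l) → (Fin n → X l) → ℝ) : ℝ :=
  condMI (fun x : (Fin k → V) × ((l : Fin L) → Fin n → Y l) × (Fin k → Z) =>
    inducedDist P Ch k n f (x.2.1, x.1, x.2.2))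

/-- `H(V^k | Y₁ⁿ,…,Y_Lⁿ, Z^k)` of the induced distribution. -/
def condEntV (P : (((l : Fin L) → U l) × V × Z) → ℝ)
    (Ch : (l : Fin L) → X l → Y l → ℝ) (k n : ℕ)
    (f : (l : Fin L) → (Fin k → U l) → (Fin n → X l) → ℝ) : ℝ :=
  condEntropy (fun x : (Fin k → V) × (((l : Fin L) → Fin n → Y l) × (Fin k → Z)) =>
    inducedDist P Ch k n f (x.2.1, x.1, x.2.2))

/-- Probability of correct decoding in the `L`-helper JSCC problem. -/
def probCorrect (P : (((l : Fin L) → U l) × V × Z) → ℝ)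
    (Ch : (l : Fin L) → X l → Y l → ℝ) (k n m : ℕ)
    (f : (l : Fin L) → (Fin k → U l) → (Fin n → X l) → ℝ)
    (φ : (Fin k → V) → Fin m)
    (g : Fin m × ((l : Fin L) → Fin n → Y l) × (Fin k → Z) → (Fin k → V)) : ℝ :=
  ∑ w : ((l : Fin L) → Fin n → Y l) × (Fin k → V) × (Fin k → Z),
    ind (g (φ w.2.1, w.1, w.2.2) = w.2.1) * inducedDist P Ch k n f w

/-- Achievability of rate `R` in the `L`-helper JSCC problem with bandwidth ratio `τ`. -/
def JSCCAchievable (P : (((l : Fin L) → U l) × V × Z) → ℝ)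
    (Ch : (l : Fin L) → X l → Y l → ℝ) (τ R : ℝ) : Prop :=
  ∀ lam : ℝ, 0 < lam → lam ≤ 1 →
    ∃ (nseq mseq : ℕ → ℕ) (δ : ℕ → ℝ)
      (f : (k : ℕ) → (l : Fin L) → (Fin k → U l) → (Fin (nseq k) → X l) → ℝ)
      (φ : (k : ℕ) → (Fin k → V) → Fin (mseq k))
      (g : (k : ℕ) → Fin (mseq k) × ((l : Fin L) → Fin (nseq k) → Y l) × (Fin k → Z) →
        (Fin k → V)),
      (∀ k, 0 ≤ δ k) ∧ Filter.Tendsto δ Filter.atTop (nhds 0) ∧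
      ∀ k : ℕ, 1 ≤ k →
        (nseq k : ℝ) ≤ τ * k ∧ 1 ≤ mseq k ∧ (∀ l, IsKernel (f k l)) ∧
        1 - lam ≤ probCorrect P Ch k (nseq k) (mseq k) (f k) (φ k) (g k) ∧
        Real.logb 2 (mseq k) / k ≤ R + δ k

/-- Optimal rate `R(τ)` of the `L`-helper JSCC problem. -/
def Rjscc (P : (((l : Fin L) → U l) × V × Z) → ℝ)
    (Ch : (l : Fin L) → X l → Y l → ℝ) (τ : ℝ) : ℝ :=
  sInf {R | JSCCAchievable P Ch τ R}

/-- `R_k`: infimum of `H(V^k|Y^n,Z^k)/k` over block lengths `n ≤ τk` and encoders. -/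
def Rk (P : (((l : Fin L) → U l) × V × Z) → ℝ)
    (Ch : (l : Fin L) → X l → Y l → ℝ) (τ : ℝ) (k : ℕ) : ℝ :=
  sInf {r | ∃ n : ℕ, (n : ℝ) ≤ τ * k ∧
    ∃ f : (l : Fin L) → (Fin k → U l) → (Fin n → X l) → ℝ,
      (∀ l, IsKernel (f l)) ∧ r = condEntV P Ch k n f / k}

end System

section SingleObserver

variable {Uu Xx Yy V Z : Type}
variable [Fintype Uu] [Fintype Xx] [Fintype Yy] [Fintype V] [Fintype Z]

/-- Single-observer induced joint pmf of `(Yⁿ, V^k, Z^k)`. -/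
def inducedDist1 (R : Uu × V × Z → ℝ) (Ch : Xx → Yy → ℝ) (k n : ℕ)
    (f : (Fin k → Uu) → (Fin n → Xx) → ℝ) :
    ((Fin n → Yy) × (Fin k → V) × (Fin k → Z)) → ℝ :=
  fun yvz => ∑ u : Fin k → Uu, ∑ x : Fin n → Xx,
    (∏ i : Fin k, R (u i, yvz.2.1 i, yvz.2.2 i)) *
      (f u x * ∏ j : Fin n, Ch (x j) (yvz.1 j))

end SingleObserver

section Aux

variable {Uu V Z Wt : Type} [Fintype Uu] [Fintype V] [Fintype Z] [Fintype Wt]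

/-- Markov chain `(Z,V) − U − W` for a joint pmf on `(U × V × Z) × W`. -/
def MarkovZVUW (J : (Uu × V × Z) × Wt → ℝ) : Prop :=
  MarkovChain (fun x : (Z × V) × Uu × Wt => J ((x.2.1, x.1.2, x.1.1), x.2.2))

/-- `I(U;W|Z)` for a joint pmf on `(U × V × Z) × W`. -/
def miUW_Z (J : (Uu × V × Z) × Wt → ℝ) : ℝ :=
  condMI (fun x : Uu × Wt × Z => ∑ v, J ((x.1, v, x.2.2), x.2.1))

/-- `I(V;W|Z)` for a joint pmf on `(U × V × Z) × W`. -/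
def miVW_Z (J : (Uu × V × Z) × Wt → ℝ) : ℝ :=
  condMI (fun x : V × Wt × Z => ∑ u, J ((u, x.1, x.2.2), x.2.1))

/-- `I(U;W|V,Z)` for a joint pmf on `(U × V × Z) × W`. -/
def miUW_VZ (J : (Uu × V × Z) × Wt → ℝ) : ℝ :=
  condMI (fun x : Uu × Wt × (V × Z) => J ((x.1, x.2.2.1, x.2.2.2), x.2.1))

/-- `H(V|W,Z)` for a joint pmf on `(U × V × Z) × W`. -/
def entV_WZ (J : (Uu × V × Z) × Wt → ℝ) : ℝ :=
  condEntropy (fun x : V × (Wt × Z) => ∑ u, J ((u, x.1, x.2.2), x.2.1))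

/-- `H(V|Z)` for a joint pmf on `U × V × Z`. -/
def entV_Z (P : Uu × V × Z → ℝ) : ℝ :=
  condEntropy (fun x : V × Z => ∑ u, P (u, x.1, x.2))

end Aux

end DHT

open DHT Filter Real

namespace DHT

set_option linter.unusedSectionVars false

lemma ind_nonneg (P : Prop) : 0 ≤ ind P := by
  unfold ind; split_ifs <;> norm_num

lemma ind_le_one (P : Prop) : ind P ≤ 1 := by
  unfold ind; split_ifs <;> norm_num

lemma ind_of {P : Prop} (h : P) : ind P = 1 := by simp [ind, h]

lemma ind_of_not {P : Prop} (h : ¬P) : ind P = 0 := by simp [ind, h]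

/-- Gibbs' inequality, phrased through the likelihood ratio. -/
lemma gibbs {α : Type*} [Fintype α] {p ρ : α → ℝ} (hp : ∀ a, 0 ≤ p a)
    (hρ : ∀ a, 0 < p a → 0 < ρ a) (hsum : ∑ a, p a / ρ a ≤ ∑ a, p a) :
    0 ≤ ∑ a, p a * log (ρ a) := by
  have h : ∀ a, p a - p a / ρ a ≤ p a * log (ρ a) := by
    intro a
    rcases (hp a).eq_or_lt with h0 | h0
    · simp [← h0]
    · have := one_sub_inv_le_log_of_pos (hρ a h0)
      calc p a - p a / ρ a = p a * (1 - (ρ a)⁻¹) := by ring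
        _ ≤ _ := by gcongr
  have := Finset.sum_le_sum fun a (_ : a ∈ Finset.univ) => h a
  rw [Finset.sum_sub_distrib] at this
  linarith

section Functionals

variable {U V Z W : Type*} [Fintype U] [Fintype V] [Fintype Z] [Fintype W]

/-- The `(U,Z)`-marginal of a source. -/
def margUZ (p : U → V → Z → ℝ) (u : U) (z : Z) : ℝ := ∑ v, p u v z

/-- The `(V,Z)`-marginal of a source. -/
def margVZ (p : U → V → Z → ℝ) (v : V) (z : Z) : ℝ := ∑ u, p u v z

/-- The `Z`-marginal of a source. -/
def margZ (p : U → V → Z → ℝ) (z : Z) : ℝ := ∑ u, margUZ p u z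

/-- Joint weight of `z` and an output symbol having likelihood `h` given `u`. -/
def outZ (p : U → V → Z → ℝ) (h : U → ℝ) (z : Z) : ℝ := ∑ u, margUZ p u z * h u

/-- Joint weight of `(v,z)` and an output symbol having likelihood `h` given `u`. -/
def outVZ (p : U → V → Z → ℝ) (h : U → ℝ) (v : V) (z : Z) : ℝ := ∑ u, p u v z * h u

/-- Contribution (in nats) to `I(U;W|Z)` of an output symbol with likelihood `h`. -/
def infoU (p : U → V → Z → ℝ) (h : U → ℝ) : ℝ :=
  ∑ u, ∑ z, margUZ p u z * h u * log (h u * margZ p z / outZ p h z)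

/-- Contribution (in nats) to `I(V;W|Z)` of an output symbol with likelihood `h`. -/
def infoV (p : U → V → Z → ℝ) (h : U → ℝ) : ℝ :=
  ∑ v, ∑ z, outVZ p h v z * log (outVZ p h v z * margZ p z / (margVZ p v z * outZ p h z))

/-- A source with strictly positive `(U,Z)`- and `(V,Z)`-marginals. -/
structure IsSource (p : U → V → Z → ℝ) : Prop where
  nonneg : ∀ u v z, 0 ≤ p u v z
  posUZ : ∀ u z, 0 < margUZ p u z
  posVZ : ∀ v z, 0 < margVZ p v z
  total : ∑ u, ∑ v, ∑ z, p u v z = 1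

namespace IsSource

variable {p : U → V → Z → ℝ}

lemma nonempty (hp : IsSource p) : Nonempty U ∧ Nonempty V ∧ Nonempty Z := by
  have h := hp.total
  refine ⟨?_, ?_, ?_⟩ <;> by_contra hc <;> rw [not_nonempty_iff] at hc <;> simp at h

lemma posZ (hp : IsSource p) (z : Z) : 0 < margZ p z := by
  have := hp.nonempty.1
  exact Finset.sum_pos (fun u _ => hp.posUZ u z) Finset.univ_nonempty

end IsSource

lemma margZ_eq_sum_margVZ (p : U → V → Z → ℝ) (z : Z) : margZ p z = ∑ v, margVZ p v z :=
  Finset.sum_comm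

lemma sum_outVZ (p : U → V → Z → ℝ) (h : U → ℝ) (z : Z) : ∑ v, outVZ p h v z = outZ p h z := by
  simp only [outVZ, outZ, margUZ, Finset.sum_mul]
  exact Finset.sum_comm

lemma IsSource.sum_margZ {p : U → V → Z → ℝ} (hp : IsSource p) : ∑ z, margZ p z = 1 := by
  rw [← hp.total]
  simp only [margZ, margUZ]
  rw [Finset.sum_comm]
  exact Finset.sum_congr rfl fun u _ => Finset.sum_comm

variable {p : U → V → Z → ℝ} {h : U → ℝ}

lemma outVZ_nonneg (hp : IsSource p) (hh : ∀ u, 0 ≤ h u) (v : V) (z : Z) : 0 ≤ outVZ p h v z :=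
  Finset.sum_nonneg fun u _ => mul_nonneg (hp.nonneg u v z) (hh u)

lemma outZ_nonneg (hp : IsSource p) (hh : ∀ u, 0 ≤ h u) (z : Z) : 0 ≤ outZ p h z :=
  Finset.sum_nonneg fun u _ => mul_nonneg (hp.posUZ u z).le (hh u)

lemma outZ_pos (hp : IsSource p) (hh : ∀ u, 0 ≤ h u) {u : U} (hu : 0 < h u) (z : Z) :
    0 < outZ p h z :=
  Finset.sum_pos' (fun u _ => mul_nonneg (hp.posUZ u z).le (hh u))
    ⟨u, Finset.mem_univ _, mul_pos (hp.posUZ u z) hu⟩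

lemma outVZ_le_outZ (hp : IsSource p) (hh : ∀ u, 0 ≤ h u) (v : V) (z : Z) :
    outVZ p h v z ≤ outZ p h z := by
  rw [← sum_outVZ]
  exact Finset.single_le_sum (f := fun v => outVZ p h v z)
    (fun v _ => outVZ_nonneg hp hh v z) (Finset.mem_univ v)

lemma outZ_smul (c : ℝ) (z : Z) : outZ p (fun u => c * h u) z = c * outZ p h z := by
  simp only [outZ, Finset.mul_sum]
  exact Finset.sum_congr rfl fun u _ => by ring

lemma outVZ_smul (c : ℝ) (v : V) (z : Z) :
    outVZ p (fun u => c * h u) v z = c * outVZ p h v z := by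
  simp only [outVZ, Finset.mul_sum]
  exact Finset.sum_congr rfl fun u _ => by ring

lemma infoU_smul (c : ℝ) : infoU p (fun u => c * h u) = c * infoU p h := by
  rcases eq_or_ne c 0 with rfl | hc
  · simp [infoU]
  · simp only [infoU, outZ_smul, Finset.mul_sum]
    refine Finset.sum_congr rfl fun u _ => Finset.sum_congr rfl fun z _ => ?_
    rw [mul_assoc c (h u), mul_div_mul_left _ _ hc]
    ring

lemma infoV_smul (c : ℝ) : infoV p (fun u => c * h u) = c * infoV p h := by
  rcases eq_or_ne c 0 with rfl | hc
  · simp [infoV, outVZ]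
  · simp only [infoV, outZ_smul, outVZ_smul, Finset.mul_sum]
    refine Finset.sum_congr rfl fun u _ => Finset.sum_congr rfl fun z _ => ?_
    rw [mul_assoc c, mul_assoc c _ (margZ p z), mul_left_comm _ c, mul_div_mul_left _ _ hc]

lemma infoV_zero : infoV p (fun _ => 0) = 0 := by simp [infoV, outVZ]

lemma infoU_zero : infoU p (fun _ => 0) = 0 := by simp [infoU]

lemma infoU_eq_sum (p : U → V → Z → ℝ) (h : U → ℝ) : infoU p h =
    ∑ u, ∑ v, ∑ z, p u v z * h u * log (h u * margZ p z / outZ p h z) := by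
  refine Finset.sum_congr rfl fun u _ => ?_
  rw [Finset.sum_comm]
  refine Finset.sum_congr rfl fun z _ => ?_
  simp only [margUZ, Finset.sum_mul]

lemma infoV_eq_sum (p : U → V → Z → ℝ) (h : U → ℝ) : infoV p h =
    ∑ u, ∑ v, ∑ z, p u v z * h u *
      log (outVZ p h v z * margZ p z / (margVZ p v z * outZ p h z)) := by
  rw [Finset.sum_comm]
  refine Finset.sum_congr rfl fun v _ => ?_
  rw [Finset.sum_comm]
  refine Finset.sum_congr rfl fun z _ => ?_
  conv_lhs => rw [outVZ, Finset.sum_mul]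
  rfl

/-- Data processing: `I(V;W|Z) ≤ I(U;W|Z)`, symbol by symbol. -/
lemma infoV_le_infoU (hp : IsSource p) (hh : ∀ u, 0 ≤ h u) : infoV p h ≤ infoU p h := by
  have key := gibbs (α := U × V × Z) (p := fun x => p x.1 x.2.1 x.2.2 * h x.1)
    (ρ := fun x => h x.1 * margVZ p x.2.1 x.2.2 / outVZ p h x.2.1 x.2.2)
    (fun x => mul_nonneg (hp.nonneg _ _ _) (hh _))
  have pos : ∀ u v z, 0 < p u v z * h u → 0 < h u ∧ 0 < outVZ p h v z := by
    intro u v z hpos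
    refine ⟨pos_of_mul_pos_right hpos (hp.nonneg _ _ _), ?_⟩
    exact lt_of_lt_of_le hpos (Finset.single_le_sum (f := fun u => p u v z * h u)
      (fun u _ => mul_nonneg (hp.nonneg _ _ _) (hh _)) (Finset.mem_univ u))
  have h1 := key (fun ⟨u, v, z⟩ hx => by
    obtain ⟨a, b⟩ := pos u v z hx
    exact div_pos (mul_pos a (hp.posVZ v z)) b) (by
    simp only [Fintype.sum_prod_type]
    rw [Finset.sum_comm, Finset.sum_comm (γ := U)]
    refine Finset.sum_le_sum fun v _ => ?_
    rw [Finset.sum_comm, Finset.sum_comm (γ := U)]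
    refine Finset.sum_le_sum fun z _ => ?_
    change _ ≤ outVZ p h v z
    calc ∑ u, p u v z * h u / (h u * margVZ p v z / outVZ p h v z)
        ≤ ∑ u, p u v z * (outVZ p h v z / margVZ p v z) := by
          refine Finset.sum_le_sum fun u _ => ?_
          rcases (hh u).eq_or_lt with h0 | h0
          · rw [← h0]
            simp only [mul_zero, zero_mul, zero_div]
            exact mul_nonneg (hp.nonneg _ _ _)
              (div_nonneg (outVZ_nonneg hp hh _ _) (hp.posVZ _ _).le)
          · have := hp.posVZ v z
            apply le_of_eq
            rw [div_div_eq_mul_div]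
            field_simp
      _ = outVZ p h v z := by
          rw [← Finset.sum_mul]
          change margVZ p v z * _ = _
          have := (hp.posVZ v z).ne'
          field_simp)
  have h2 : infoU p h - infoV p h = ∑ x : U × V × Z, p x.1 x.2.1 x.2.2 * h x.1 *
      log (h x.1 * margVZ p x.2.1 x.2.2 / outVZ p h x.2.1 x.2.2) := by
    rw [infoU_eq_sum, infoV_eq_sum]
    simp only [Fintype.sum_prod_type, ← Finset.sum_sub_distrib]
    refine Finset.sum_congr rfl fun u _ => Finset.sum_congr rfl fun v _ =>
      Finset.sum_congr rfl fun z _ => ?_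
    rcases (mul_nonneg (hp.nonneg u v z) (hh u)).eq_or_lt with h0 | h0
    · simp [← h0]
    · obtain ⟨a, b⟩ := pos u v z h0
      have c := hp.posZ z
      have d := hp.posVZ v z
      have e := outZ_pos hp hh a z
      rw [← mul_sub, ← log_div (by positivity) (by positivity)]
      congr 2
      field_simp
  linarith

end Functionals

section Tensor

variable {U₁ V₁ Z₁ U₂ V₂ Z₂ Y : Type*} [Fintype U₁] [Fintype V₁] [Fintype Z₁]
  [Fintype U₂] [Fintype V₂] [Fintype Z₂] [Fintype Y]

/-- Product of two independent sources. -/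
def prodSource (p₁ : U₁ → V₁ → Z₁ → ℝ) (p₂ : U₂ → V₂ → Z₂ → ℝ) :
    U₁ × U₂ → V₁ × V₂ → Z₁ × Z₂ → ℝ :=
  fun u v z => p₁ u.1 v.1 z.1 * p₂ u.2 v.2 z.2

/-- The kernel seen by the first source when the second `Z` is revealed at the output. -/
def fstLik (p₂ : U₂ → V₂ → Z₂ → ℝ) (g : Y → U₁ × U₂ → ℝ) : Y × Z₂ → U₁ → ℝ :=
  fun w u₁ => ∑ u₂, margUZ p₂ u₂ w.2 * g w.1 (u₁, u₂)

/-- The kernel seen by the second source when the first `(U,Z)` is revealed at the output. -/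
def sndLik (p₁ : U₁ → V₁ → Z₁ → ℝ) (g : Y → U₁ × U₂ → ℝ) : Y × U₁ × Z₁ → U₂ → ℝ :=
  fun w u₂ => margUZ p₁ w.2.1 w.2.2 * g w.1 (w.2.1, u₂)

variable (p₁ : U₁ → V₁ → Z₁ → ℝ) (p₂ : U₂ → V₂ → Z₂ → ℝ) (g : Y → U₁ × U₂ → ℝ)

lemma margUZ_prodSource (u : U₁ × U₂) (z : Z₁ × Z₂) :
    margUZ (prodSource p₁ p₂) u z = margUZ p₁ u.1 z.1 * margUZ p₂ u.2 z.2 := by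
  simp only [margUZ, prodSource, Fintype.sum_prod_type, Finset.sum_mul_sum]

lemma margVZ_prodSource (v : V₁ × V₂) (z : Z₁ × Z₂) :
    margVZ (prodSource p₁ p₂) v z = margVZ p₁ v.1 z.1 * margVZ p₂ v.2 z.2 := by
  simp only [margVZ, prodSource, Fintype.sum_prod_type, Finset.sum_mul_sum]

lemma margZ_prodSource (z : Z₁ × Z₂) :
    margZ (prodSource p₁ p₂) z = margZ p₁ z.1 * margZ p₂ z.2 := by
  simp only [margZ, margUZ_prodSource, Fintype.sum_prod_type, Finset.sum_mul_sum]

lemma outZ_prodSource (y : Y) (z : Z₁ × Z₂) :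
    outZ (prodSource p₁ p₂) (g y) z = outZ p₁ (fstLik p₂ g (y, z.2)) z.1 := by
  simp only [outZ, margUZ_prodSource, Fintype.sum_prod_type, fstLik, Finset.mul_sum]
  exact Finset.sum_congr rfl fun _ _ => Finset.sum_congr rfl fun _ _ => by ring

lemma outZ_sndLik (y : Y) (u₁ : U₁) (z₁ : Z₁) (z₂ : Z₂) :
    outZ p₂ (sndLik p₁ g (y, u₁, z₁)) z₂ = margUZ p₁ u₁ z₁ * fstLik p₂ g (y, z₂) u₁ := by
  simp only [outZ, sndLik, fstLik, Finset.mul_sum]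
  exact Finset.sum_congr rfl fun _ _ => by ring

lemma outVZ_sndLik (y : Y) (u₁ : U₁) (z₁ : Z₁) (v₂ : V₂) (z₂ : Z₂) :
    outVZ p₂ (sndLik p₁ g (y, u₁, z₁)) v₂ z₂ =
      margUZ p₁ u₁ z₁ * outVZ p₂ (fun u₂ => g y (u₁, u₂)) v₂ z₂ := by
  simp only [outVZ, sndLik, Finset.mul_sum]
  exact Finset.sum_congr rfl fun _ _ => by ring

lemma outVZ_prodSource (y : Y) (v : V₁ × V₂) (z : Z₁ × Z₂) :
    outVZ (prodSource p₁ p₂) (g y) v z =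
      ∑ u₁, p₁ u₁ v.1 z.1 * outVZ p₂ (fun u₂ => g y (u₁, u₂)) v.2 z.2 := by
  simp only [outVZ, prodSource, Fintype.sum_prod_type, Finset.mul_sum]
  exact Finset.sum_congr rfl fun _ _ => Finset.sum_congr rfl fun _ _ => by ring

lemma outVZ_fstLik (y : Y) (v₁ : V₁) (z₁ : Z₁) (z₂ : Z₂) :
    outVZ p₁ (fstLik p₂ g (y, z₂)) v₁ z₁ =
      ∑ u₁, ∑ v₂, p₁ u₁ v₁ z₁ * outVZ p₂ (fun u₂ => g y (u₁, u₂)) v₂ z₂ := by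
  simp only [← Finset.mul_sum, sum_outVZ]
  rfl

variable {p₁ p₂ g}

lemma sum_sndLik_add (hp₁ : IsSource p₁) (hg : ∑ y, g y = 1) : ∑ w, sndLik p₁ g w = 1 := by
  funext u₂
  have h1 : ∀ u, ∑ y, g y u = 1 := fun u => by simpa using congrFun hg u
  simp only [Finset.sum_apply, sndLik, Fintype.sum_prod_type]
  rw [Finset.sum_comm]
  simp only [fun a : U₁ => Finset.sum_comm (s := (Finset.univ : Finset Y))
    (t := (Finset.univ : Finset Z₁)) (f := fun y z => margUZ p₁ a z * g y (a, u₂)),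
    ← Finset.mul_sum, h1, mul_one]
  rw [Finset.sum_comm]
  exact hp₁.sum_margZ

lemma sum_fstLik (hp₂ : IsSource p₂) (hg : ∑ y, g y = 1) : ∑ w, fstLik p₂ g w = 1 := by
  funext u₁
  have h1 : ∀ u, ∑ y, g y u = 1 := fun u => by simpa using congrFun hg u
  simp only [Finset.sum_apply, fstLik, Fintype.sum_prod_type]
  rw [Finset.sum_comm]
  refine Eq.trans ?_ hp₂.sum_margZ
  refine Finset.sum_congr rfl fun z _ => ?_
  rw [Finset.sum_comm]
  refine Finset.sum_congr rfl fun u _ => ?_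
  rw [← Finset.mul_sum, h1, mul_one]

lemma sndLik_nonneg (hp₁ : IsSource p₁) (hg : ∀ y u, 0 ≤ g y u) (w : Y × U₁ × Z₁) (u : U₂) :
    0 ≤ sndLik p₁ g w u := mul_nonneg (hp₁.posUZ _ _).le (hg _ _)

lemma fstLik_nonneg (hp₂ : IsSource p₂) (hg : ∀ y u, 0 ≤ g y u) (w : Y × Z₂) (u : U₁) :
    0 ≤ fstLik p₂ g w u :=
  Finset.sum_nonneg fun _ _ => mul_nonneg (hp₂.posUZ _ _).le (hg _ _)

lemma fstLik_pos (hp₂ : IsSource p₂) (hg : ∀ y u, 0 ≤ g y u) {y : Y} {u₁ : U₁} {u₂ : U₂}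
    (h : 0 < g y (u₁, u₂)) (z₂ : Z₂) : 0 < fstLik p₂ g (y, z₂) u₁ :=
  Finset.sum_pos' (fun _ _ => mul_nonneg (hp₂.posUZ _ _).le (hg _ _))
    ⟨u₂, Finset.mem_univ _, mul_pos (hp₂.posUZ _ _) h⟩

/-- Chain rule for `I(U₁U₂;Y|Z₁Z₂)`. -/
lemma sum_infoU_prodSource (hp₁ : IsSource p₁) (hp₂ : IsSource p₂) (hg : ∀ y u, 0 ≤ g y u) :
    ∑ y, infoU (prodSource p₁ p₂) (g y) =
      ∑ w, infoU p₁ (fstLik p₂ g w) + ∑ w, infoU p₂ (sndLik p₁ g w) := by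
  set a : Y × U₁ × Z₁ × U₂ × Z₂ → ℝ := fun x => margUZ p₁ x.2.1 x.2.2.1 *
    margUZ p₂ x.2.2.2.1 x.2.2.2.2 * g x.1 (x.2.1, x.2.2.2.1) with ha
  have e0 : ∑ y, infoU (prodSource p₁ p₂) (g y) = ∑ x, a x * log (g x.1 (x.2.1, x.2.2.2.1) *
      (margZ p₁ x.2.2.1 * margZ p₂ x.2.2.2.2) / outZ p₁ (fstLik p₂ g (x.1, x.2.2.2.2)) x.2.2.1) := by
    simp only [infoU, margUZ_prodSource, margZ_prodSource, outZ_prodSource, ha,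
      Fintype.sum_prod_type]
    refine Finset.sum_congr rfl fun y _ => Finset.sum_congr rfl fun u₁ _ => ?_
    rw [Finset.sum_comm]
  have e1 : ∑ w, infoU p₁ (fstLik p₂ g w) = ∑ x, a x * log (fstLik p₂ g (x.1, x.2.2.2.2) x.2.1 *
      margZ p₁ x.2.2.1 / outZ p₁ (fstLik p₂ g (x.1, x.2.2.2.2)) x.2.2.1) := by
    simp only [infoU, ha, Fintype.sum_prod_type]
    refine Finset.sum_congr rfl fun y _ => ?_
    rw [Finset.sum_comm]
    refine Finset.sum_congr rfl fun u₁ _ => ?_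
    rw [Finset.sum_comm]
    refine Finset.sum_congr rfl fun z₁ _ => ?_
    rw [Finset.sum_comm]
    refine Finset.sum_congr rfl fun z₂ _ => ?_
    conv_lhs => rw [fstLik, Finset.mul_sum, Finset.sum_mul]
    exact Finset.sum_congr rfl fun u₂ _ => by simp only [fstLik]; ring
  have e2 : ∑ w, infoU p₂ (sndLik p₁ g w) = ∑ x, a x * log (sndLik p₁ g (x.1, x.2.1, x.2.2.1)
      x.2.2.2.1 * margZ p₂ x.2.2.2.2 /
      outZ p₂ (sndLik p₁ g (x.1, x.2.1, x.2.2.1)) x.2.2.2.2) := by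
    simp only [infoU, ha, Fintype.sum_prod_type]
    refine Finset.sum_congr rfl fun y _ => Finset.sum_congr rfl fun u₁ _ =>
      Finset.sum_congr rfl fun z₁ _ => Finset.sum_congr rfl fun u₂ _ =>
      Finset.sum_congr rfl fun z₂ _ => ?_
    simp only [sndLik]
    ring
  rw [e0, e1, e2, ← Finset.sum_add_distrib]
  refine Finset.sum_congr rfl fun ⟨y, u₁, z₁, u₂, z₂⟩ _ => ?_
  rcases (hg y (u₁, u₂)).eq_or_lt with h0 | h0
  · simp [ha, ← h0]
  · have b1 := hp₁.posUZ u₁ z₁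
    have b3 := hp₁.posZ z₁
    have b4 := hp₂.posZ z₂
    have b5 := fstLik_pos hp₂ hg h0 z₂
    have b6 := outZ_pos hp₁ (fstLik_nonneg hp₂ hg (y, z₂)) b5 z₁
    have b7 : 0 < sndLik p₁ g (y, u₁, z₁) u₂ := mul_pos b1 h0
    simp only [outZ_sndLik]
    rw [← mul_add, ← log_mul (by positivity) (by positivity)]
    congr 2
    simp only [sndLik]
    field_simp

/-- Single-letterization step for `I(V₁V₂;Y|Z₁Z₂)`. -/
lemma sum_infoV_prodSource_le (hp₁ : IsSource p₁) (hp₂ : IsSource p₂)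
    (hg : ∀ y u, 0 ≤ g y u) :
    ∑ y, infoV (prodSource p₁ p₂) (g y) ≤
      ∑ w, infoV p₁ (fstLik p₂ g w) + ∑ w, infoV p₂ (sndLik p₁ g w) := by
  set b : Y → U₁ → V₂ → Z₂ → ℝ := fun y u₁ v₂ z₂ => outVZ p₂ (fun u₂ => g y (u₁, u₂)) v₂ z₂
    with hb
  have b_nonneg : ∀ y u₁ v₂ z₂, 0 ≤ b y u₁ v₂ z₂ := fun y u₁ v₂ z₂ =>
    outVZ_nonneg hp₂ (fun u₂ => hg y (u₁, u₂)) v₂ z₂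
  set H : Y → V₁ → Z₁ → V₂ → Z₂ → ℝ := fun y v₁ z₁ v₂ z₂ => ∑ u₁, p₁ u₁ v₁ z₁ * b y u₁ v₂ z₂
    with hH
  set A : Y → V₁ → Z₁ → Z₂ → ℝ := fun y v₁ z₁ z₂ => outVZ p₁ (fstLik p₂ g (y, z₂)) v₁ z₁ with hA
  set K : Y → U₁ → Z₂ → ℝ := fun y u₁ z₂ => fstLik p₂ g (y, z₂) u₁ with hK
  set O : Y → Z₁ → Z₂ → ℝ := fun y z₁ z₂ => outZ p₁ (fstLik p₂ g (y, z₂)) z₁ with hO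
  set J : Y × V₁ × Z₁ × V₂ × Z₂ × U₁ → ℝ := fun x => p₁ x.2.2.2.2.2 x.2.1 x.2.2.1 *
    b x.1 x.2.2.2.2.2 x.2.2.2.1 x.2.2.2.2.1 with hJ
  have e0 : ∑ y, infoV (prodSource p₁ p₂) (g y) = ∑ x : Y × V₁ × Z₁ × V₂ × Z₂ × U₁, J x *
      log (H x.1 x.2.1 x.2.2.1 x.2.2.2.1 x.2.2.2.2.1 *
      (margZ p₁ x.2.2.1 * margZ p₂ x.2.2.2.2.1) / (margVZ p₁ x.2.1 x.2.2.1 *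
      margVZ p₂ x.2.2.2.1 x.2.2.2.2.1 * O x.1 x.2.2.1 x.2.2.2.2.1)) := by
    simp only [infoV, margVZ_prodSource, margZ_prodSource, outZ_prodSource, outVZ_prodSource, hJ,
      Fintype.sum_prod_type]
    refine Finset.sum_congr rfl fun y _ => Finset.sum_congr rfl fun v₁ _ => ?_
    rw [Finset.sum_comm]
    refine Finset.sum_congr rfl fun z₁ _ => Finset.sum_congr rfl fun v₂ _ =>
      Finset.sum_congr rfl fun z₂ _ => ?_
    rw [Finset.sum_mul]
  have e1 : ∑ w, infoV p₁ (fstLik p₂ g w) = ∑ x : Y × V₁ × Z₁ × V₂ × Z₂ × U₁, J x *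
      log (A x.1 x.2.1 x.2.2.1 x.2.2.2.2.1 * margZ p₁ x.2.2.1 / (margVZ p₁ x.2.1 x.2.2.1 *
      O x.1 x.2.2.1 x.2.2.2.2.1)) := by
    simp only [infoV, hJ, Fintype.sum_prod_type]
    refine Finset.sum_congr rfl fun y _ => ?_
    rw [Finset.sum_comm]
    refine Finset.sum_congr rfl fun v₁ _ => ?_
    rw [Finset.sum_comm]
    refine Finset.sum_congr rfl fun z₁ _ => ?_
    refine Eq.trans ?_ Finset.sum_comm
    refine Finset.sum_congr rfl fun z₂ _ => ?_
    conv_lhs => rw [outVZ_fstLik, Finset.sum_comm, Finset.sum_mul]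
    refine Finset.sum_congr rfl fun v₂ _ => ?_
    rw [Finset.sum_mul]
    simp only [hA, outVZ_fstLik]
    exact Finset.sum_congr rfl fun u₂ _ => by rw [Finset.sum_comm]
  have e2 : ∑ w, infoV p₂ (sndLik p₁ g w) = ∑ x : Y × V₁ × Z₁ × V₂ × Z₂ × U₁, J x *
      log (margUZ p₁ x.2.2.2.2.2 x.2.2.1 * b x.1 x.2.2.2.2.2 x.2.2.2.1 x.2.2.2.2.1 *
      margZ p₂ x.2.2.2.2.1 / (margVZ p₂ x.2.2.2.1 x.2.2.2.2.1 *
      (margUZ p₁ x.2.2.2.2.2 x.2.2.1 * K x.1 x.2.2.2.2.2 x.2.2.2.2.1))) := by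
    simp only [infoV, outVZ_sndLik, outZ_sndLik, hJ, Fintype.sum_prod_type]
    refine Finset.sum_congr rfl fun y _ => ?_
    rw [Finset.sum_comm]
    refine Eq.trans ?_ Finset.sum_comm
    refine Finset.sum_congr rfl fun z₁ _ => ?_
    rw [Finset.sum_comm]
    refine Eq.trans ?_ Finset.sum_comm
    refine Finset.sum_congr rfl fun v₂ _ => ?_
    rw [Finset.sum_comm]
    refine Eq.trans ?_ Finset.sum_comm
    refine Finset.sum_congr rfl fun z₂ _ => ?_
    refine Eq.trans ?_ Finset.sum_comm
    refine Finset.sum_congr rfl fun u₁ _ => ?_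
    conv_lhs => enter [1, 1]; rw [margUZ]
    rw [Finset.sum_mul, Finset.sum_mul]
  have J_nonneg : ∀ x, 0 ≤ J x := fun x => mul_nonneg (hp₁.nonneg _ _ _) (b_nonneg _ _ _ _)
  have H_nonneg : ∀ y v₁ z₁ v₂ z₂, 0 ≤ H y v₁ z₁ v₂ z₂ := fun y v₁ z₁ v₂ z₂ =>
    Finset.sum_nonneg fun u₁ _ => mul_nonneg (hp₁.nonneg _ _ _) (b_nonneg _ _ _ _)
  have pos : ∀ y v₁ z₁ v₂ z₂ u₁, 0 < J (y, v₁, z₁, v₂, z₂, u₁) →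
      0 < b y u₁ v₂ z₂ ∧ 0 < H y v₁ z₁ v₂ z₂ ∧ 0 < K y u₁ z₂ ∧ 0 < A y v₁ z₁ z₂ ∧
      0 < O y z₁ z₂ := by
    intro y v₁ z₁ v₂ z₂ u₁ hpos
    have c1 : 0 < b y u₁ v₂ z₂ := pos_of_mul_pos_right hpos (hp₁.nonneg _ _ _)
    have c2 : 0 < p₁ u₁ v₁ z₁ := pos_of_mul_pos_left hpos (b_nonneg _ _ _ _)
    have c3 : 0 < K y u₁ z₂ :=
      lt_of_lt_of_le c1 (outVZ_le_outZ hp₂ (fun u₂ => hg y (u₁, u₂)) v₂ z₂)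
    have c4 : 0 < A y v₁ z₁ z₂ := Finset.sum_pos'
      (fun _ _ => mul_nonneg (hp₁.nonneg _ _ _) (fstLik_nonneg hp₂ hg _ _))
      ⟨u₁, Finset.mem_univ _, mul_pos c2 c3⟩
    refine ⟨c1, Finset.sum_pos' (fun _ _ => mul_nonneg (hp₁.nonneg _ _ _) (b_nonneg _ _ _ _))
      ⟨u₁, Finset.mem_univ _, hpos⟩, c3, c4, ?_⟩
    exact lt_of_lt_of_le c4 (outVZ_le_outZ hp₁ (fstLik_nonneg hp₂ hg _) v₁ z₁)
  have key := gibbs (p := J) (ρ := fun x => A x.1 x.2.1 x.2.2.1 x.2.2.2.2.1 *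
      b x.1 x.2.2.2.2.2 x.2.2.2.1 x.2.2.2.2.1 / (K x.1 x.2.2.2.2.2 x.2.2.2.2.1 *
      H x.1 x.2.1 x.2.2.1 x.2.2.2.1 x.2.2.2.2.1)) J_nonneg
    (fun ⟨y, v₁, z₁, v₂, z₂, u₁⟩ hx => by
      obtain ⟨c1, c2, c3, c4, -⟩ := pos _ _ _ _ _ _ hx
      dsimp only
      positivity) (by
    simp only [Fintype.sum_prod_type]
    refine Finset.sum_le_sum fun y _ => Finset.sum_le_sum fun v₁ _ =>
      Finset.sum_le_sum fun z₁ _ => Finset.sum_le_sum fun v₂ _ =>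
      Finset.sum_le_sum fun z₂ _ => ?_
    change _ ≤ H y v₁ z₁ v₂ z₂
    have A_nonneg : 0 ≤ A y v₁ z₁ z₂ := outVZ_nonneg hp₁ (fstLik_nonneg hp₂ hg _) _ _
    calc _ ≤ ∑ u₁, (p₁ u₁ v₁ z₁ * K y u₁ z₂) * (H y v₁ z₁ v₂ z₂ / A y v₁ z₁ z₂) := by
          refine Finset.sum_le_sum fun u₁ _ => ?_
          rcases (J_nonneg (y, v₁, z₁, v₂, z₂, u₁)).eq_or_lt with h0 | h0
          · rw [← h0, zero_div]
            exact mul_nonneg (mul_nonneg (hp₁.nonneg _ _ _) (fstLik_nonneg hp₂ hg _ _))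
              (div_nonneg (H_nonneg _ _ _ _ _) A_nonneg)
          · obtain ⟨c1, c2, c3, c4, -⟩ := pos _ _ _ _ _ _ h0
            apply le_of_eq
            simp only [hJ]
            field_simp
      _ = A y v₁ z₁ z₂ * (H y v₁ z₁ v₂ z₂ / A y v₁ z₁ z₂) := by rw [← Finset.sum_mul]; rfl
      _ ≤ H y v₁ z₁ v₂ z₂ := by
          rcases A_nonneg.eq_or_lt with h0 | h0
          · rw [← h0, zero_mul]; exact H_nonneg _ _ _ _ _
          · apply le_of_eq; field_simp)
  rw [e0, e1, e2, ← Finset.sum_add_distrib, ← sub_nonneg, ← Finset.sum_sub_distrib]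
  refine key.trans_eq (Finset.sum_congr rfl fun ⟨y, v₁, z₁, v₂, z₂, u₁⟩ _ => ?_)
  rcases (J_nonneg (y, v₁, z₁, v₂, z₂, u₁)).eq_or_lt with h0 | h0
  · simp [← h0]
  · obtain ⟨c1, c2, c3, c4, c5⟩ := pos _ _ _ _ _ _ h0
    have d1 := hp₁.posZ z₁
    have d2 := hp₂.posZ z₂
    have d3 := hp₁.posVZ v₁ z₁
    have d4 := hp₂.posVZ v₂ z₂
    have d5 := hp₁.posUZ u₁ z₁
    dsimp only
    rw [← mul_add, ← mul_sub, ← log_mul (by positivity) (by positivity),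
      ← log_div (by positivity) (by positivity)]
    congr 2
    field_simp

end Tensor

section Power

variable {U V Z U' V' Z' : Type*} [Fintype U] [Fintype V] [Fintype Z]
  [Fintype U'] [Fintype V'] [Fintype Z']

/-- `k` independent copies of a source. -/
def powSource (p : U → V → Z → ℝ) (k : ℕ) : (Fin k → U) → (Fin k → V) → (Fin k → Z) → ℝ :=
  fun u v z => ∏ i, p (u i) (v i) (z i)

variable (p : U → V → Z → ℝ) (k : ℕ)

lemma margUZ_powSource (u : Fin k → U) (z : Fin k → Z) :
    margUZ (powSource p k) u z = ∏ i, margUZ p (u i) (z i) := by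
  simp only [margUZ, powSource, Fintype.prod_sum]

lemma margVZ_powSource (v : Fin k → V) (z : Fin k → Z) :
    margVZ (powSource p k) v z = ∏ i, margVZ p (v i) (z i) := by
  simp only [margVZ, powSource, Fintype.prod_sum]

lemma margZ_powSource (z : Fin k → Z) : margZ (powSource p k) z = ∏ i, margZ p (z i) := by
  simp only [margZ, margUZ_powSource, Fintype.prod_sum]

variable {p}

lemma IsSource.pow (hp : IsSource p) : IsSource (powSource p k) where
  nonneg _ _ _ := Finset.prod_nonneg fun _ _ => hp.nonneg _ _ _
  posUZ _ _ := by
    rw [margUZ_powSource]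
    exact Finset.prod_pos fun _ _ => hp.posUZ _ _
  posVZ _ _ := by
    rw [margVZ_powSource]
    exact Finset.prod_pos fun _ _ => hp.posVZ _ _
  total := by
    have h : ∏ _i : Fin k, ∑ u, ∑ v, ∑ z, p u v z = 1 := by
      rw [hp.total, Finset.prod_const_one]
    simp only [Fintype.prod_sum] at h
    exact h

variable (p) in
lemma infoU_equiv (h : U → ℝ) (eU : U' ≃ U) (eV : V' ≃ V) (eZ : Z' ≃ Z) :
    infoU (fun u v z => p (eU u) (eV v) (eZ z)) (fun u => h (eU u)) = infoU p h := by
  have h1 : ∀ u z, margUZ (fun u v z => p (eU u) (eV v) (eZ z)) u z = margUZ p (eU u) (eZ z) :=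
    fun u z => eV.sum_comp fun v => p (eU u) v (eZ z)
  have h2 : ∀ z, margZ (fun u v z => p (eU u) (eV v) (eZ z)) z = margZ p (eZ z) := fun z => by
    simp only [margZ, h1]
    exact eU.sum_comp fun u => margUZ p u (eZ z)
  have h3 : ∀ z, outZ (fun u v z => p (eU u) (eV v) (eZ z)) (fun u => h (eU u)) z =
      outZ p h (eZ z) := fun z => by
    simp only [outZ, h1]
    exact eU.sum_comp fun u => margUZ p u (eZ z) * h u
  simp only [infoU, h1, h2, h3]
  rw [← eU.sum_comp]
  exact Finset.sum_congr rfl fun u _ => eZ.sum_comp fun z =>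
    margUZ p (eU u) z * h (eU u) * log (h (eU u) * margZ p z / outZ p h z)

variable (p) in
lemma infoV_equiv (h : U → ℝ) (eU : U' ≃ U) (eV : V' ≃ V) (eZ : Z' ≃ Z) :
    infoV (fun u v z => p (eU u) (eV v) (eZ z)) (fun u => h (eU u)) = infoV p h := by
  have h1 : ∀ u z, margUZ (fun u v z => p (eU u) (eV v) (eZ z)) u z = margUZ p (eU u) (eZ z) :=
    fun u z => eV.sum_comp fun v => p (eU u) v (eZ z)
  have h2 : ∀ z, margZ (fun u v z => p (eU u) (eV v) (eZ z)) z = margZ p (eZ z) := fun z => by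
    simp only [margZ, h1]
    exact eU.sum_comp fun u => margUZ p u (eZ z)
  have h3 : ∀ z, outZ (fun u v z => p (eU u) (eV v) (eZ z)) (fun u => h (eU u)) z =
      outZ p h (eZ z) := fun z => by
    simp only [outZ, h1]
    exact eU.sum_comp fun u => margUZ p u (eZ z) * h u
  have h4 : ∀ v z, margVZ (fun u v z => p (eU u) (eV v) (eZ z)) v z = margVZ p (eV v) (eZ z) :=
    fun v z => eU.sum_comp fun u => p u (eV v) (eZ z)
  have h5 : ∀ v z, outVZ (fun u v z => p (eU u) (eV v) (eZ z)) (fun u => h (eU u)) v z =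
      outVZ p h (eV v) (eZ z) := fun v z => eU.sum_comp fun u => p u (eV v) (eZ z) * h u
  simp only [infoV, h2, h3, h4, h5]
  rw [← eV.sum_comp]
  exact Finset.sum_congr rfl fun v _ => eZ.sum_comp fun z => outVZ p h (eV v) z *
    log (outVZ p h (eV v) z * margZ p z / (margVZ p (eV v) z * outZ p h z))

lemma powSource_succ_cons (u : U × (Fin k → U)) (v : V × (Fin k → V)) (z : Z × (Fin k → Z)) :
    powSource p (k + 1) (Fin.consEquiv (fun _ => U) u) (Fin.consEquiv (fun _ => V) v)
      (Fin.consEquiv (fun _ => Z) z) = prodSource p (powSource p k) u v z := by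
  simp [powSource, prodSource, Fin.prod_univ_succ, Fin.consEquiv]

end Power

section SingleLetter

variable {U V Z : Type} [Fintype U] [Fintype V] [Fintype Z] {p : U → V → Z → ℝ}

/-- Single-letterization: the information quantities of a kernel acting on `k` i.i.d. source
symbols are those of a family of likelihoods on one source symbol with total mass `k`. -/
theorem exists_singleLetter (hp : IsSource p) (k : ℕ) :
    ∀ (Y : Type) [Fintype Y] (g : Y → (Fin k → U) → ℝ), (∀ y u, 0 ≤ g y u) → ∑ y, g y = 1 →
    ∃ (W : Type) (_ : Fintype W) (h : W → U → ℝ), (∀ w u, 0 ≤ h w u) ∧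
      (∑ w, h w = fun _ => (k : ℝ)) ∧
      ∑ w, infoU p (h w) = ∑ y, infoU (powSource p k) (g y) ∧
      ∑ y, infoV (powSource p k) (g y) ≤ ∑ w, infoV p (h w) := by
  induction k with
  | zero =>
    intro Y _ g hg hsum
    refine ⟨Empty, inferInstance, fun w => w.elim, fun w => w.elim, ?_, ?_, ?_⟩
    · funext u; simp
    · refine (Fintype.sum_empty _).trans (Eq.symm (Finset.sum_eq_zero fun y _ => ?_))
      simp only [infoU, margZ, outZ, margUZ_powSource, Finset.univ_unique, Finset.sum_singleton,
        Finset.univ_eq_empty, Finset.prod_empty, one_mul, mul_one]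
      rcases eq_or_ne (g y default) 0 with h0 | h0
      · simp [h0]
      · simp [div_self h0]
    · refine (Finset.sum_eq_zero fun y _ => ?_).le.trans_eq (Fintype.sum_empty _).symm
      simp only [infoV, outVZ, outZ, margZ, margUZ_powSource, margVZ_powSource, powSource,
        Finset.univ_unique, Finset.sum_singleton,
        Finset.univ_eq_empty, Finset.prod_empty, one_mul, mul_one]
      rcases eq_or_ne (g y default) 0 with h0 | h0
      · simp [h0]
      · simp [div_self h0]
  | succ k ih =>
    intro Y _ g hg hsum
    set g' : Y → U × (Fin k → U) → ℝ := fun y u => g y (Fin.consEquiv (fun _ => U) u) with hg'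
    have hg'_nonneg : ∀ y u, 0 ≤ g' y u := fun y u => hg _ _
    have hsum' : ∑ y, g' y = 1 := by
      funext u
      simpa using congrFun hsum (Fin.consEquiv (fun _ => U) u)
    have eU : ∀ y, infoU (powSource p (k + 1)) (g y) =
        infoU (prodSource p (powSource p k)) (g' y) := fun y => by
      rw [← infoU_equiv (powSource p (k + 1)) (g y) (Fin.consEquiv (fun _ => U))
        (Fin.consEquiv (fun _ => V)) (Fin.consEquiv (fun _ => Z))]
      simp only [powSource_succ_cons]
      rfl
    have eV : ∀ y, infoV (powSource p (k + 1)) (g y) =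
        infoV (prodSource p (powSource p k)) (g' y) := fun y => by
      rw [← infoV_equiv (powSource p (k + 1)) (g y) (Fin.consEquiv (fun _ => U))
        (Fin.consEquiv (fun _ => V)) (Fin.consEquiv (fun _ => Z))]
      simp only [powSource_succ_cons]
      rfl
    obtain ⟨W, _, h, h1, h2, h3, h4⟩ := ih (Y × U × Z) (sndLik p g')
      (sndLik_nonneg hp hg'_nonneg) (sum_sndLik_add hp hsum')
    refine ⟨Y × (Fin k → Z) ⊕ W, inferInstance, Sum.elim (fstLik (powSource p k) g') h,
      ?_, ?_, ?_, ?_⟩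
    · rintro (w | w) u
      · exact fstLik_nonneg (hp.pow k) hg'_nonneg w u
      · exact h1 w u
    · rw [Fintype.sum_sum_type]
      simp only [Sum.elim_inl, Sum.elim_inr, h2, sum_fstLik (hp.pow k) hsum']
      funext u
      simp [add_comm]
    · rw [Fintype.sum_sum_type]
      simp only [Sum.elim_inl, Sum.elim_inr, eU, h3]
      rw [sum_infoU_prodSource hp (hp.pow k) hg'_nonneg]
    · rw [Fintype.sum_sum_type]
      simp only [Sum.elim_inl, Sum.elim_inr, eV]
      refine (sum_infoV_prodSource_le hp (hp.pow k) hg'_nonneg).trans ?_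
      gcongr

/-- Support lemma: a family of likelihoods of total mass `c` can be replaced by a kernel with
`|U| + 4` output symbols and the same (normalised) information quantities. -/
theorem exists_small_kernel (hp : IsSource p) {W : Type} [Fintype W] {h : W → U → ℝ}
    (hh : ∀ w u, 0 ≤ h w u) {c : ℝ} (hc : 0 < c) (hsum : ∑ w, h w = fun _ => c) :
    ∃ h' : Fin (Fintype.card U + 4) → U → ℝ, (∀ w u, 0 ≤ h' w u) ∧ ∑ w, h' w = 1 ∧
      c * ∑ w, infoU p (h' w) = ∑ w, infoU p (h w) ∧
      c * ∑ w, infoV p (h' w) = ∑ w, infoV p (h w) := by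
  classical
  have hW : Nonempty W := by
    by_contra hW
    rw [not_nonempty_iff] at hW
    obtain ⟨u⟩ := hp.nonempty.1
    have := congrFun hsum u
    simp at this
    exact hc.ne this
  set N : ℝ := (Fintype.card W : ℝ) with hN
  have hNpos : 0 < N := by rw [hN]; exact_mod_cast Fintype.card_pos
  set x : W → (U → ℝ) × ℝ × ℝ := fun w => (h w, infoU p (h w), infoV p (h w)) with hx
  have hmem : ∑ w, N⁻¹ • x w ∈ convexHull ℝ (Set.range x) :=
    (convex_convexHull ℝ _).sum_mem (fun _ _ => by positivity)
      (by simp [hN]) (fun w _ => subset_convexHull ℝ _ ⟨w, rfl⟩)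
  obtain ⟨ι, _, z, w, hz, hind, hw, hw1, hzw⟩ := eq_pos_convex_span_of_mem_convexHull hmem
  have hcard : Fintype.card ι ≤ Fintype.card (Fin (Fintype.card U + 4)) := by
    have := hind.card_le_finrank_succ
    have h2 := Submodule.finrank_le (vectorSpan ℝ (Set.range z))
    simp only [Module.finrank_prod, Module.finrank_fintype_fun_eq_card, Module.finrank_self] at h2
    rw [Fintype.card_fin]
    omega
  obtain ⟨e⟩ := Function.Embedding.nonempty_of_card_le hcard
  choose j hj using fun i => hz ⟨i, rfl⟩
  have hsc : ∑ i, (N * w i / c) • x (j i) = c⁻¹ • ∑ w, x w := by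
    have h1 : ∑ w, x w = N • ∑ w, N⁻¹ • x w := by
      rw [← Finset.smul_sum, smul_smul, mul_inv_cancel₀ hNpos.ne', one_smul]
    rw [h1, ← hzw, smul_smul, Finset.smul_sum]
    refine Finset.sum_congr rfl fun i _ => ?_
    rw [hj, smul_smul]
    congr 1
    ring
  set h' : Fin (Fintype.card U + 4) → U → ℝ :=
    Function.extend e (fun i u => (N * w i / c) * h (j i) u) (fun _ _ => 0) with hh'
  have hsumF : ∀ {E : Type} [AddCommMonoid E] (F : (U → ℝ) → E), F (fun _ => 0) = 0 →
      ∑ a, F (h' a) = ∑ i, F (fun u => (N * w i / c) * h (j i) u) := by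
    intro E _ F hF
    rw [← Finset.sum_subset (Finset.subset_univ (Finset.univ.map e)), Finset.sum_map]
    · exact Finset.sum_congr rfl fun i _ => by rw [hh', e.injective.extend_apply]
    · intro a _ ha
      rw [hh', Function.extend_apply', hF]
      rintro ⟨i, rfl⟩
      simp at ha
  refine ⟨h', ?_, ?_, ?_, ?_⟩
  · intro a u
    by_cases ha : ∃ i, e i = a
    · obtain ⟨i, rfl⟩ := ha
      rw [hh', e.injective.extend_apply]
      have := hw i
      have := hh (j i) u
      positivity
    · rw [hh', Function.extend_apply' _ _ _ ha]
  · rw [hsumF (fun h => h) rfl]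
    have := congrArg Prod.fst hsc
    simp only [hx, Prod.smul_mk, Prod.fst_sum] at this
    refine Eq.trans ?_ (this.trans ?_)
    · rfl
    · rw [Prod.smul_fst, Prod.fst_sum, hsum]
      funext u
      simp [hc.ne']
  · rw [hsumF (infoU p) infoU_zero]
    have := congrArg (fun a => a.2.1) hsc
    simp only [hx, Prod.smul_mk, Prod.snd_sum, Prod.fst_sum, smul_eq_mul, Prod.smul_snd,
      Prod.smul_fst] at this
    simp only [infoU_smul, this]
    field_simp
  · rw [hsumF (infoV p) infoV_zero]
    have := congrArg (fun a => a.2.2) hsc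
    simp only [hx, Prod.smul_mk, Prod.snd_sum, smul_eq_mul, Prod.smul_snd] at this
    simp only [infoV_smul, this]
    field_simp

end SingleLetter

section ProductWeights

variable {ι α : Type*} [Fintype ι] [DecidableEq ι] [Fintype α] {c : ι → α → ℝ}

lemma sum_prod_eq_one (hc : ∀ i, ∑ a, c i a = 1) : ∑ y : ι → α, ∏ i, c i (y i) = 1 := by
  rw [← Fintype.prod_sum]
  simp [hc]

lemma sum_prod_mul (hc : ∀ i, ∑ a, c i a = 1) (j : ι) (h : α → ℝ) :
    ∑ y : ι → α, (∏ i, c i (y i)) * h (y j) = ∑ a, c j a * h a := by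
  have e : ∀ y : ι → α, (∏ i, c i (y i)) * h (y j) =
      ∏ i, c i (y i) * (if i = j then h (y i) else 1) := fun y => by
    rw [Finset.prod_mul_distrib, Finset.prod_ite_eq' Finset.univ j (fun i => h (y i))]
    simp
  simp only [e]
  rw [← Fintype.prod_sum (fun i a => c i a * (if i = j then h a else 1)),
    Finset.prod_eq_single j]
  · simp
  · intro i _ hij
    simp [hij, hc]
  · simp

lemma sum_prod_mul_mul (hc : ∀ i, ∑ a, c i a = 1) {j j' : ι} (hj : j ≠ j') (h h' : α → ℝ) :
    ∑ y : ι → α, (∏ i, c i (y i)) * (h (y j) * h' (y j')) =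
      (∑ a, c j a * h a) * ∑ a, c j' a * h' a := by
  have e : ∀ y : ι → α, (∏ i, c i (y i)) * (h (y j) * h' (y j')) =
      ∏ i, c i (y i) * ((if i = j then h (y i) else 1) * (if i = j' then h' (y i) else 1)) :=
    fun y => by
    rw [Finset.prod_mul_distrib, Finset.prod_mul_distrib,
      Finset.prod_ite_eq' Finset.univ j (fun i => h (y i)),
      Finset.prod_ite_eq' Finset.univ j' (fun i => h' (y i))]
    simp
  simp only [e]
  rw [← Fintype.prod_sum (fun i a => c i a *
    ((if i = j then h a else 1) * (if i = j' then h' a else 1)))]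
  have e2 : ∀ i, ∑ a, c i a * ((if i = j then h a else 1) * (if i = j' then h' a else 1)) =
      (if i = j then ∑ a, c i a * h a else 1) * (if i = j' then ∑ a, c i a * h' a else 1) := by
    intro i
    rcases eq_or_ne i j with rfl | h1
    · simp [hj]
    · rcases eq_or_ne i j' with rfl | h2
      · simp [h1]
      · simp [h1, h2, hc]
  simp only [e2]
  rw [Finset.prod_mul_distrib, Finset.prod_ite_eq' Finset.univ j (fun i => ∑ a, c i a * h a),
    Finset.prod_ite_eq' Finset.univ j' (fun i => ∑ a, c i a * h' a)]
  simp

end ProductWeights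

section Channel

variable {X Y : Type*} [Fintype X] [Fintype Y]

/-- Mutual information (in nats) of input `q` and channel `Ch`. -/
def chanInfo (q : X → ℝ) (Ch : X → Y → ℝ) : ℝ :=
  ∑ x, ∑ y, q x * Ch x y * log (Ch x y / ∑ a, q a * Ch a y)

variable {q : X → ℝ} {Ch : X → Y → ℝ}

lemma mutualInfo_eq_chanInfo (hCh : IsKernel Ch) :
    mutualInfo (fun xy : X × Y => q xy.1 * Ch xy.1 xy.2) = chanInfo q Ch / log 2 := by
  simp only [mutualInfo, chanInfo, Fintype.sum_prod_type, Finset.sum_div, ← Finset.mul_sum,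
    (hCh _).2, mul_one]
  refine Finset.sum_congr rfl fun x _ => Finset.sum_congr rfl fun y _ => ?_
  rcases eq_or_ne (q x) 0 with h | h
  · simp [h]
  · rw [mul_div_mul_left _ _ h, logb, mul_div_assoc]

lemma neg_mul_log_le_one {x : ℝ} (hx : 0 ≤ x) : x * log (1 / x) ≤ 1 := by
  rcases hx.eq_or_lt with rfl | h
  · simp
  · have := log_le_sub_one_of_pos (one_div_pos.2 h)
    calc x * log (1 / x) ≤ x * (1 / x - 1) := by gcongr
      _ = 1 - x := by field_simp
      _ ≤ 1 := by linarith

lemma chanInfo_le (hq : IsPMF q) (hCh : IsKernel Ch) :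
    chanInfo q Ch ≤ Fintype.card X * Fintype.card Y := by
  have : ∀ x y, q x * Ch x y * log (Ch x y / ∑ a, q a * Ch a y) ≤ 1 := by
    intro x y
    have hq0 := hq.1
    have hC0 : ∀ x y, 0 ≤ Ch x y := fun x y => (hCh x).1 y
    have hC1 : Ch x y ≤ 1 := (hCh x).2 ▸ Finset.single_le_sum (fun y _ => hC0 x y)
      (Finset.mem_univ y)
    rcases (mul_nonneg (hq0 x) (hC0 x y)).eq_or_lt with h0 | h0
    · rw [← h0]; simp
    · have h1 : 0 < q x := pos_of_mul_pos_left h0 (hC0 x y)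
      have h2 : 0 < Ch x y := pos_of_mul_pos_right h0 (hq0 x)
      have h3 : q x * Ch x y ≤ ∑ a, q a * Ch a y := Finset.single_le_sum
        (f := fun a => q a * Ch a y) (fun a _ => mul_nonneg (hq0 a) (hC0 a y)) (Finset.mem_univ x)
      have h3' : 0 < ∑ a, q a * Ch a y := lt_of_lt_of_le h0 h3
      have hqx1 : q x ≤ 1 := hq.2 ▸ Finset.single_le_sum (fun y _ => hq0 y) (Finset.mem_univ x)
      have h4 : log (Ch x y / ∑ a, q a * Ch a y) ≤ log (1 / q x) := by
        apply log_le_log (by positivity)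
        rw [div_le_div_iff₀ h3' h1]
        linarith
      have h5 : 0 ≤ log (1 / q x) := log_nonneg (by rw [le_div_iff₀ h1]; linarith)
      calc _ ≤ q x * Ch x y * log (1 / q x) := by gcongr
        _ ≤ q x * 1 * log (1 / q x) := by gcongr
        _ ≤ 1 := by rw [mul_one]; exact neg_mul_log_le_one h1.le
  calc chanInfo q Ch ≤ ∑ _x : X, ∑ _y : Y, (1 : ℝ) :=
        Finset.sum_le_sum fun x _ => Finset.sum_le_sum fun y _ => this x y
    _ = _ := by simp

lemma bddAbove_mutualInfo (hCh : IsKernel Ch) : BddAbove {c | ∃ q : X → ℝ, IsPMF q ∧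
    c = mutualInfo (fun xy : X × Y => q xy.1 * Ch xy.1 xy.2)} := by
  refine ⟨Fintype.card X * Fintype.card Y / log 2, ?_⟩
  rintro _ ⟨q, hq, rfl⟩
  rw [mutualInfo_eq_chanInfo hCh]
  have := log_pos one_lt_two
  have := chanInfo_le hq hCh
  gcongr

lemma chanInfo_le_capacity (hq : IsPMF q) (hCh : IsKernel Ch) :
    chanInfo q Ch ≤ capacity Ch * log 2 := by
  rw [← div_le_iff₀ (log_pos one_lt_two), ← mutualInfo_eq_chanInfo hCh]
  exact le_csSup (bddAbove_mutualInfo hCh) ⟨q, hq, rfl⟩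

lemma exists_lt_chanInfo (hCh : IsKernel Ch) {c : ℝ} (hc0 : 0 ≤ c) (hc : c < capacity Ch) :
    ∃ q : X → ℝ, IsPMF q ∧ c * log 2 < chanInfo q Ch := by
  have hne : {c | ∃ q : X → ℝ, IsPMF q ∧
      c = mutualInfo (fun xy : X × Y => q xy.1 * Ch xy.1 xy.2)}.Nonempty := by
    by_contra h
    rw [Set.not_nonempty_iff_eq_empty] at h
    rw [capacity, h, Real.sSup_empty] at hc
    exact hc0.not_gt hc
  obtain ⟨_, ⟨q, hq, rfl⟩, h⟩ := exists_lt_of_lt_csSup hne hc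
  refine ⟨q, hq, ?_⟩
  rwa [mutualInfo_eq_chanInfo hCh, lt_div_iff₀ (log_pos one_lt_two)] at h

/-- Likelihood of the channel output word `y` when the message `u` is encoded by `f`. -/
def chanLik {U : Type*} {n : ℕ} (f : U → (Fin n → X) → ℝ) (Ch : X → Y → ℝ) (y : Fin n → Y)
    (u : U) : ℝ := ∑ x, f u x * ∏ j, Ch (x j) (y j)

variable {U V Z : Type*} [Fintype U] [Fintype V] [Fintype Z] {n : ℕ}
  {f : U → (Fin n → X) → ℝ} {p : U → V → Z → ℝ}

lemma chanLik_nonneg (hf : IsKernel f) (hCh : IsKernel Ch) (y : Fin n → Y) (u : U) :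
    0 ≤ chanLik f Ch y u :=
  Finset.sum_nonneg fun x _ => mul_nonneg ((hf u).1 x) (Finset.prod_nonneg fun _ _ => (hCh _).1 _)

lemma sum_chanLik (hf : IsKernel f) (hCh : IsKernel Ch) :
    ∑ y, chanLik f Ch y = 1 := by
  funext u
  simp only [Finset.sum_apply, chanLik]
  rw [Finset.sum_comm]
  simp only [← Finset.mul_sum]
  rw [Pi.one_apply, ← (hf u).2]
  refine Finset.sum_congr rfl fun x _ => ?_
  rw [sum_prod_eq_one (c := fun j => Ch (x j)) fun j => (hCh _).2, mul_one]

/-- Converse to the channel coding theorem: the conditional information conveyed by the channel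
output is at most `n` times the capacity. -/
theorem sum_infoU_chanLik_le (hp : IsSource p) (hf : IsKernel f) (hCh : IsKernel Ch) :
    ∑ y, infoU p (chanLik f Ch y) ≤ n * (capacity Ch * log 2) := by
  set r : (Fin n → X) → ℝ := fun x => ∑ u, ∑ z, margUZ p u z * f u x with hr
  set pj : Fin n → X → ℝ := fun j a => ∑ x, ind (x j = a) * r x with hpj
  set qj : Fin n → Y → ℝ := fun j b => ∑ a, pj j a * Ch a b with hqj
  have hCh0 : ∀ x y, 0 ≤ Ch x y := fun x y => (hCh x).1 y
  have hr0 : ∀ x, 0 ≤ r x := fun x => Finset.sum_nonneg fun u _ => Finset.sum_nonneg fun z _ =>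
    mul_nonneg (hp.posUZ u z).le ((hf u).1 x)
  have pj_sum : ∀ j (F : X → ℝ), ∑ a, pj j a * F a = ∑ x, r x * F (x j) := by
    intro j F
    simp only [hpj, Finset.sum_mul]
    rw [Finset.sum_comm]
    refine Finset.sum_congr rfl fun x _ => ?_
    rw [Finset.sum_eq_single (x j)]
    · rw [ind_of rfl, one_mul]
    · intro a _ ha
      rw [ind_of_not ha.symm]; ring
    · simp
  have hr1 : ∑ x, r x = 1 := by
    simp only [hr]
    rw [Finset.sum_comm, ← hp.sum_margZ]
    simp only [margZ]
    refine Eq.trans ?_ Finset.sum_comm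
    refine Finset.sum_congr rfl fun u _ => ?_
    rw [Finset.sum_comm]
    refine Finset.sum_congr rfl fun z _ => ?_
    rw [← Finset.mul_sum, (hf u).2, mul_one]
  have hpmf : ∀ j, IsPMF (pj j) := fun j => by
    refine ⟨fun a => Finset.sum_nonneg fun x _ => mul_nonneg (ind_nonneg _) (hr0 x), ?_⟩
    have := pj_sum j fun _ => 1
    simpa [hr1] using this
  have qj1 : ∀ j, ∑ b, qj j b = 1 := fun j => by
    simp only [hqj]
    rw [Finset.sum_comm]
    simp only [← Finset.mul_sum, (hCh _).2, mul_one, (hpmf j).2]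
  have qj0 : ∀ j b, 0 ≤ qj j b := fun j b =>
    Finset.sum_nonneg fun a _ => mul_nonneg ((hpmf j).1 a) (hCh0 a b)
  set g := chanLik f Ch with hg
  have hg0 : ∀ y u, 0 ≤ g y u := chanLik_nonneg hf hCh
  set J : U × Z × (Fin n → X) × (Fin n → Y) → ℝ := fun x =>
    margUZ p x.1 x.2.1 * (f x.1 x.2.2.1 * ∏ j, Ch (x.2.2.1 j) (x.2.2.2 j)) with hJ
  have J0 : ∀ x, 0 ≤ J x := fun x => mul_nonneg (hp.posUZ _ _).le
    (mul_nonneg ((hf _).1 _) (Finset.prod_nonneg fun _ _ => hCh0 _ _))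
  have e1 : ∑ y, infoU p (g y) = ∑ x, J x *
      log (g x.2.2.2 x.1 * margZ p x.2.1 / outZ p (g x.2.2.2) x.2.1) := by
    simp only [infoU, hJ, Fintype.sum_prod_type]
    rw [Finset.sum_comm]
    refine Finset.sum_congr rfl fun u _ => ?_
    rw [Finset.sum_comm]
    refine Finset.sum_congr rfl fun z _ => ?_
    refine Eq.trans ?_ Finset.sum_comm
    refine Finset.sum_congr rfl fun y _ => ?_
    conv_lhs => rw [hg, chanLik, Finset.mul_sum, Finset.sum_mul]
    rfl
  have e2 : ∑ j, chanInfo (pj j) Ch = ∑ x, J x *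
      log (∏ j, (Ch (x.2.2.1 j) (x.2.2.2 j) / qj j (x.2.2.2 j))) := by
    have : ∀ x, J x * log (∏ j, (Ch (x.2.2.1 j) (x.2.2.2 j) / qj j (x.2.2.2 j))) =
        ∑ j, J x * log (Ch (x.2.2.1 j) (x.2.2.2 j) / qj j (x.2.2.2 j)) := by
      intro x
      rcases (J0 x).eq_or_lt with h0 | h0
      · simp [← h0]
      · have h1 : 0 < ∏ j, Ch (x.2.2.1 j) (x.2.2.2 j) :=
          pos_of_mul_pos_right (pos_of_mul_pos_right h0 (hp.posUZ _ _).le) ((hf _).1 _)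
        have h2 : 0 < r x.2.2.1 := by
          have h3 : 0 < f x.1 x.2.2.1 := pos_of_mul_pos_left
            (pos_of_mul_pos_right h0 (hp.posUZ _ _).le)
            (Finset.prod_nonneg fun _ _ => hCh0 _ _)
          exact Finset.sum_pos' (fun u _ => Finset.sum_nonneg fun z _ =>
            mul_nonneg (hp.posUZ u z).le ((hf u).1 _)) ⟨x.1, Finset.mem_univ _,
            Finset.sum_pos' (fun z _ => mul_nonneg (hp.posUZ _ z).le ((hf _).1 _))
            ⟨x.2.1, Finset.mem_univ _, mul_pos (hp.posUZ _ _) h3⟩⟩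
        rw [log_prod, Finset.mul_sum]
        intro j _
        have h4 : 0 < Ch (x.2.2.1 j) (x.2.2.2 j) :=
          lt_of_le_of_ne (hCh0 _ _) (Finset.prod_ne_zero_iff.1 h1.ne' j (Finset.mem_univ _)).symm
        have h5 : 0 < qj j (x.2.2.2 j) := by
          simp only [hqj, pj_sum j fun a => Ch a (x.2.2.2 j)]
          exact Finset.sum_pos' (fun x _ => mul_nonneg (hr0 x) (hCh0 _ _))
            ⟨x.2.2.1, Finset.mem_univ _, mul_pos h2 h4⟩
        positivity
    simp only [this]
    rw [Finset.sum_comm]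
    refine Finset.sum_congr rfl fun j _ => ?_
    have e3 : chanInfo (pj j) Ch = ∑ x, r x * ∑ b, Ch (x j) b * log (Ch (x j) b / qj j b) := by
      rw [← pj_sum j fun a => ∑ b, Ch a b * log (Ch a b / qj j b)]
      simp only [chanInfo, Finset.mul_sum, mul_assoc]
      rfl
    rw [e3]
    simp only [hJ, Fintype.sum_prod_type]
    simp only [hr, Finset.sum_mul]
    rw [Finset.sum_comm]
    refine Finset.sum_congr rfl fun u _ => ?_
    rw [Finset.sum_comm]
    refine Finset.sum_congr rfl fun z _ => Finset.sum_congr rfl fun x _ => ?_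
    rw [← sum_prod_mul (c := fun j => Ch (x j)) (fun j => (hCh _).2) j
      (fun b => log (Ch (x j) b / qj j b)), Finset.mul_sum]
    exact Finset.sum_congr rfl fun y _ => by ring
  have pos : ∀ u z x y, 0 < J (u, z, x, y) → 0 < g y u ∧ 0 < outZ p (g y) z ∧
      0 < ∏ j, (Ch (x j) (y j) / qj j (y j)) ∧ 0 < ∏ j, qj j (y j) ∧
      0 < ∏ j, Ch (x j) (y j) := by
    intro u z x y h0
    have h1 : 0 < ∏ j, Ch (x j) (y j) :=
      pos_of_mul_pos_right (pos_of_mul_pos_right h0 (hp.posUZ _ _).le) ((hf _).1 _)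
    have h3 : 0 < f u x := pos_of_mul_pos_left
      (pos_of_mul_pos_right h0 (hp.posUZ _ _).le) (Finset.prod_nonneg fun _ _ => hCh0 _ _)
    have h2 : 0 < r x := Finset.sum_pos' (fun u _ => Finset.sum_nonneg fun z _ =>
        mul_nonneg (hp.posUZ u z).le ((hf u).1 _)) ⟨u, Finset.mem_univ _,
        Finset.sum_pos' (fun z _ => mul_nonneg (hp.posUZ _ z).le ((hf _).1 _))
        ⟨z, Finset.mem_univ _, mul_pos (hp.posUZ _ _) h3⟩⟩
    have h4 : ∀ j, 0 < Ch (x j) (y j) := fun j =>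
      lt_of_le_of_ne (hCh0 _ _) (Finset.prod_ne_zero_iff.1 h1.ne' j (Finset.mem_univ _)).symm
    have h5 : ∀ j, 0 < qj j (y j) := fun j => by
      simp only [hqj, pj_sum j fun a => Ch a (y j)]
      exact Finset.sum_pos' (fun x _ => mul_nonneg (hr0 x) (hCh0 _ _))
        ⟨x, Finset.mem_univ _, mul_pos h2 (h4 j)⟩
    have h6 : 0 < g y u := Finset.sum_pos' (fun x _ => mul_nonneg ((hf u).1 x)
      (Finset.prod_nonneg fun _ _ => hCh0 _ _)) ⟨x, Finset.mem_univ _, mul_pos h3 h1⟩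
    exact ⟨h6, outZ_pos hp (hg0 y) h6 z, Finset.prod_pos fun j _ => div_pos (h4 j) (h5 j),
      Finset.prod_pos fun j _ => h5 j, h1⟩
  have key := gibbs (p := J) (ρ := fun x => (∏ j, (Ch (x.2.2.1 j) (x.2.2.2 j) /
      qj j (x.2.2.2 j))) / (g x.2.2.2 x.1 * margZ p x.2.1 / outZ p (g x.2.2.2) x.2.1)) J0
    (fun ⟨u, z, x, y⟩ hx => by
      obtain ⟨c1, c2, c3, -⟩ := pos _ _ _ _ hx
      have := hp.posZ z
      dsimp only
      positivity) (by
    have hJsum : ∑ x, J x = 1 := by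
      simp only [hJ, Fintype.sum_prod_type]
      rw [← hr1]
      simp only [hr]
      refine Eq.trans ?_ Finset.sum_comm
      refine Finset.sum_congr rfl fun u _ => ?_
      refine Eq.trans ?_ Finset.sum_comm
      refine Finset.sum_congr rfl fun z _ => Finset.sum_congr rfl fun x _ => ?_
      rw [← Finset.mul_sum, ← Finset.mul_sum,
        sum_prod_eq_one (c := fun j => Ch (x j)) fun j => (hCh _).2, mul_one]
    rw [hJsum]
    have hq1 : ∑ z, ∑ y : Fin n → Y, margZ p z * ∏ j, qj j (y j) = 1 := by
      simp only [← Finset.mul_sum, sum_prod_eq_one qj1, mul_one, hp.sum_margZ]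
    rw [← hq1]
    simp only [Fintype.sum_prod_type]
    rw [Finset.sum_comm]
    refine Finset.sum_le_sum fun z _ => ?_
    have : ∀ u : U, ∑ x : Fin n → X, ∑ y : Fin n → Y, J (u, z, x, y) /
        ((∏ j, (Ch (x j) (y j) / qj j (y j))) / (g y u * margZ p z / outZ p (g y) z)) ≤
        ∑ y : Fin n → Y, margUZ p u z * g y u *
          ((margZ p z * ∏ j, qj j (y j)) / outZ p (g y) z) := by
      intro u
      rw [Finset.sum_comm]
      refine Finset.sum_le_sum fun y _ => ?_
      have hz := hp.posZ z
      calc _ ≤ ∑ x : Fin n → X, margUZ p u z * f u x *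
            (g y u * (margZ p z * ∏ j, qj j (y j)) / outZ p (g y) z) := by
            refine Finset.sum_le_sum fun x _ => ?_
            rcases (J0 (u, z, x, y)).eq_or_lt with h0 | h0
            · rw [← h0, zero_div]
              exact mul_nonneg (mul_nonneg (hp.posUZ _ _).le ((hf u).1 x))
                (div_nonneg (mul_nonneg (hg0 _ _) (mul_nonneg hz.le
                  (Finset.prod_nonneg fun _ _ => qj0 _ _))) (outZ_nonneg hp (hg0 y) z))
            · obtain ⟨c1, c2, c3, c4, c5⟩ := pos _ _ _ _ h0
              apply le_of_eq
              rw [Finset.prod_div_distrib]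
              simp only [hJ]
              field_simp
        _ = _ := by
            rw [← Finset.sum_mul, ← Finset.mul_sum, (hf u).2]
            ring
    refine (Finset.sum_le_sum fun u _ => this u).trans ?_
    rw [Finset.sum_comm]
    refine Finset.sum_le_sum fun y _ => ?_
    rw [← Finset.sum_mul]
    change outZ p (g y) z * _ ≤ _
    rcases (outZ_nonneg hp (hg0 y) z).eq_or_lt with h0 | h0
    · rw [← h0, zero_mul]
      exact mul_nonneg (hp.posZ z).le (Finset.prod_nonneg fun _ _ => qj0 _ _)
    · apply le_of_eq; field_simp)
  have hle : ∑ y, infoU p (g y) ≤ ∑ j, chanInfo (pj j) Ch := by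
    rw [e1, e2, ← sub_nonneg, ← Finset.sum_sub_distrib]
    refine key.trans_eq (Finset.sum_congr rfl fun ⟨u, z, x, y⟩ _ => ?_)
    rcases (J0 (u, z, x, y)).eq_or_lt with h0 | h0
    · simp [← h0]
    · obtain ⟨c1, c2, c3, c4, c5⟩ := pos _ _ _ _ h0
      have hz := hp.posZ z
      dsimp only
      rw [← mul_sub, ← log_div c3.ne' (by positivity)]
  refine hle.trans ?_
  calc _ ≤ ∑ _j : Fin n, capacity Ch * log 2 :=
        Finset.sum_le_sum fun j _ => chanInfo_le_capacity (hpmf j) hCh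
    _ = _ := by simp

end Channel

section SecondMoment

variable {ι α : Type*} [Fintype ι] [DecidableEq ι] [Fintype α] {c : ι → α → ℝ}

lemma sum_prod_sq (hc : ∀ i, ∑ a, c i a = 1) (h : ι → α → ℝ) (h0 : ∀ i, ∑ a, c i a * h i a = 0) :
    ∑ y : ι → α, (∏ i, c i (y i)) * (∑ i, h i (y i)) ^ 2 = ∑ i, ∑ a, c i a * h i a ^ 2 := by
  have : ∀ y : ι → α, (∏ i, c i (y i)) * (∑ i, h i (y i)) ^ 2 =
      ∑ i, ∑ j, (∏ i, c i (y i)) * (h i (y i) * h j (y j)) := fun y => by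
    rw [sq, Finset.sum_mul_sum]
    simp only [Finset.mul_sum]
  simp only [this]
  rw [Finset.sum_comm]
  refine Finset.sum_congr rfl fun i _ => ?_
  rw [Finset.sum_comm, Finset.sum_eq_single i]
  · rw [← sum_prod_mul hc i fun a => h i a ^ 2]
    exact Finset.sum_congr rfl fun y _ => by ring
  · intro j _ hj
    rw [sum_prod_mul_mul hc hj.symm (h i) (h j), h0, zero_mul]
  · simp

/-- The soft covering lemma, in expected `L¹` form. -/
lemma soft_covering {M : ℕ} (hM : 0 < M) {w : α → ℝ} (hw : IsPMF w) {φ : α → ℝ}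
    (hφ : ∀ a, 0 ≤ φ a) (hφ1 : ∑ a, w a * φ a = 1) {b l : ℝ} (hb : 0 ≤ b) (hl : 0 < l) :
    ∑ y : Fin M → α, (∏ i, w (y i)) * |1 - ∑ m, φ (y m) / M| ≤
      2 * ∑ a, w a * φ a * ind (b < φ a) + (l + b / (M * l)) := by
  have hM' : (0 : ℝ) < M := by exact_mod_cast hM
  set φ₁ : α → ℝ := fun a => φ a * ind (φ a ≤ b) with h1
  set φ₂ : α → ℝ := fun a => φ a * ind (b < φ a) with h2
  have h12 : ∀ a, φ a = φ₁ a + φ₂ a := fun a => by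
    simp only [h1, h2]
    rcases le_or_gt (φ a) b with h | h
    · rw [ind_of h, ind_of_not h.not_gt]; ring
    · rw [ind_of h, ind_of_not h.not_ge]; ring
  have h20 : ∀ a, 0 ≤ φ₂ a := fun a => mul_nonneg (hφ a) (ind_nonneg _)
  have h10 : ∀ a, 0 ≤ φ₁ a := fun a => mul_nonneg (hφ a) (ind_nonneg _)
  set μ₁ := ∑ a, w a * φ₁ a with hμ1
  set μ₂ := ∑ a, w a * φ₂ a with hμ2
  have hμ : μ₁ + μ₂ = 1 := by
    rw [hμ1, hμ2, ← Finset.sum_add_distrib, ← hφ1]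
    exact Finset.sum_congr rfl fun a _ => by rw [h12 a]; ring
  have hμ10 : 0 ≤ μ₁ := Finset.sum_nonneg fun a _ => mul_nonneg (hw.1 a) (h10 a)
  have hμ20 : 0 ≤ μ₂ := Finset.sum_nonneg fun a _ => mul_nonneg (hw.1 a) (h20 a)
  have hκ : ∀ y : Fin M → α, 0 ≤ ∏ i, w (y i) := fun y => Finset.prod_nonneg fun _ _ => hw.1 _
  have hκ1 : ∑ y : Fin M → α, ∏ i, w (y i) = 1 := sum_prod_eq_one fun _ => hw.2
  have hpt : ∀ y : Fin M → α, |1 - ∑ m, φ (y m) / M| ≤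
      l + (∑ m, (φ₁ (y m) - μ₁) / M) ^ 2 / l + μ₂ + ∑ m, φ₂ (y m) / M := by
    intro y
    set x := ∑ m, (φ₁ (y m) - μ₁) / M with hx
    have e : 1 - ∑ m, φ (y m) / M = -x + μ₂ - ∑ m, φ₂ (y m) / M := by
      have : x = ∑ m, φ₁ (y m) / M - μ₁ := by
        rw [hx]
        simp only [sub_div, Finset.sum_sub_distrib]
        simp
        field_simp
      rw [this, ← hμ]
      simp only [h12, add_div, Finset.sum_add_distrib]
      ring
    have h3 : |x| ≤ l + x ^ 2 / l := by
      rw [← sub_nonneg]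
      have : l + x ^ 2 / l - |x| = ((|x| - l / 2) ^ 2 + 3 / 4 * l ^ 2) / l := by
        field_simp
        rw [← sq_abs x]
        ring
      rw [this]; positivity
    have h4 : 0 ≤ ∑ m, φ₂ (y m) / M := Finset.sum_nonneg fun m _ => div_nonneg (h20 _) hM'.le
    have := neg_abs_le x
    have := le_abs_self x
    rw [e, abs_le]
    constructor <;> linarith
  have hS2 : ∑ y : Fin M → α, (∏ i, w (y i)) * ∑ m, φ₂ (y m) / M = μ₂ := by
    simp only [Finset.mul_sum]
    rw [Finset.sum_comm]
    have : ∀ m : Fin M, ∑ y : Fin M → α, (∏ i, w (y i)) * (φ₂ (y m) / M) = μ₂ / M := fun m => by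
      rw [sum_prod_mul (c := fun _ => w) (fun _ => hw.2) m fun a => φ₂ a / M, hμ2, Finset.sum_div]
      exact Finset.sum_congr rfl fun a _ => by ring
    simp only [this]
    simp
    field_simp
  have hvar : ∑ y : Fin M → α, (∏ i, w (y i)) * (∑ m, (φ₁ (y m) - μ₁) / M) ^ 2 ≤ b / M := by
    rw [sum_prod_sq (c := fun _ => w) (fun _ => hw.2) (fun _ a => (φ₁ a - μ₁) / M)]
    · have : ∑ a, w a * ((φ₁ a - μ₁) / M) ^ 2 ≤ b / M ^ 2 := by
        have e : ∑ a, w a * ((φ₁ a - μ₁) / M) ^ 2 = (∑ a, w a * φ₁ a ^ 2 - μ₁ ^ 2) / M ^ 2 := by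
          have : ∀ a, w a * ((φ₁ a - μ₁) / M) ^ 2 =
              (w a * φ₁ a ^ 2 - 2 * μ₁ * (w a * φ₁ a) + μ₁ ^ 2 * w a) / M ^ 2 := fun a => by
            field_simp; ring
          simp only [this]
          rw [← Finset.sum_div, Finset.sum_add_distrib, Finset.sum_sub_distrib, ← Finset.mul_sum,
            ← Finset.mul_sum, ← hμ1, hw.2]
          ring
        rw [e]
        gcongr
        have h5 : ∑ a, w a * φ₁ a ^ 2 ≤ b * μ₁ := by
          rw [hμ1, Finset.mul_sum]
          refine Finset.sum_le_sum fun a _ => ?_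
          have : φ₁ a ^ 2 ≤ b * φ₁ a := by
            simp only [h1]
            rcases le_or_gt (φ a) b with h | h
            · rw [ind_of h, mul_one, sq]
              exact mul_le_mul_of_nonneg_right h (hφ a)
            · rw [ind_of_not h.not_ge]; simp
          nlinarith [hw.1 a]
        nlinarith
      calc _ = M * ∑ a, w a * ((φ₁ a - μ₁) / M) ^ 2 := by simp
        _ ≤ M * (b / M ^ 2) := by gcongr
        _ = b / M := by field_simp
    · intro _
      have : ∀ a, w a * ((φ₁ a - μ₁) / M) = (w a * φ₁ a - μ₁ * w a) / M := fun a => by ring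
      simp only [this]
      rw [← Finset.sum_div, Finset.sum_sub_distrib, ← Finset.mul_sum, hw.2, ← hμ1]
      simp
  calc _ ≤ ∑ y : Fin M → α, (∏ i, w (y i)) *
        (l + (∑ m, (φ₁ (y m) - μ₁) / M) ^ 2 / l + μ₂ + ∑ m, φ₂ (y m) / M) :=
        Finset.sum_le_sum fun y _ => mul_le_mul_of_nonneg_left (hpt y) (hκ y)
    _ = (l + μ₂) * (∑ y : Fin M → α, ∏ i, w (y i)) +
        (∑ y : Fin M → α, (∏ i, w (y i)) * (∑ m, (φ₁ (y m) - μ₁) / M) ^ 2) / l +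
        ∑ y : Fin M → α, (∏ i, w (y i)) * ∑ m, φ₂ (y m) / M := by
        rw [Finset.mul_sum, Finset.sum_div, ← Finset.sum_add_distrib, ← Finset.sum_add_distrib]
        exact Finset.sum_congr rfl fun y _ => by ring
    _ ≤ (l + μ₂) * 1 + (b / M) / l + μ₂ := by
        rw [hS2, hκ1]
        gcongr
    _ = _ := by
        rw [div_div]
        have : μ₂ = ∑ a, w a * φ a * ind (b < φ a) :=
          Finset.sum_congr rfl fun a _ => by simp only [h2]; ring
        rw [← this]; ring

end SecondMoment

section Decoding

variable {α Ω : Type*} [Fintype α] [Fintype Ω]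

/-- The threshold decoder succeeds: exactly one codeword passes, and it is good. -/
def Decodes {M : ℕ} (pass good : α → Ω → Prop) (y : Fin M → α) (o : Ω) : Prop :=
  ∃ m, pass (y m) o ∧ (∀ m', pass (y m') o → m' = m) ∧ good (y m) o

lemma ind_not_decodes_le {M : ℕ} (pass good : α → Ω → Prop) (y : Fin M → α) (o : Ω) (m : Fin M) :
    ind (¬Decodes pass good y o) ≤ ind (¬pass (y m) o) + ind (¬good (y m) o) +
      ∑ m', if m' = m then 0 else ind (pass (y m') o) := by
  have hs : ∀ m', 0 ≤ (if m' = m then 0 else ind (pass (y m') o)) := fun m' => by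
    split_ifs
    · exact le_rfl
    · exact ind_nonneg _
  have hs' := Finset.sum_nonneg fun m' (_ : m' ∈ Finset.univ) => hs m'
  have n1 := ind_nonneg (¬pass (y m) o)
  have n2 := ind_nonneg (¬good (y m) o)
  by_cases h1 : pass (y m) o
  swap
  · rw [ind_of h1]
    have := ind_le_one (¬Decodes pass good y o)
    linarith
  by_cases h2 : good (y m) o
  swap
  · rw [ind_of h2]
    have := ind_le_one (¬Decodes pass good y o)
    linarith
  by_cases h3 : ∀ m', pass (y m') o → m' = m
  · rw [ind_of_not (not_not.2 (show Decodes pass good y o from ⟨m, h1, h3, h2⟩))]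
    linarith
  · push Not at h3
    obtain ⟨m', h4, h5⟩ := h3
    have h6 := Finset.single_le_sum (fun m' (_ : m' ∈ Finset.univ) => hs m') (Finset.mem_univ m')
    rw [if_neg h5, ind_of h4] at h6
    have := ind_le_one (¬Decodes pass good y o)
    linarith

/-- Expected error of threshold decoding under a random codebook. -/
lemma random_coding {M : ℕ} (hM : 0 < M) {w : α → ℝ} (hw : IsPMF w) {T : α → Ω → ℝ}
    (hT : ∀ a o, 0 ≤ T a o) (pass good : α → Ω → Prop) :
    ∑ y : Fin M → α, (∏ i, w (y i)) *
        ∑ m, ∑ o, T (y m) o / M * ind (¬Decodes pass good y o) ≤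
      ∑ a, ∑ o, w a * T a o * (ind (¬pass a o) + ind (¬good a o)) +
        M * ∑ o, (∑ a, w a * T a o) * ∑ a, w a * ind (pass a o) := by
  have hM' : (0 : ℝ) < M := by exact_mod_cast hM
  have hc : ∀ _ : Fin M, ∑ a, w a = 1 := fun _ => hw.2
  have hκ : ∀ y : Fin M → α, 0 ≤ ∏ i, w (y i) := fun y => Finset.prod_nonneg fun _ _ => hw.1 _
  set B : Ω → ℝ := fun o => (∑ a, w a * T a o) * ∑ a, w a * ind (pass a o) with hB
  have hB0 : ∀ o, 0 ≤ B o := fun o => mul_nonneg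
    (Finset.sum_nonneg fun a _ => mul_nonneg (hw.1 a) (hT a o))
    (Finset.sum_nonneg fun a _ => mul_nonneg (hw.1 a) (ind_nonneg _))
  have key : ∀ m : Fin M, ∀ o, ∑ y : Fin M → α, (∏ i, w (y i)) *
      (T (y m) o / M * ind (¬Decodes pass good y o)) ≤
      (∑ a, w a * T a o * (ind (¬pass a o) + ind (¬good a o))) / M + B o := by
    intro m o
    calc _ ≤ ∑ y : Fin M → α, ((∏ i, w (y i)) *
          (T (y m) o / M * (ind (¬pass (y m) o) + ind (¬good (y m) o))) +
          ∑ m', if m' = m then 0 else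
            (∏ i, w (y i)) * (T (y m) o / M * ind (pass (y m') o))) := by
          refine Finset.sum_le_sum fun y _ => ?_
          have h1 := ind_not_decodes_le pass good y o m
          have h2 : 0 ≤ (∏ i, w (y i)) * (T (y m) o / M) :=
            mul_nonneg (hκ y) (div_nonneg (hT _ _) hM'.le)
          have h3 := mul_le_mul_of_nonneg_left h1 h2
          have h4 : ((∏ i, w (y i)) * (T (y m) o / M)) *
              (∑ m', if m' = m then 0 else ind (pass (y m') o)) =
              ∑ m', if m' = m then 0 else
                (∏ i, w (y i)) * (T (y m) o / M * ind (pass (y m') o)) := by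
            rw [Finset.mul_sum]
            exact Finset.sum_congr rfl fun m' _ => by split_ifs <;> ring
          rw [← h4]
          linarith
      _ = (∑ a, w a * T a o * (ind (¬pass a o) + ind (¬good a o))) / M +
          ∑ m', if m' = m then 0 else B o / M := by
          rw [Finset.sum_add_distrib]
          congr 1
          · rw [sum_prod_mul (c := fun _ => w) hc m
              fun a => T a o / M * (ind (¬pass a o) + ind (¬good a o)), Finset.sum_div]
            exact Finset.sum_congr rfl fun a _ => by ring
          · rw [Finset.sum_comm]
            refine Finset.sum_congr rfl fun m' _ => ?_
            split_ifs with h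
            · simp
            · rw [sum_prod_mul_mul (c := fun _ => w) hc (Ne.symm h) (fun a => T a o / M)
                fun a => ind (pass a o)]
              simp only [hB]
              rw [show ∑ a, w a * (T a o / M) = (∑ a, w a * T a o) / M by
                simp only [Finset.sum_div, mul_div_assoc]]
              ring
      _ ≤ (∑ a, w a * T a o * (ind (¬pass a o) + ind (¬good a o))) / M +
          ∑ _m' : Fin M, B o / M := by
          gcongr with m'
          split_ifs
          · exact div_nonneg (hB0 o) hM'.le
          · exact le_rfl
      _ = _ := by simp; field_simp
  calc _ = ∑ m : Fin M, ∑ o, ∑ y : Fin M → α, (∏ i, w (y i)) *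
        (T (y m) o / M * ind (¬Decodes pass good y o)) := by
        simp only [Finset.mul_sum]
        rw [Finset.sum_comm]
        exact Finset.sum_congr rfl fun m _ => Finset.sum_comm
    _ ≤ ∑ m : Fin M, ∑ o, ((∑ a, w a * T a o * (ind (¬pass a o) + ind (¬good a o))) / M + B o) :=
        Finset.sum_le_sum fun m _ => Finset.sum_le_sum fun o _ => key m o
    _ = _ := by
        rw [Finset.sum_const, Finset.card_univ, Fintype.card_fin, nsmul_eq_mul,
          Finset.sum_add_distrib, ← Finset.sum_div, Finset.sum_comm]
        field_simp

end Decoding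

section LikelihoodEncoder

variable {M : ℕ}

/-- The likelihood encoder: choose an index proportionally to `r`. -/
def likEnc (r : Fin M → ℝ) (m : Fin M) : ℝ :=
  if 0 < ∑ i, r i / M then r m / M / ∑ i, r i / M else 1 / M

lemma likEnc_nonneg {r : Fin M → ℝ} (hr : ∀ m, 0 ≤ r m) (m : Fin M) : 0 ≤ likEnc r m := by
  unfold likEnc
  have := hr m
  split_ifs <;> positivity

lemma sum_likEnc (hM : 0 < M) (r : Fin M → ℝ) : ∑ m, likEnc r m = 1 := by
  unfold likEnc
  have hM' : (0 : ℝ) < M := by exact_mod_cast hM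
  split_ifs with h
  · rw [← Finset.sum_div, div_self h.ne']
  · simp
    field_simp

lemma sum_abs_likEnc_sub (hM : 0 < M) {r : Fin M → ℝ} (hr : ∀ m, 0 ≤ r m) :
    ∑ m, |likEnc r m - r m / M| = |1 - ∑ m, r m / M| := by
  have hM' : (0 : ℝ) < M := by exact_mod_cast hM
  have h0 : ∀ m, 0 ≤ r m / M := fun m => div_nonneg (hr m) hM'.le
  by_cases h : 0 < ∑ i, r i / M
  · have : ∀ m, |likEnc r m - r m / M| = (r m / M) * (|1 - ∑ m, r m / M| / ∑ m, r m / M) := by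
      intro m
      rw [likEnc, if_pos h, show r m / M / (∑ i, r i / M) - r m / M =
        r m / M * ((1 - ∑ i, r i / M) / ∑ i, r i / M) by field_simp, abs_mul,
        abs_of_nonneg (h0 m), abs_div, abs_of_pos h]
    simp only [this]
    rw [← Finset.sum_mul]
    field_simp
  · have hz : ∑ i, r i / M = 0 := le_antisymm (not_lt.1 h) (Finset.sum_nonneg fun m _ => h0 m)
    have hz' : ∀ m, r m / M = 0 := fun m =>
      (Finset.sum_eq_zero_iff_of_nonneg fun m _ => h0 m).1 hz m (Finset.mem_univ m)
    simp only [likEnc, hz']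
    simp
    field_simp

end LikelihoodEncoder

lemma exists_le_of_sum_mul_le {α : Type*} [Fintype α] {w F : α → ℝ} (hw : IsPMF w) {C : ℝ}
    (h : ∑ a, w a * F a ≤ C) : ∃ a, F a ≤ C := by
  by_contra! hc
  obtain ⟨a, -, ha⟩ : ∃ a ∈ Finset.univ, 0 < w a := by
    apply Finset.exists_lt_of_sum_lt (f := fun _ => (0 : ℝ))
    rw [hw.2]; simp
  have : ∑ a, w a * C < ∑ a, w a * F a :=
    Finset.sum_lt_sum (fun a _ => mul_le_mul_of_nonneg_left (hc a).le (hw.1 a))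
      ⟨a, Finset.mem_univ a, mul_lt_mul_of_pos_left (hc a) ha⟩
  rw [← Finset.sum_mul, hw.2, one_mul] at this
  linarith

lemma sum_mul_ind_lt_le {α : Type*} [Fintype α] {w s : α → ℝ} (hw : ∀ a, 0 ≤ w a)
    (hs0 : ∀ a, 0 ≤ s a) {B b : ℝ} (hs : ∑ a, w a * s a ≤ B) (hb : 0 < b) :
    ∑ a, w a * ind (b < s a) ≤ B / b := by
  rw [le_div_iff₀ hb, Finset.sum_mul]
  refine (Finset.sum_le_sum fun a _ => ?_).trans hs
  by_cases h : b < s a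
  · rw [ind_of h]
    nlinarith [hw a]
  · rw [ind_of_not h]
    have := mul_nonneg (hw a) (hs0 a)
    simpa

lemma ind_not_and_le {P Q : Prop} : ind (¬(P ∧ Q)) ≤ ind (¬P) + ind (¬Q) := by
  by_cases hP : P <;> by_cases hQ : Q <;> simp [ind, hP, hQ]

section OneShot

variable {U V Z W X Y : Type*} [Fintype U] [Fintype V] [Fintype Z] [Fintype W] [Fintype X]
  [Fintype Y]

/-- One-shot achievability: likelihood encoding against a random codebook of auxiliary symbols
and channel inputs, with a threshold decoder and a threshold test. -/
theorem one_shot {p : U → V → Z → ℝ} (hp0 : ∀ u v z, 0 ≤ p u v z)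
    (hp1 : ∑ u, ∑ v, ∑ z, p u v z = 1) {pW : W → ℝ} (hW : IsPMF pW) {r : U → W → ℝ}
    (hr0 : ∀ u w, 0 ≤ r u w) (hr1 : ∀ u, ∑ w, pW w * r u w = 1) {q : X → ℝ} (hq : IsPMF q)
    {Ch : X → Y → ℝ} (hCh : IsKernel Ch) {s : W → Z → ℝ} (hs0 : ∀ w z, 0 ≤ s w z)
    (hs : ∀ z, ∑ w, pW w * s w z ≤ 1) {t : X → Y → ℝ} (ht0 : ∀ x y, 0 ≤ t x y)
    (ht : ∀ y, ∑ x, q x * t x y ≤ 1) {ρ : W → V → Z → ℝ} (hρ0 : ∀ w v z, 0 ≤ ρ w v z)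
    (hρ : ∀ w z, ∑ v, margVZ p v z * ρ w v z ≤ margZ p z) {a b d g l : ℝ} (ha : 0 ≤ a)
    (hb : 0 < b) (hd : 0 < d) (hg : 0 < g) (hl : 0 < l) {M : ℕ} (hM : 0 < M) :
    ∃ f : U → X → ℝ, IsKernel f ∧ ∃ A : Y → V → Z → Prop,
      (∀ y z, ∑ v, margVZ p v z * ind (A y v z) ≤ margZ p z / g) ∧
      ∑ u, ∑ v, ∑ z, ∑ y, p u v z * (∑ x, f u x * Ch x y) * ind (¬A y v z) ≤
        2 * (∑ w, ∑ u, ∑ v, ∑ z, pW w * r u w * p u v z * ind (a < r u w)) +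
        ∑ w, ∑ u, ∑ v, ∑ z, pW w * r u w * p u v z * ind (s w z ≤ b) +
        ∑ w, ∑ u, ∑ v, ∑ z, pW w * r u w * p u v z * ind (ρ w v z ≤ g) +
        ∑ x, ∑ y, q x * Ch x y * ind (t x y ≤ d) + (l + a / (M * l)) + M / (b * d) := by
  have hM' : (0 : ℝ) < M := by exact_mod_cast hM
  have hC0 : ∀ x y, 0 ≤ Ch x y := fun x y => (hCh x).1 y
  set w : W × X → ℝ := fun c => pW c.1 * q c.2 with hw_def
  have hw : IsPMF w := by
    refine ⟨fun c => mul_nonneg (hW.1 _) (hq.1 _), ?_⟩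
    simp only [hw_def, Fintype.sum_prod_type, ← Finset.mul_sum, hq.2, mul_one, hW.2]
  set pass : W × X → U × V × Z × Y → Prop :=
    fun c o => b < s c.1 o.2.2.1 ∧ d < t c.2 o.2.2.2 with hpass
  set good : W × X → U × V × Z × Y → Prop := fun c o => g < ρ c.1 o.2.1 o.2.2.1 with hgood
  set T : W × X → U × V × Z × Y → ℝ :=
    fun c o => p o.1 o.2.1 o.2.2.1 * r o.1 c.1 * Ch c.2 o.2.2.2 with hT_def
  have hT : ∀ c o, 0 ≤ T c o := fun c o => mul_nonneg (mul_nonneg (hp0 _ _ _) (hr0 _ _)) (hC0 _ _)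
  set A : (Fin M → W × X) → Y → V → Z → Prop := fun c y v z =>
    Decodes (fun (c : W × X) (o : V × Z × Y) => b < s c.1 o.2.1 ∧ d < t c.2 o.2.2)
      (fun (c : W × X) (o : V × Z × Y) => g < ρ c.1 o.1 o.2.1) c (v, z, y) with hA
  set e : (Fin M → W × X) → U → Fin M → ℝ := fun c u => likEnc fun m => r u (c m).1 with he
  have he0 : ∀ c u m, 0 ≤ e c u m := fun c u m => likEnc_nonneg (fun m => hr0 _ _) m
  set f : (Fin M → W × X) → U → X → ℝ := fun c u x => ∑ m, e c u m * ind ((c m).2 = x) with hf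
  have hfsum : ∀ c u (F : X → ℝ), ∑ x, f c u x * F x = ∑ m, e c u m * F (c m).2 := by
    intro c u F
    simp only [hf, Finset.sum_mul]
    rw [Finset.sum_comm]
    refine Finset.sum_congr rfl fun m _ => ?_
    rw [Finset.sum_eq_single (c m).2]
    · rw [ind_of rfl, mul_one]
    · intro x _ hx
      rw [ind_of_not hx.symm]; ring
    · simp
  have hfk : ∀ c, IsKernel (f c) := fun c u =>
    ⟨fun x => Finset.sum_nonneg fun m _ => mul_nonneg (he0 _ _ _) (ind_nonneg _), by
      have := hfsum c u fun _ => 1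
      simp only [mul_one] at this
      rw [this]
      exact sum_likEnc hM _⟩
  have hAQ : ∀ c y z, ∑ v, margVZ p v z * ind (A c y v z) ≤ margZ p z / g := by
    intro c y z
    have hvz : ∀ v, 0 ≤ margVZ p v z := fun v => Finset.sum_nonneg fun u _ => hp0 _ _ _
    have hz : 0 ≤ margZ p z := by
      rw [margZ_eq_sum_margVZ]
      exact Finset.sum_nonneg fun v _ => hvz v
    by_cases h : ∃ m, (b < s (c m).1 z ∧ d < t (c m).2 y) ∧
        ∀ m', (b < s (c m').1 z ∧ d < t (c m').2 y) → m' = m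
    · obtain ⟨m, hm, hm'⟩ := h
      refine le_trans (Finset.sum_le_sum fun v _ => ?_)
        (sum_mul_ind_lt_le hvz (fun v => hρ0 (c m).1 v z) (hρ (c m).1 z) hg)
      refine mul_le_mul_of_nonneg_left ?_ (hvz v)
      by_cases h2 : A c y v z
      · obtain ⟨m2, h3, h4, h5⟩ := id h2
        obtain rfl := hm' m2 h3
        rw [ind_of h2, ind_of h5]
      · rw [ind_of_not h2]
        exact ind_nonneg _
    · refine le_trans (le_of_eq ?_) (div_nonneg hz hg.le)
      refine Finset.sum_eq_zero fun v _ => ?_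
      rw [ind_of_not, mul_zero]
      rintro ⟨m, h1, h2, -⟩
      exact h ⟨m, h1, h2⟩
  set pU : U → ℝ := fun u => ∑ v, ∑ z, p u v z with hpU
  have hpU0 : ∀ u, 0 ≤ pU u := fun u =>
    Finset.sum_nonneg fun v _ => Finset.sum_nonneg fun z _ => hp0 _ _ _
  set Loss : (Fin M → W × X) → ℝ := fun c =>
    ∑ u, ∑ v, ∑ z, ∑ y, p u v z * (∑ x, f c u x * Ch x y) * ind (¬A c y v z) with hLoss
  have hbound : ∀ c, Loss c ≤
      ∑ m, ∑ o, T (c m) o / M * ind (¬Decodes pass good c o) +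
      ∑ u, pU u * |1 - ∑ m, r u (c m).1 / M| := by
    intro c
    have e1 : ∑ m, ∑ o, T (c m) o / M * ind (¬Decodes pass good c o) =
        ∑ u, ∑ v, ∑ z, ∑ y, ∑ m, p u v z * (r u (c m).1 / M * Ch (c m).2 y) *
          ind (¬A c y v z) := by
      rw [Finset.sum_comm]
      simp only [Fintype.sum_prod_type]
      refine Finset.sum_congr rfl fun u _ => Finset.sum_congr rfl fun v _ =>
        Finset.sum_congr rfl fun z _ => Finset.sum_congr rfl fun y _ =>
        Finset.sum_congr rfl fun m _ => ?_
      change p u v z * r u (c m).1 * Ch (c m).2 y / M * ind (¬A c y v z) = _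
      ring
    have e2 : ∑ u, pU u * |1 - ∑ m, r u (c m).1 / M| =
        ∑ u, ∑ v, ∑ z, ∑ y, ∑ m, p u v z * (|e c u m - r u (c m).1 / M| * Ch (c m).2 y) := by
      refine Finset.sum_congr rfl fun u _ => ?_
      rw [← sum_abs_likEnc_sub hM fun m => hr0 u (c m).1, hpU, Finset.sum_mul]
      refine Finset.sum_congr rfl fun v _ => ?_
      rw [Finset.sum_mul]
      refine Finset.sum_congr rfl fun z _ => ?_
      rw [Finset.sum_comm]
      simp only [← Finset.mul_sum, (hCh _).2, mul_one]
      rfl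
    rw [e1, e2]
    simp only [hLoss, ← Finset.sum_add_distrib]
    refine Finset.sum_le_sum fun u _ => Finset.sum_le_sum fun v _ =>
        Finset.sum_le_sum fun z _ => Finset.sum_le_sum fun y _ => ?_
    rw [hfsum, Finset.mul_sum, Finset.sum_mul]
    refine Finset.sum_le_sum fun m _ => ?_
    have h1 := le_abs_self (e c u m - r u (c m).1 / M)
    have h2 := abs_nonneg (e c u m - r u (c m).1 / M)
    have h3 := ind_nonneg (¬A c y v z)
    have h4 := ind_le_one (¬A c y v z)
    have h5 : e c u m * ind (¬A c y v z) ≤ r u (c m).1 / M * ind (¬A c y v z) +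
        |e c u m - r u (c m).1 / M| := by nlinarith
    have h6 := mul_le_mul_of_nonneg_left h5 (mul_nonneg (hp0 u v z) (hC0 (c m).2 y))
    linarith
  have hκ : IsPMF fun c : Fin M → W × X => ∏ i, w (c i) :=
    ⟨fun c => Finset.prod_nonneg fun _ _ => hw.1 _, sum_prod_eq_one fun _ => hw.2⟩
  have hwφ : ∀ F : W → ℝ, ∑ c, w c * F c.1 = ∑ i, pW i * F i := fun F => by
    simp only [hw_def, Fintype.sum_prod_type, mul_right_comm _ (q _), ← Finset.mul_sum, hq.2,
      mul_one]
  have hpU1 : ∑ u, pU u = 1 := hp1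
  have hswap : ∀ F : U → W → ℝ, ∑ i, ∑ u, ∑ v, ∑ z, pW i * r u i * p u v z * F u i =
      ∑ u, pU u * ∑ i, pW i * (r u i * F u i) := fun F => by
    rw [Finset.sum_comm]
    refine Finset.sum_congr rfl fun u _ => ?_
    rw [Finset.mul_sum]
    refine Finset.sum_congr rfl fun i _ => ?_
    simp only [hpU, Finset.sum_mul]
    exact Finset.sum_congr rfl fun v _ => Finset.sum_congr rfl fun z _ => by ring
  have hsplit : ∀ (F : W → U → V → Z → ℝ) (G : X → Y → ℝ),
      ∑ i, ∑ x, ∑ u, ∑ v, ∑ z, ∑ y, F i u v z * G x y =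
        (∑ i, ∑ u, ∑ v, ∑ z, F i u v z) * ∑ x, ∑ y, G x y := fun F G => by
    simp only [← Finset.mul_sum, ← Finset.sum_mul]
  have hF1 : ∑ i, ∑ u, ∑ v, ∑ z, pW i * r u i * p u v z = 1 := by
    have := hswap fun _ _ => 1
    simpa only [mul_one, hr1, hpU1] using this
  have hG1 : ∑ x, ∑ y, q x * Ch x y = 1 := by
    simp only [← Finset.mul_sum, (hCh _).2, mul_one, hq.2]
  have hcov : ∑ c : Fin M → W × X, (∏ i, w (c i)) * ∑ u, pU u * |1 - ∑ m, r u (c m).1 / M| ≤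
      2 * (∑ w, ∑ u, ∑ v, ∑ z, pW w * r u w * p u v z * ind (a < r u w)) +
        (l + a / (M * l)) := by
    have h1 : ∀ u, ∑ c : Fin M → W × X, (∏ i, w (c i)) * |1 - ∑ m, r u (c m).1 / M| ≤
        2 * ∑ i, pW i * (r u i * ind (a < r u i)) + (l + a / (M * l)) := fun u => by
      have := soft_covering hM hw (φ := fun c => r u c.1) (fun c => hr0 u c.1)
        (by rw [hwφ, hr1]) ha hl
      simp only [mul_assoc] at this
      rw [hwφ fun i => r u i * ind (a < r u i)] at this
      simpa only [mul_assoc] using this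
    calc _ = ∑ u, pU u * ∑ c : Fin M → W × X, (∏ i, w (c i)) * |1 - ∑ m, r u (c m).1 / M| := by
          simp only [Finset.mul_sum]
          rw [Finset.sum_comm]
          exact Finset.sum_congr rfl fun u _ => Finset.sum_congr rfl fun c _ => by ring
      _ ≤ ∑ u, pU u * (2 * ∑ i, pW i * (r u i * ind (a < r u i)) + (l + a / (M * l))) :=
          Finset.sum_le_sum fun u _ => mul_le_mul_of_nonneg_left (h1 u) (hpU0 u)
      _ = _ := by
          rw [hswap fun u i => ind (a < r u i)]
          simp only [mul_add, Finset.sum_add_distrib, ← Finset.sum_mul, hpU1, one_mul]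
          rw [Finset.mul_sum]
          congr 1
          exact Finset.sum_congr rfl fun u _ => by ring
  have hdec := random_coding hM hw hT pass good
  have hR1 : ∑ c, ∑ o, w c * T c o * (ind (¬pass c o) + ind (¬good c o)) ≤
        ∑ w, ∑ u, ∑ v, ∑ z, pW w * r u w * p u v z * ind (s w z ≤ b) +
        ∑ w, ∑ u, ∑ v, ∑ z, pW w * r u w * p u v z * ind (ρ w v z ≤ g) +
        ∑ x, ∑ y, q x * Ch x y * ind (t x y ≤ d) := by
    simp only [Fintype.sum_prod_type]
    have h1 : ∀ i x u v z y, w (i, x) * T (i, x) (u, v, z, y) *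
        (ind (¬pass (i, x) (u, v, z, y)) + ind (¬good (i, x) (u, v, z, y))) ≤
        (pW i * r u i * p u v z * (ind (s i z ≤ b) + ind (ρ i v z ≤ g))) * (q x * Ch x y) +
        (pW i * r u i * p u v z) * (q x * Ch x y * ind (t x y ≤ d)) := by
      intro i x u v z y
      have h2 : ind (¬pass (i, x) (u, v, z, y)) ≤ ind (s i z ≤ b) + ind (t x y ≤ d) := by
        have := @ind_not_and_le (b < s i z) (d < t x y)
        rwa [not_lt, not_lt] at this
      have h3 : ind (¬good (i, x) (u, v, z, y)) = ind (ρ i v z ≤ g) := by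
        simp only [hgood, not_lt]
      have h4 := mul_le_mul_of_nonneg_left h2
        (mul_nonneg (hw.1 (i, x)) (hT (i, x) (u, v, z, y)))
      rw [h3]
      simp only [hw_def, hT_def] at h4 ⊢
      linarith
    refine (Finset.sum_le_sum fun i _ => Finset.sum_le_sum fun x _ => Finset.sum_le_sum fun u _ =>
      Finset.sum_le_sum fun v _ => Finset.sum_le_sum fun z _ => Finset.sum_le_sum fun y _ =>
      h1 i x u v z y).trans (le_of_eq ?_)
    simp only [Finset.sum_add_distrib]
    rw [hsplit (fun i u v z => pW i * r u i * p u v z * (ind (s i z ≤ b) + ind (ρ i v z ≤ g)))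
        fun x y => q x * Ch x y,
      hsplit (fun i u v z => pW i * r u i * p u v z) fun x y => q x * Ch x y * ind (t x y ≤ d),
      hF1, hG1, mul_one, one_mul]
    simp only [mul_add, Finset.sum_add_distrib]
  have hR2 : ∑ o, (∑ c, w c * T c o) * ∑ c, w c * ind (pass c o) ≤ 1 / (b * d) := by
    have h1 : ∀ o, ∑ c, w c * ind (pass c o) ≤ 1 / (b * d) := by
      rintro ⟨u, v, z, y⟩
      calc ∑ c, w c * ind (pass c (u, v, z, y)) =
            (∑ i, pW i * ind (b < s i z)) * ∑ x, q x * ind (d < t x y) := by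
            rw [Finset.sum_mul_sum, Fintype.sum_prod_type]
            refine Finset.sum_congr rfl fun i _ => Finset.sum_congr rfl fun x _ => ?_
            have : ind (pass (i, x) (u, v, z, y)) = ind (b < s i z) * ind (d < t x y) := by
              by_cases h1 : b < s i z <;> by_cases h2 : d < t x y <;> simp [hpass, ind, h1, h2]
            rw [this]
            simp only [hw_def]
            ring
        _ ≤ (1 / b) * (1 / d) := mul_le_mul
            (sum_mul_ind_lt_le hW.1 (fun i => hs0 i z) (hs z) hb)
            (sum_mul_ind_lt_le hq.1 (fun x => ht0 x y) (ht y) hd)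
            (Finset.sum_nonneg fun x _ => mul_nonneg (hq.1 x) (ind_nonneg _)) (by positivity)
        _ = _ := by rw [one_div_mul_one_div]
    have h2 : ∑ o, ∑ c, w c * T c o = 1 := by
      rw [Finset.sum_comm]
      simp only [Fintype.sum_prod_type]
      rw [← mul_one (1 : ℝ)]
      nth_rewrite 1 [← hF1]
      rw [← hG1, ← hsplit]
      refine Finset.sum_congr rfl fun i _ => Finset.sum_congr rfl fun x _ =>
        Finset.sum_congr rfl fun u _ => Finset.sum_congr rfl fun v _ =>
        Finset.sum_congr rfl fun z _ => Finset.sum_congr rfl fun y _ => ?_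
      simp only [hw_def, hT_def]
      ring
    calc _ ≤ ∑ o, (∑ c, w c * T c o) * (1 / (b * d)) :=
          Finset.sum_le_sum fun o _ => mul_le_mul_of_nonneg_left (h1 o)
            (Finset.sum_nonneg fun c _ => mul_nonneg (hw.1 c) (hT c o))
      _ = _ := by rw [← Finset.sum_mul, h2, one_mul]
  obtain ⟨c, hc⟩ := exists_le_of_sum_mul_le hκ (le_refl (∑ c, (∏ i, w (c i)) * Loss c))
  refine ⟨f c, hfk c, A c, hAQ c, hc.trans ?_⟩
  have h1 : ∑ c : Fin M → W × X, (∏ i, w (c i)) * Loss c ≤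
      ∑ c : Fin M → W × X, (∏ i, w (c i)) *
        ∑ m, ∑ o, T (c m) o / M * ind (¬Decodes pass good c o) +
      ∑ c : Fin M → W × X, (∏ i, w (c i)) * ∑ u, pU u * |1 - ∑ m, r u (c m).1 / M| := by
    rw [← Finset.sum_add_distrib]
    refine Finset.sum_le_sum fun c _ => ?_
    rw [← mul_add]
    exact mul_le_mul_of_nonneg_left (hbound c) (hκ.1 c)
  have h2 : M * ∑ o, (∑ c, w c * T c o) * ∑ c, w c * ind (pass c o) ≤ M / (b * d) := by
    rw [← mul_one_div]
    exact mul_le_mul_of_nonneg_left hR2 hM'.le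
  linarith

end OneShot

section Testing

variable {U V Z Y : Type*} [Fintype U] [Fintype V] [Fintype Z] [Fintype Y] {p : U → V → Z → ℝ}
  {g : Y → U → ℝ}

lemma sum_outZ (hg : ∑ y, g y = 1) (z : Z) : ∑ y, outZ p (g y) z = margZ p z := by
  simp only [outZ, margZ]
  rw [Finset.sum_comm]
  refine Finset.sum_congr rfl fun u _ => ?_
  have := congrFun hg u
  rw [Finset.sum_apply, Pi.one_apply] at this
  rw [← Finset.mul_sum, this, mul_one]

lemma sum_outVZ_likelihood (hg : ∑ y, g y = 1) (v : V) (z : Z) :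
    ∑ y, outVZ p (g y) v z = margVZ p v z := by
  simp only [outVZ, margVZ]
  rw [Finset.sum_comm]
  refine Finset.sum_congr rfl fun u _ => ?_
  have := congrFun hg u
  rw [Finset.sum_apply, Pi.one_apply] at this
  rw [← Finset.mul_sum, this, mul_one]

/-- A good test certifies a large divergence. -/
lemma infoV_ge_of_test (hp : IsSource p) (hg0 : ∀ y u, 0 ≤ g y u) (hg : ∑ y, g y = 1)
    {A : Y → V → Z → Prop} {G : ℝ} (hG : 1 ≤ G)
    (hA : ∀ y z, ∑ v, margVZ p v z * ind (A y v z) ≤ margZ p z / G) {ε : ℝ}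
    (hε : ∑ u, ∑ v, ∑ z, ∑ y, p u v z * g y u * ind (¬A y v z) ≤ ε) :
    (1 - ε) * log G - log 2 ≤ ∑ y, infoV p (g y) := by
  have hG0 : 0 < G := by linarith
  set PP : Y × V × Z → ℝ := fun x => outVZ p (g x.1) x.2.1 x.2.2 with hPP
  have hPP0 : ∀ x, 0 ≤ PP x := fun x => outVZ_nonneg hp (hg0 _) _ _
  have hPP1 : ∑ x, PP x = 1 := by
    simp only [hPP, Fintype.sum_prod_type]
    rw [Finset.sum_comm]
    rw [← hp.sum_margZ]
    simp only [margZ_eq_sum_margVZ]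
    refine Eq.trans ?_ Finset.sum_comm
    refine Finset.sum_congr rfl fun v _ => ?_
    rw [Finset.sum_comm]
    exact Finset.sum_congr rfl fun z _ => sum_outVZ_likelihood hg v z
  set N : Y × V × Z → ℝ := fun x => 1 + (G - 1) * ind (A x.1 x.2.1 x.2.2) with hN
  have hN0 : ∀ x, 0 < N x := fun x => by
    have := ind_nonneg (A x.1 x.2.1 x.2.2)
    have : 0 ≤ (G - 1) * ind (A x.1 x.2.1 x.2.2) := mul_nonneg (by linarith) this
    simp only [hN]; linarith
  have hpos : ∀ y v z, 0 < PP (y, v, z) → 0 < outVZ p (g y) v z * margZ p z /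
      (margVZ p v z * outZ p (g y) z) := fun y v z h => by
    have h1 : 0 < outVZ p (g y) v z := h
    have h2 := h1.trans_le (outVZ_le_outZ hp (hg0 y) v z)
    have h3 := hp.posVZ v z
    have h4 := hp.posZ z
    positivity
  have key := gibbs (p := PP) (ρ := fun x => 2 * (outVZ p (g x.1) x.2.1 x.2.2 * margZ p x.2.2 /
      (margVZ p x.2.1 x.2.2 * outZ p (g x.1) x.2.2)) / N x) hPP0
    (fun ⟨y, v, z⟩ h => div_pos (mul_pos two_pos (hpos y v z h)) (hN0 _)) (by
      rw [hPP1]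
      have h1 : ∀ y v z, PP (y, v, z) / (2 * (outVZ p (g y) v z * margZ p z /
          (margVZ p v z * outZ p (g y) z)) / N (y, v, z)) ≤
          outZ p (g y) z / margZ p z / 2 * (margVZ p v z * N (y, v, z)) := by
        intro y v z
        have h4 := hp.posZ z
        have h3 := hp.posVZ v z
        have h5 := hN0 (y, v, z)
        rcases (hPP0 (y, v, z)).eq_or_lt with h | h
        · rw [← h, zero_div]
          have := outZ_nonneg hp (hg0 y) z
          positivity
        · have h1 : 0 < outVZ p (g y) v z := h
          have h2 := h1.trans_le (outVZ_le_outZ hp (hg0 y) v z)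
          apply le_of_eq
          simp only [hPP]
          field_simp
      have h2 : ∀ y z, ∑ v, outZ p (g y) z / margZ p z / 2 * (margVZ p v z * N (y, v, z)) ≤
          outZ p (g y) z := by
        intro y z
        have h4 := hp.posZ z
        rw [← Finset.mul_sum]
        have h5 : ∑ v, margVZ p v z * N (y, v, z) ≤ 2 * margZ p z := by
          have : ∑ v, margVZ p v z * N (y, v, z) =
              margZ p z + (G - 1) * ∑ v, margVZ p v z * ind (A y v z) := by
            rw [margZ_eq_sum_margVZ, Finset.mul_sum, ← Finset.sum_add_distrib]
            exact Finset.sum_congr rfl fun v _ => by simp only [hN]; ring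
          rw [this]
          have h6 := mul_le_mul_of_nonneg_left (hA y z) (by linarith : (0 : ℝ) ≤ G - 1)
          have h7 : (G - 1) * (margZ p z / G) ≤ margZ p z := by
            rw [← mul_div_assoc, div_le_iff₀ hG0]
            nlinarith
          linarith
        have h8 := outZ_nonneg hp (hg0 y) z
        calc _ ≤ outZ p (g y) z / margZ p z / 2 * (2 * margZ p z) := by gcongr
          _ = _ := by field_simp
      simp only [Fintype.sum_prod_type]
      calc _ ≤ ∑ y, ∑ v, ∑ z, outZ p (g y) z / margZ p z / 2 * (margVZ p v z * N (y, v, z)) :=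
            Finset.sum_le_sum fun y _ => Finset.sum_le_sum fun v _ => Finset.sum_le_sum
              fun z _ => h1 y v z
        _ = ∑ y, ∑ z, ∑ v, outZ p (g y) z / margZ p z / 2 * (margVZ p v z * N (y, v, z)) :=
            Finset.sum_congr rfl fun y _ => Finset.sum_comm
        _ ≤ ∑ y, ∑ z, outZ p (g y) z :=
            Finset.sum_le_sum fun y _ => Finset.sum_le_sum fun z _ => h2 y z
        _ = 1 := by
            rw [Finset.sum_comm, ← hp.sum_margZ]
            exact Finset.sum_congr rfl fun z _ => sum_outZ hg z)
  have hI : ∑ y, infoV p (g y) = ∑ x, PP x * log (outVZ p (g x.1) x.2.1 x.2.2 * margZ p x.2.2 /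
      (margVZ p x.2.1 x.2.2 * outZ p (g x.1) x.2.2)) := by
    simp only [Fintype.sum_prod_type]
    rfl
  have hlogN : ∀ x, log (N x) = log G * ind (A x.1 x.2.1 x.2.2) := fun x => by
    by_cases h : A x.1 x.2.1 x.2.2
    · simp [hN, ind_of h]
    · simp [hN, ind_of_not h]
  have hsplit : ∑ x, PP x * log (2 * (outVZ p (g x.1) x.2.1 x.2.2 * margZ p x.2.2 /
      (margVZ p x.2.1 x.2.2 * outZ p (g x.1) x.2.2)) / N x) =
      log 2 + ∑ y, infoV p (g y) - log G * ∑ x, PP x * ind (A x.1 x.2.1 x.2.2) := by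
    rw [hI, ← mul_one (log 2), ← hPP1, Finset.mul_sum, Finset.mul_sum, ← Finset.sum_add_distrib,
      ← Finset.sum_sub_distrib]
    refine Finset.sum_congr rfl fun ⟨y, v, z⟩ _ => ?_
    rcases (hPP0 (y, v, z)).eq_or_lt with h | h
    · simp [← h]
    · have := hpos y v z h
      rw [log_div (by positivity) (hN0 _).ne', log_mul two_ne_zero this.ne', hlogN]
      ring
  have hPA : 1 - ε ≤ ∑ x, PP x * ind (A x.1 x.2.1 x.2.2) := by
    have h1 : ∑ x, PP x * ind (¬A x.1 x.2.1 x.2.2) ≤ ε := by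
      refine le_trans (le_of_eq ?_) hε
      simp only [hPP, Fintype.sum_prod_type, outVZ, Finset.sum_mul]
      calc _ = ∑ y, ∑ u, ∑ v, ∑ z, p u v z * g y u * ind (¬A y v z) := by
            refine Finset.sum_congr rfl fun y _ => ?_
            refine Eq.trans ?_ Finset.sum_comm
            exact Finset.sum_congr rfl fun v _ => Finset.sum_comm
        _ = _ := by
            rw [Finset.sum_comm]
            refine Finset.sum_congr rfl fun u _ => ?_
            rw [Finset.sum_comm]
            exact Finset.sum_congr rfl fun v _ => Finset.sum_comm
    have h2 : ∑ x, PP x * ind (A x.1 x.2.1 x.2.2) + ∑ x, PP x * ind (¬A x.1 x.2.1 x.2.2) = 1 := by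
      rw [← hPP1, ← Finset.sum_add_distrib]
      refine Finset.sum_congr rfl fun x _ => ?_
      by_cases h : A x.1 x.2.1 x.2.2
      · rw [ind_of h, ind_of_not (not_not.2 h)]; ring
      · rw [ind_of h, ind_of_not h]; ring
    linarith
  have h3 := mul_le_mul_of_nonneg_left hPA (log_nonneg hG)
  rw [hsplit] at key
  linarith

end Testing

section Concentration

variable {α : Type*} [Fintype α] {w : α → ℝ}

/-- The weak law of large numbers on a finite alphabet. -/
lemma tendsto_prob_dev (hw : IsPMF w) (F : α → ℝ) {δ : ℝ} (hδ : 0 < δ) :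
    Tendsto (fun k : ℕ => ∑ c : Fin k → α, (∏ i, w (c i)) *
      ind (k * δ ≤ |∑ i, (F (c i) - ∑ a, w a * F a)|)) atTop (nhds 0) := by
  set μ := ∑ a, w a * F a with hμ
  set σ := ∑ a, w a * (F a - μ) ^ 2 with hσ
  have hw0 : ∀ (k : ℕ) (c : Fin k → α), 0 ≤ ∏ i, w (c i) := fun k c =>
    Finset.prod_nonneg fun _ _ => hw.1 _
  refine squeeze_zero' (.of_forall fun k => Finset.sum_nonneg fun c _ =>
    mul_nonneg (hw0 k c) (ind_nonneg _)) ?_ (tendsto_const_div_atTop_nhds_zero_nat (σ / δ ^ 2))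
  filter_upwards [eventually_ge_atTop 1] with k hk
  have hk' : (0 : ℝ) < k := by exact_mod_cast hk
  rw [div_div, le_div_iff₀ (by positivity)]
  have h1 := sum_prod_sq (ι := Fin k) (c := fun _ => w) (fun _ => hw.2) (fun _ a => F a - μ)
    (fun _ => by
      simp only [mul_sub, Finset.sum_sub_distrib, ← Finset.sum_mul, hw.2, ← hμ]
      ring)
  have h2 : (∑ c : Fin k → α, (∏ i, w (c i)) * ind (k * δ ≤ |∑ i, (F (c i) - μ)|)) *
      (k * δ) ^ 2 ≤ k * σ := by
    calc _ ≤ ∑ c : Fin k → α, (∏ i, w (c i)) * (∑ i, (F (c i) - μ)) ^ 2 := by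
          rw [Finset.sum_mul]
          refine Finset.sum_le_sum fun c _ => ?_
          rw [mul_assoc]
          refine mul_le_mul_of_nonneg_left ?_ (hw0 k c)
          by_cases h : k * δ ≤ |∑ i, (F (c i) - μ)|
          · rw [ind_of h, one_mul, ← sq_abs (∑ i, (F (c i) - μ))]
            gcongr
          · rw [ind_of_not h, zero_mul]
            positivity
      _ = k * σ := by rw [h1]; simp [hσ]
  nlinarith

lemma log_prod_sub {φ : α → ℝ} (hw : ∀ a, 0 ≤ w a) (hφ : ∀ a, 0 < w a → 0 < φ a) {k : ℕ}
    {c : Fin k → α} (hc : 0 < ∏ i, w (c i)) (μ : ℝ) :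
    0 < ∏ i, φ (c i) ∧ ∑ i, (log (φ (c i)) - μ) = log (∏ i, φ (c i)) - k * μ := by
  have h1 : ∀ i, 0 < φ (c i) := fun i => hφ _
    ((hw _).lt_of_ne (Finset.prod_ne_zero_iff.1 hc.ne' i (Finset.mem_univ i)).symm)
  refine ⟨Finset.prod_pos fun i _ => h1 i, ?_⟩
  rw [log_prod fun i _ => (h1 i).ne', Finset.sum_sub_distrib]
  simp

lemma tendsto_prob_lt_prod (hw : IsPMF w) {φ : α → ℝ} (hφ : ∀ a, 0 < w a → 0 < φ a) {δ : ℝ}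
    (hδ : 0 < δ) : Tendsto (fun k : ℕ => ∑ c : Fin k → α, (∏ i, w (c i)) *
      ind (exp (k * (∑ a, w a * log (φ a) + δ)) < ∏ i, φ (c i))) atTop (nhds 0) := by
  have hw0 : ∀ (k : ℕ) (c : Fin k → α), 0 ≤ ∏ i, w (c i) := fun k c =>
    Finset.prod_nonneg fun _ _ => hw.1 _
  refine squeeze_zero (fun k => Finset.sum_nonneg fun c _ =>
    mul_nonneg (hw0 k c) (ind_nonneg _)) (fun k => ?_) (tendsto_prob_dev hw (fun a => log (φ a)) hδ)
  refine Finset.sum_le_sum fun c _ => ?_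
  rcases (hw0 k c).eq_or_lt with h0 | h0
  · simp [← h0]
  · refine mul_le_mul_of_nonneg_left ?_ h0.le
    by_cases h : exp (k * (∑ a, w a * log (φ a) + δ)) < ∏ i, φ (c i)
    swap
    · rw [ind_of_not h]; exact ind_nonneg _
    · obtain ⟨h1, h2⟩ := log_prod_sub hw.1 hφ h0 (∑ a, w a * log (φ a))
      have h3 := (lt_log_iff_exp_lt h1).2 h
      rw [ind_of h, ind_of]
      rw [h2]
      refine le_trans ?_ (le_abs_self _)
      linarith

lemma tendsto_prob_prod_le (hw : IsPMF w) {φ : α → ℝ} (hφ : ∀ a, 0 < w a → 0 < φ a) {δ : ℝ}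
    (hδ : 0 < δ) : Tendsto (fun k : ℕ => ∑ c : Fin k → α, (∏ i, w (c i)) *
      ind (∏ i, φ (c i) ≤ exp (k * (∑ a, w a * log (φ a) - δ)))) atTop (nhds 0) := by
  have hw0 : ∀ (k : ℕ) (c : Fin k → α), 0 ≤ ∏ i, w (c i) := fun k c =>
    Finset.prod_nonneg fun _ _ => hw.1 _
  refine squeeze_zero (fun k => Finset.sum_nonneg fun c _ =>
    mul_nonneg (hw0 k c) (ind_nonneg _)) (fun k => ?_) (tendsto_prob_dev hw (fun a => log (φ a)) hδ)
  refine Finset.sum_le_sum fun c _ => ?_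
  rcases (hw0 k c).eq_or_lt with h0 | h0
  · simp [← h0]
  · refine mul_le_mul_of_nonneg_left ?_ h0.le
    by_cases h : ∏ i, φ (c i) ≤ exp (k * (∑ a, w a * log (φ a) - δ))
    swap
    · rw [ind_of_not h]; exact ind_nonneg _
    · obtain ⟨h1, h2⟩ := log_prod_sub hw.1 hφ h0 (∑ a, w a * log (φ a))
      have h3 := (log_le_iff_le_exp h1).2 h
      rw [ind_of h, ind_of]
      rw [h2]
      refine le_trans ?_ (neg_le_abs _)
      linarith

end Concentration

section Reindex

variable {ι A B C D : Type*} [Fintype ι] [DecidableEq ι] [Fintype A] [Fintype B] [Fintype C]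
  [Fintype D]

lemma sum_pi_pair (F : (ι → A) → (ι → B) → ℝ) :
    ∑ a, ∑ b, F a b = ∑ c : ι → A × B, F (fun i => (c i).1) fun i => (c i).2 := by
  rw [← Fintype.sum_prod_type']
  exact (Fintype.sum_equiv (Equiv.arrowProdEquivProdArrow ι (fun _ => A) (fun _ => B)) _ _
    fun c => rfl).symm

lemma sum_pi_quadruple (F : (ι → A) → (ι → B) → (ι → C) → (ι → D) → ℝ) :
    ∑ a, ∑ b, ∑ c, ∑ d, F a b c d = ∑ e : ι → A × B × C × D,
      F (fun i => (e i).1) (fun i => (e i).2.1) (fun i => (e i).2.2.1) fun i => (e i).2.2.2 := by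
  simp only [sum_pi_pair]

lemma sum_prod_mul_le_one {f g : ι → A → ℝ} (hfg : ∀ i, ∑ a, f i a * g i a ≤ 1)
    (h0 : ∀ i a, 0 ≤ f i a * g i a) : ∑ a : ι → A, (∏ i, f i (a i)) * ∏ i, g i (a i) ≤ 1 := by
  simp only [← Finset.prod_mul_distrib]
  rw [← Fintype.prod_sum fun i a => f i a * g i a]
  exact Finset.prod_le_one (fun i _ => Finset.sum_nonneg fun a _ => h0 i a) fun i _ => hfg i

end Reindex

section BlockCoding

variable {U V Z W X Y : Type*} [Fintype U] [Fintype V] [Fintype Z] [Fintype W] [Fintype X]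
  [Fintype Y]

lemma nat_ceil_le_two_mul {x : ℝ} (hx : 1 ≤ x) : (⌈x⌉₊ : ℝ) ≤ 2 * x := by
  have := (Nat.ceil_lt_add_one (by linarith : (0 : ℝ) ≤ x)).le
  linarith

lemma tendsto_exp_neg_mul {c : ℝ} (hc : 0 < c) :
    Tendsto (fun k : ℕ => exp (-(k * c))) atTop (nhds 0) :=
  tendsto_exp_neg_atTop_nhds_zero.comp (tendsto_natCast_atTop_atTop.atTop_mul_const hc)

/-- Block version of the one-shot achievability bound. -/
theorem block_coding {p : U → V → Z → ℝ} (hp : IsSource p) {pW : W → ℝ} (hW : IsPMF pW)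
    {r : U → W → ℝ} (hr0 : ∀ u w, 0 ≤ r u w) (hr1 : ∀ u, ∑ w, pW w * r u w = 1) {q : X → ℝ}
    (hq : IsPMF q) {Ch : X → Y → ℝ} (hCh : IsKernel Ch) {s : W → Z → ℝ} (hs0 : ∀ w z, 0 ≤ s w z)
    (hs : ∀ z, ∑ w, pW w * s w z ≤ 1) {t : X → Y → ℝ} (ht0 : ∀ x y, 0 ≤ t x y)
    (ht : ∀ y, ∑ x, q x * t x y ≤ 1) {ρ : W → V → Z → ℝ} (hρ0 : ∀ w v z, 0 ≤ ρ w v z)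
    (hρ : ∀ w z, ∑ v, margVZ p v z * ρ w v z ≤ margZ p z)
    (hpos : ∀ w u v z, 0 < pW w * r u w * p u v z → 0 < r u w ∧ 0 < s w z ∧ 0 < ρ w v z)
    (hpos' : ∀ x y, 0 < q x * Ch x y → 0 < t x y) {j : W × U × V × Z → ℝ}
    (hj : ∀ w u v z, j (w, u, v, z) = pW w * r u w * p u v z) {μr μs μρ μt : ℝ}
    (hμr : ∑ x, j x * log (r x.2.1 x.1) = μr) (hμs : ∑ x, j x * log (s x.1 x.2.2.2) = μs)
    (hμρ : ∑ x, j x * log (ρ x.1 x.2.2.1 x.2.2.2) = μρ)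
    (hμt : ∑ x : X × Y, q x.1 * Ch x.1 x.2 * log (t x.1 x.2) = μt) (hμr0 : 0 ≤ μr)
    {τ δ : ℝ} (hτ : 0 < τ) (hδ : 0 < δ) (hrate : μr - μs + 4 * δ < τ * (μt - δ)) :
    ∃ ε : ℕ → ℝ, Tendsto ε atTop (nhds 0) ∧ ∀ k : ℕ,
      ∃ f : (Fin k → U) → (Fin ⌊τ * k⌋₊ → X) → ℝ, IsKernel f ∧
      ∃ A : (Fin ⌊τ * k⌋₊ → Y) → (Fin k → V) → (Fin k → Z) → Prop,
      (∀ y z, ∑ v, margVZ (powSource p k) v z * ind (A y v z) ≤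
        margZ (powSource p k) z / exp (k * (μρ - δ))) ∧
      ∑ u, ∑ v, ∑ z, ∑ y, powSource p k u v z * chanLik f Ch y u * ind (¬A y v z) ≤ ε k := by
  have hC0 : ∀ x y, 0 ≤ Ch x y := fun x y => (hCh x).1 y
  have hjpmf : IsPMF j := by
    refine ⟨fun ⟨w, u, v, z⟩ => ?_, ?_⟩
    · rw [hj]
      exact mul_nonneg (mul_nonneg (hW.1 _) (hr0 _ _)) (hp.nonneg _ _ _)
    · simp only [Fintype.sum_prod_type, hj]
      rw [Finset.sum_comm]
      simp only [← Finset.mul_sum, ← Finset.sum_mul, hr1, one_mul]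
      exact hp.total
  have hcpmf : IsPMF fun x : X × Y => q x.1 * Ch x.1 x.2 := by
    refine ⟨fun x => mul_nonneg (hq.1 _) (hC0 _ _), ?_⟩
    simp only [Fintype.sum_prod_type, ← Finset.mul_sum, (hCh _).2, mul_one, hq.2]
  have hposr : ∀ x, 0 < j x → 0 < r x.2.1 x.1 := fun ⟨w, u, v, z⟩ h =>
    (hpos w u v z (hj w u v z ▸ h)).1
  have hposs : ∀ x, 0 < j x → 0 < s x.1 x.2.2.2 := fun ⟨w, u, v, z⟩ h =>
    (hpos w u v z (hj w u v z ▸ h)).2.1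
  have hposρ : ∀ x, 0 < j x → 0 < ρ x.1 x.2.2.1 x.2.2.2 := fun ⟨w, u, v, z⟩ h =>
    (hpos w u v z (hj w u v z ▸ h)).2.2
  have t1 := tendsto_prob_lt_prod hjpmf hposr hδ
  have t2 := tendsto_prob_prod_le hjpmf hposs hδ
  have t3 := tendsto_prob_prod_le hjpmf hposρ hδ
  have hfloor : Tendsto (fun k : ℕ => ⌊τ * k⌋₊) atTop atTop :=
    tendsto_nat_floor_atTop.comp (tendsto_natCast_atTop_atTop.const_mul_atTop hτ)
  have t4 := (tendsto_prob_prod_le hcpmf (φ := fun x => t x.1 x.2)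
    (fun x h => hpos' x.1 x.2 h) hδ).comp hfloor
  rw [hμr] at t1
  rw [hμs] at t2
  rw [hμρ] at t3
  rw [hμt] at t4
  have t5 := (tendsto_exp_neg_mul (half_pos hδ)).const_mul 2
  have t6 := (tendsto_exp_neg_mul hδ).const_mul (2 * exp |μt - δ|)
  have tt := ((((t1.const_mul 2).add t2).add t3).add t4).add (t5.add t6)
  simp only [mul_zero, add_zero] at tt
  refine ⟨_, tt, fun k => ?_⟩
  have hpk := hp.pow k
  set n := ⌊τ * k⌋₊ with hn
  set M := ⌈exp (k * (μr + 2 * δ))⌉₊ with hM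
  have hM1 : exp (k * (μr + 2 * δ)) ≤ M := Nat.le_ceil _
  have hM0 : 0 < M := Nat.ceil_pos.2 (exp_pos _)
  have hM0' : (0 : ℝ) < M := by exact_mod_cast hM0
  have hM2 : (M : ℝ) ≤ 2 * exp (k * (μr + 2 * δ)) :=
    nat_ceil_le_two_mul (one_le_exp (by positivity))
  obtain ⟨f, hf, A, hA, hloss⟩ := one_shot (p := powSource p k) hpk.nonneg hpk.total
    (pW := fun w : Fin k → W => ∏ i, pW (w i))
    ⟨fun w => Finset.prod_nonneg fun _ _ => hW.1 _, sum_prod_eq_one fun _ => hW.2⟩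
    (r := fun u w => ∏ i, r (u i) (w i)) (fun u w => Finset.prod_nonneg fun _ _ => hr0 _ _)
    (fun u => by
      simp only [← Finset.prod_mul_distrib]
      rw [← Fintype.prod_sum fun i a => pW a * r (u i) a]
      simp [hr1])
    (q := fun x : Fin n → X => ∏ i, q (x i))
    ⟨fun w => Finset.prod_nonneg fun _ _ => hq.1 _, sum_prod_eq_one fun _ => hq.2⟩
    (Ch := fun x (y : Fin n → Y) => ∏ i, Ch (x i) (y i))
    (fun x => ⟨fun y => Finset.prod_nonneg fun _ _ => hC0 _ _,
      sum_prod_eq_one (c := fun i => Ch (x i)) fun i => (hCh _).2⟩)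
    (s := fun w z => ∏ i, s (w i) (z i)) (fun w z => Finset.prod_nonneg fun _ _ => hs0 _ _)
    (fun z => sum_prod_mul_le_one (f := fun _ => pW) (g := fun i a => s a (z i))
      (fun i => hs (z i)) fun i a => mul_nonneg (hW.1 _) (hs0 _ _))
    (t := fun x y => ∏ i, t (x i) (y i)) (fun w z => Finset.prod_nonneg fun _ _ => ht0 _ _)
    (fun y => sum_prod_mul_le_one (f := fun _ => q) (g := fun i a => t a (y i))
      (fun i => ht (y i)) fun i a => mul_nonneg (hq.1 _) (ht0 _ _))
    (ρ := fun w v z => ∏ i, ρ (w i) (v i) (z i))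
    (fun w v z => Finset.prod_nonneg fun _ _ => hρ0 _ _ _)
    (fun w z => by
      simp only [margVZ_powSource, margZ_powSource, ← Finset.prod_mul_distrib]
      rw [← Fintype.prod_sum fun i a => margVZ p a (z i) * ρ (w i) a (z i)]
      exact Finset.prod_le_prod (fun i _ => Finset.sum_nonneg fun v _ =>
        mul_nonneg (hp.posVZ _ _).le (hρ0 _ _ _)) fun i _ => hρ _ _)
    (exp_pos (k * (μr + δ))).le (exp_pos (k * (μs - δ))) (exp_pos (n * (μt - δ)))
    (exp_pos (k * (μρ - δ))) (exp_pos (-(k * (δ / 2)))) hM0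
  refine ⟨f, hf, A, hA, ?_⟩
  have hjc : ∀ c : Fin k → W × U × V × Z, (∏ i, pW (c i).1) * (∏ i, r (c i).2.1 (c i).1) *
      powSource p k (fun i => (c i).2.1) (fun i => (c i).2.2.1) (fun i => (c i).2.2.2) =
      ∏ i, j (c i) := fun c => by
    simp only [powSource, ← Finset.prod_mul_distrib]
    exact Finset.prod_congr rfl fun i _ => (hj _ _ _ _).symm
  rw [sum_pi_quadruple fun w u v z => (∏ i, pW (w i)) * (∏ i, r (u i) (w i)) *
      powSource p k u v z * ind (exp (k * (μr + δ)) < ∏ i, r (u i) (w i)),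
    sum_pi_quadruple fun w u v z => (∏ i, pW (w i)) * (∏ i, r (u i) (w i)) *
      powSource p k u v z * ind (∏ i, s (w i) (z i) ≤ exp (k * (μs - δ))),
    sum_pi_quadruple fun w u v z => (∏ i, pW (w i)) * (∏ i, r (u i) (w i)) *
      powSource p k u v z * ind (∏ i, ρ (w i) (v i) (z i) ≤ exp (k * (μρ - δ))),
    sum_pi_pair fun x y => (∏ i, q (x i)) * (∏ i, Ch (x i) (y i)) *
      ind (∏ i, t (x i) (y i) ≤ exp (n * (μt - δ)))] at hloss
  simp only [hjc] at hloss
  simp only [← Finset.prod_mul_distrib] at hloss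
  have e1 : exp (-(k * (δ / 2))) + exp (k * (μr + δ)) / (M * exp (-(k * (δ / 2)))) ≤
      2 * exp (-(k * (δ / 2))) := by
    have : exp (k * (μr + δ)) / (M * exp (-(k * (δ / 2)))) ≤ exp (-(k * (δ / 2))) := by
      rw [div_le_iff₀ (by positivity)]
      calc exp (k * (μr + δ)) = exp (-(k * (δ / 2))) *
            (exp (k * (μr + 2 * δ)) * exp (-(k * (δ / 2)))) := by
            rw [← exp_add, ← exp_add]; congr 1; ring
        _ ≤ _ := by gcongr
    linarith
  have e2 : M / (exp (k * (μs - δ)) * exp (n * (μt - δ))) ≤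
      2 * exp |μt - δ| * exp (-(k * δ)) := by
    rw [div_le_iff₀ (by positivity)]
    refine hM2.trans ?_
    rw [mul_assoc, mul_assoc, ← exp_add, ← exp_add, ← exp_add]
    gcongr
    have h1 : (n : ℝ) ≤ τ * k := Nat.floor_le (by positivity)
    have h2 : τ * k - 1 ≤ n := by
      have := Nat.lt_floor_add_one (τ * k)
      linarith
    have h3 : (τ * k - n) * (μt - δ) ≤ |μt - δ| := by
      have := le_abs_self (μt - δ)
      have := abs_nonneg (μt - δ)
      nlinarith
    have h4 : (k : ℝ) * (μr - μs + 4 * δ) ≤ k * (τ * (μt - δ)) := by gcongr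
    nlinarith
  refine le_trans hloss ?_
  dsimp only [Function.comp_apply]
  linarith

end BlockCoding

section Achievability

variable {U V Z W X Y : Type*} [Fintype U] [Fintype V] [Fintype Z] [Fintype W] [Fintype X]
  [Fintype Y]

lemma exists_block_test {p : U → V → Z → ℝ} (hp : IsSource p) {h : W → U → ℝ}
    (hh : ∀ w u, 0 ≤ h w u) (hsum : ∑ w, h w = 1) {q : X → ℝ} (hq : IsPMF q)
    {Ch : X → Y → ℝ} (hCh : IsKernel Ch) {τ δ : ℝ} (hτ : 0 < τ) (hδ : 0 < δ)
    (hrate : ∑ w, infoU p (h w) + 4 * δ < τ * (chanInfo q Ch - δ)) :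
    ∃ ε : ℕ → ℝ, Tendsto ε atTop (nhds 0) ∧ ∀ k : ℕ,
      ∃ f : (Fin k → U) → (Fin ⌊τ * k⌋₊ → X) → ℝ, IsKernel f ∧
      ∃ A : (Fin ⌊τ * k⌋₊ → Y) → (Fin k → V) → (Fin k → Z) → Prop,
      (∀ y z, ∑ v, margVZ (powSource p k) v z * ind (A y v z) ≤
        margZ (powSource p k) z / exp (k * (∑ w, infoV p (h w) - δ))) ∧
      ∑ u, ∑ v, ∑ z, ∑ y, powSource p k u v z * chanLik f Ch y u * ind (¬A y v z) ≤ ε k := by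
  have hC0 : ∀ x y, 0 ≤ Ch x y := fun x y => (hCh x).1 y
  have hsum' : ∀ u, ∑ w, h w u = 1 := fun u => by
    have := congrFun hsum u
    rwa [Finset.sum_apply] at this
  set pW : W → ℝ := fun w => ∑ z, outZ p (h w) z with hpW
  have hpW0 : ∀ w, 0 ≤ pW w := fun w => Finset.sum_nonneg fun z _ => outZ_nonneg hp (hh w) z
  have hpWpos : ∀ w u, 0 < h w u → 0 < pW w := fun w u hu => by
    have := hp.nonempty.2.2
    exact Finset.sum_pos (fun z _ => outZ_pos hp (hh w) hu z) Finset.univ_nonempty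
  have hW : IsPMF pW := by
    refine ⟨hpW0, ?_⟩
    simp only [hpW]
    rw [Finset.sum_comm]
    simp only [sum_outZ hsum]
    exact hp.sum_margZ
  have hr : ∀ w u, pW w * (h w u / pW w) = h w u := fun w u => by
    rcases (hh w u).eq_or_lt with h0 | h0
    · simp [← h0]
    · exact mul_div_cancel₀ _ (hpWpos w u h0).ne'
  have hjp : ∀ w u v z, 0 < pW w * (h w u / pW w) * p u v z →
      0 < h w u ∧ 0 < pW w ∧ 0 < outZ p (h w) z ∧ 0 < outVZ p (h w) v z := fun w u v z hj => by
    rw [hr] at hj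
    have hu := pos_of_mul_pos_left hj (hp.nonneg u v z)
    refine ⟨hu, hpWpos w u hu, outZ_pos hp (hh w) hu z, ?_⟩
    refine lt_of_lt_of_le (mul_comm (h w u) _ ▸ hj) (Finset.single_le_sum
      (f := fun u => p u v z * h w u) (fun u _ => mul_nonneg (hp.nonneg _ _ _) (hh w u))
      (Finset.mem_univ u))
  have hcp : ∀ x y, 0 < q x * Ch x y → 0 < ∑ a, q a * Ch a y := fun x y hxy =>
    lt_of_lt_of_le hxy (Finset.single_le_sum (f := fun a => q a * Ch a y)
      (fun a _ => mul_nonneg (hq.1 a) (hC0 a y)) (Finset.mem_univ x))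
  set j : W × U × V × Z → ℝ := fun x => pW x.1 * (h x.1 x.2.1 / pW x.1) * p x.2.1 x.2.2.1 x.2.2.2
    with hj
  have hj0 : ∀ x, 0 ≤ j x := fun x => by
    simp only [hj, hr]
    exact mul_nonneg (hh _ _) (hp.nonneg _ _ _)
  have hinfoU : ∑ x, j x * log (h x.1 x.2.1 / pW x.1) -
      ∑ x, j x * log (outZ p (h x.1) x.2.2.2 / (pW x.1 * margZ p x.2.2.2)) =
      ∑ w, infoU p (h w) := by
    simp only [infoU_eq_sum, Fintype.sum_prod_type, ← Finset.sum_sub_distrib]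
    refine Finset.sum_congr rfl fun w _ => Finset.sum_congr rfl fun u _ =>
      Finset.sum_congr rfl fun v _ => Finset.sum_congr rfl fun z _ => ?_
    rcases (hj0 (w, u, v, z)).eq_or_lt with h0 | h0
    · rw [← h0]
      simp only [hj, hr, mul_comm (h w u)] at h0
      simp [← h0]
    · obtain ⟨a, b, c, d⟩ := hjp w u v z h0
      have e := hp.posZ z
      simp only [hj, hr]
      rw [← mul_sub, ← log_div (by positivity) (by positivity), mul_comm (h w u)]
      congr 2
      field_simp
  have hinfoV : ∑ x, j x * log (outVZ p (h x.1) x.2.2.1 x.2.2.2 * margZ p x.2.2.2 /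
      (margVZ p x.2.2.1 x.2.2.2 * outZ p (h x.1) x.2.2.2)) = ∑ w, infoV p (h w) := by
    simp only [infoV_eq_sum, Fintype.sum_prod_type, hj, hr]
    simp only [mul_comm (h _ _)]
  have hr0 : 0 ≤ ∑ x, j x * log (h x.1 x.2.1 / pW x.1) := by
    refine gibbs hj0 (fun ⟨w, u, v, z⟩ hx => ?_) ?_
    · obtain ⟨a, b, -, -⟩ := hjp w u v z hx
      positivity
    · have hjs : ∑ x, j x = 1 := by
        simp only [Fintype.sum_prod_type, hj, hr]
        rw [Finset.sum_comm]
        simp only [← Finset.mul_sum, ← Finset.sum_mul, hsum', one_mul]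
        exact hp.total
      rw [hjs]
      calc ∑ x, j x / (h x.1 x.2.1 / pW x.1)
          ≤ ∑ x : W × U × V × Z, pW x.1 * p x.2.1 x.2.2.1 x.2.2.2 := by
            refine Finset.sum_le_sum fun ⟨w, u, v, z⟩ _ => ?_
            rcases (hh w u).eq_or_lt with h0 | h0
            · simp only [hj, ← h0]
              simpa using mul_nonneg (hpW0 w) (hp.nonneg u v z)
            · have := hpWpos w u h0
              apply le_of_eq
              simp only [hj]
              field_simp
        _ = 1 := by
            simp only [Fintype.sum_prod_type, ← Finset.mul_sum, hp.total, mul_one, hW.2]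
  have hchan : ∑ x : X × Y, q x.1 * Ch x.1 x.2 * log (Ch x.1 x.2 / ∑ a, q a * Ch a x.2) =
      chanInfo q Ch := by
    simp only [chanInfo, Fintype.sum_prod_type]
  refine block_coding hp hW (r := fun u w => h w u / pW w)
    (fun u w => div_nonneg (hh w u) (hpW0 w)) (fun u => by simp only [hr, hsum']) hq hCh
    (s := fun w z => outZ p (h w) z / (pW w * margZ p z))
    (fun w z => div_nonneg (outZ_nonneg hp (hh w) z) (mul_nonneg (hpW0 w) (hp.posZ z).le))
    (fun z => ?_) (t := fun x y => Ch x y / ∑ a, q a * Ch a y)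
    (fun x y => div_nonneg (hC0 x y) (Finset.sum_nonneg fun a _ =>
      mul_nonneg (hq.1 a) (hC0 a y))) (fun y => ?_)
    (ρ := fun w v z => outVZ p (h w) v z * margZ p z / (margVZ p v z * outZ p (h w) z))
    (fun w v z => div_nonneg (mul_nonneg (outVZ_nonneg hp (hh w) v z) (hp.posZ z).le)
      (mul_nonneg (hp.posVZ v z).le (outZ_nonneg hp (hh w) z))) (fun w z => ?_)
    (fun w u v z hx => ?_) (fun x y hxy => ?_) (fun w u v z => rfl) rfl rfl hinfoV hchan hr0 hτ hδ
    (by rw [hinfoU]; exact hrate)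
  · calc ∑ w, pW w * (outZ p (h w) z / (pW w * margZ p z))
        ≤ ∑ w, outZ p (h w) z / margZ p z := by
          refine Finset.sum_le_sum fun w _ => ?_
          have h1 := hp.posZ z
          have h2 := outZ_nonneg hp (hh w) z
          rcases (hpW0 w).eq_or_lt with h0 | h0
          · rw [← h0, zero_mul]
            positivity
          · apply le_of_eq
            field_simp
      _ = 1 := by
          rw [← Finset.sum_div, sum_outZ hsum, div_self (hp.posZ z).ne']
  · simp only [← mul_div_assoc, ← Finset.sum_div]
    exact div_self_le_one _
  · calc ∑ v, margVZ p v z * (outVZ p (h w) v z * margZ p z / (margVZ p v z * outZ p (h w) z))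
        = ∑ v, outVZ p (h w) v z * margZ p z / outZ p (h w) z :=
          Finset.sum_congr rfl fun v _ => by
            have := (hp.posVZ v z).ne'
            rw [← mul_div_assoc, mul_div_mul_left _ _ this]
      _ = outZ p (h w) z / outZ p (h w) z * margZ p z := by
          rw [← Finset.sum_div, ← Finset.sum_mul, sum_outVZ]
          ring
      _ ≤ 1 * margZ p z := by
          have := (hp.posZ z).le
          gcongr
          exact div_self_le_one _
      _ = _ := one_mul _
  · obtain ⟨a, b, c, d⟩ := hjp w u v z hx
    have := hp.posZ z
    have := hp.posVZ v z
    exact ⟨by positivity, by positivity, by positivity⟩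
  · exact div_pos (pos_of_mul_pos_right hxy (hq.1 x)) (hcp x y hxy)

/-- Every value below `I(V;W|Z)` is achieved by some block length, provided
`I(U;W|Z)` is strictly below the information carried by the channel. -/
theorem exists_block_encoder {p : U → V → Z → ℝ} (hp : IsSource p) {h : W → U → ℝ}
    (hh : ∀ w u, 0 ≤ h w u) (hsum : ∑ w, h w = 1) {q : X → ℝ} (hq : IsPMF q)
    {Ch : X → Y → ℝ} (hCh : IsKernel Ch) {τ η : ℝ} (hτ : 0 < τ) (hη : 0 < η)
    (hrate : ∑ w, infoU p (h w) < τ * chanInfo q Ch) (hpos : 0 < ∑ w, infoV p (h w)) :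
    ∃ k n : ℕ, 1 ≤ k ∧ (n : ℝ) ≤ τ * k ∧ ∃ f : (Fin k → U) → (Fin n → X) → ℝ, IsKernel f ∧
      (∑ w, infoV p (h w) - η) * k ≤ ∑ y, infoV (powSource p k) (chanLik f Ch y) := by
  set μ := ∑ w, infoV p (h w) with hμ
  set δ := min (min (μ / 2) (η / 2))
    ((τ * chanInfo q Ch - ∑ w, infoU p (h w)) / (2 * (4 + τ))) with hδ
  have hδ0 : 0 < δ := lt_min (lt_min (by linarith) (by linarith))
    (div_pos (by linarith) (by linarith))
  have hδ1 : δ ≤ μ / 2 := (min_le_left _ _).trans (min_le_left _ _)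
  have hδ2 : δ ≤ η / 2 := (min_le_left _ _).trans (min_le_right _ _)
  have hδ3 : δ * (2 * (4 + τ)) ≤ τ * chanInfo q Ch - ∑ w, infoU p (h w) :=
    (le_div_iff₀ (by linarith)).1 (min_le_right _ _)
  have hr' : ∑ w, infoU p (h w) + 4 * δ < τ * (chanInfo q Ch - δ) := by
    have : 0 < δ * (4 + τ) := by positivity
    linarith
  obtain ⟨ε, hε, H⟩ := exists_block_test hp hh hsum hq hCh hτ hδ0 hr'
  have hlim : Tendsto (fun k : ℕ => (1 - ε k) * (μ - δ) - log 2 / k) atTop (nhds (μ - δ)) := by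
    have := ((tendsto_const_nhds (x := (1 : ℝ)).sub hε).mul_const (μ - δ)).sub
      (tendsto_const_div_atTop_nhds_zero_nat (log 2))
    simpa using this
  obtain ⟨k, hk, hk1⟩ := ((hlim.eventually (lt_mem_nhds (show μ - η < μ - δ by linarith))).and
    (eventually_ge_atTop 1)).exists
  have hk0 : (0 : ℝ) < k := by exact_mod_cast hk1
  obtain ⟨f, hf, A, hA, hloss⟩ := H k
  refine ⟨k, ⌊τ * k⌋₊, hk1, Nat.floor_le (by positivity), f, hf, ?_⟩
  have h1 := infoV_ge_of_test (hp.pow k) (chanLik_nonneg hf hCh) (sum_chanLik hf hCh)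
    (one_le_exp (mul_nonneg hk0.le (by linarith))) hA hloss
  rw [log_exp] at h1
  refine le_trans ?_ h1
  have h2 := mul_le_mul_of_nonneg_right hk.le hk0.le
  have h3 : ((1 - ε k) * (μ - δ) - log 2 / k) * k = (1 - ε k) * (k * (μ - δ)) - log 2 := by
    field_simp
  linarith

end Achievability

section SingleLetter

variable {U V Z W X Y : Type*} [Fintype U] [Fintype V] [Fintype Z] [Fintype W] [Fintype X]
  [Fintype Y] {p : U → V → Z → ℝ}

lemma chanInfo_nonneg {q : X → ℝ} (hq : IsPMF q) {Ch : X → Y → ℝ} (hCh : IsKernel Ch) :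
    0 ≤ chanInfo q Ch := by
  have hC0 : ∀ x y, 0 ≤ Ch x y := fun x y => (hCh x).1 y
  have ho0 : ∀ y, 0 ≤ ∑ a, q a * Ch a y := fun y => Finset.sum_nonneg fun a _ =>
    mul_nonneg (hq.1 a) (hC0 a y)
  have hsum : ∑ x : X × Y, q x.1 * Ch x.1 x.2 = 1 := by
    simp only [Fintype.sum_prod_type, ← Finset.mul_sum, (hCh _).2, mul_one, hq.2]
  have key := gibbs (p := fun x : X × Y => q x.1 * Ch x.1 x.2)
    (ρ := fun x => Ch x.1 x.2 / ∑ a, q a * Ch a x.2) (fun x => mul_nonneg (hq.1 _) (hC0 _ _))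
    (fun x hx => div_pos (pos_of_mul_pos_right hx (hq.1 _)) (lt_of_lt_of_le hx
      (Finset.single_le_sum (f := fun a => q a * Ch a x.2)
        (fun a _ => mul_nonneg (hq.1 a) (hC0 a _)) (Finset.mem_univ x.1)))) (by
    rw [hsum]
    calc ∑ x : X × Y, q x.1 * Ch x.1 x.2 / (Ch x.1 x.2 / ∑ a, q a * Ch a x.2)
        ≤ ∑ x : X × Y, q x.1 * ∑ a, q a * Ch a x.2 := by
          refine Finset.sum_le_sum fun x _ => ?_
          rcases (hC0 x.1 x.2).eq_or_lt with h0 | h0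
          · rw [← h0]
            simpa using mul_nonneg (hq.1 _) (ho0 _)
          · rw [div_div_eq_mul_div, mul_right_comm, mul_div_cancel_right₀ _ h0.ne']
      _ = 1 := by
          simp only [Fintype.sum_prod_type, ← Finset.mul_sum]
          rw [Finset.sum_comm]
          simp only [← Finset.mul_sum, (hCh _).2, mul_one, hq.2])
  simpa only [chanInfo, Fintype.sum_prod_type] using key

lemma capacity_nonneg {Ch : X → Y → ℝ} (hCh : IsKernel Ch) : 0 ≤ capacity Ch := by
  refine Real.sSup_nonneg ?_
  rintro c ⟨q, hq, rfl⟩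
  rw [mutualInfo_eq_chanInfo hCh]
  exact div_nonneg (chanInfo_nonneg hq hCh) (log_pos one_lt_two).le

lemma infoU_const (hp : IsSource p) (c : ℝ) : infoU p (fun _ => c) = 0 := by
  rcases eq_or_ne c 0 with rfl | hc
  · exact infoU_zero
  · simp only [infoU, outZ, ← Finset.sum_mul]
    refine Finset.sum_eq_zero fun u _ => Finset.sum_eq_zero fun z _ => ?_
    have := (hp.posZ z).ne'
    change _ * log (c * margZ p z / (margZ p z * c)) = 0
    rw [mul_comm c, div_self (mul_ne_zero this hc), log_one, mul_zero]

lemma infoV_const (hp : IsSource p) (c : ℝ) : infoV p (fun _ => c) = 0 := by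
  rcases eq_or_ne c 0 with rfl | hc
  · exact infoV_zero
  · simp only [infoV, outZ, outVZ, ← Finset.sum_mul]
    refine Finset.sum_eq_zero fun v _ => Finset.sum_eq_zero fun z _ => ?_
    have h1 := (hp.posZ z).ne'
    have h2 := (hp.posVZ v z).ne'
    change _ * log (margVZ p v z * c * margZ p z / (margVZ p v z * (margZ p z * c))) = 0
    rw [mul_assoc (margVZ p v z), mul_comm c (margZ p z),
      div_self (mul_ne_zero h2 (mul_ne_zero h1 hc)), log_one, mul_zero]

lemma isKernel_empty_word (A : Type*) : IsKernel fun (_ : A) (_ : Fin 0 → X) => (1 : ℝ) :=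
  fun _ => ⟨fun _ => zero_le_one, by simp⟩

lemma sum_infoV_empty_word (hp : IsSource p) (Ch : X → Y → ℝ) :
    ∑ y, infoV p (chanLik (fun (_ : U) (_ : Fin 0 → X) => (1 : ℝ)) Ch y) = 0 := by
  have : ∀ y, chanLik (fun (_ : U) (_ : Fin 0 → X) => (1 : ℝ)) Ch y = fun _ => 1 := fun y => by
    funext u
    simp [chanLik]
  simp only [this, infoV_const hp, Finset.sum_const_zero]

/-- Achievability of the single-letter expression under the non-strict rate constraint. -/
theorem exists_block_encoder_of_le (hp : IsSource p) {h : W → U → ℝ} (hh : ∀ w u, 0 ≤ h w u)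
    (hsum : ∑ w, h w = 1) {Ch : X → Y → ℝ} (hCh : IsKernel Ch) {τ η : ℝ} (hτ : 0 < τ)
    (hη : 0 < η) (hrate : ∑ w, infoU p (h w) ≤ τ * (capacity Ch * log 2)) :
    ∃ k n : ℕ, 1 ≤ k ∧ (n : ℝ) ≤ τ * k ∧ ∃ f : (Fin k → U) → (Fin n → X) → ℝ, IsKernel f ∧
      (∑ w, infoV p (h w) - η) * k ≤ ∑ y, infoV (powSource p k) (chanLik f Ch y) := by
  have hl := log_pos one_lt_two
  set S := ∑ w, infoV p (h w) with hS
  rcases le_or_gt S η with hSη | hSη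
  · refine ⟨1, 0, le_rfl, by simpa using hτ.le, _, isKernel_empty_word _, ?_⟩
    rw [sum_infoV_empty_word (hp.pow 1)]
    simpa using hSη
  have hS0 : 0 < S := hη.trans hSη
  have hSI : S ≤ ∑ w, infoU p (h w) := Finset.sum_le_sum fun w _ => infoV_le_infoU hp (hh w)
  set e := η / (2 * S) with he
  have he0 : 0 < e := by positivity
  have he1 : e < 1 := by rw [he, div_lt_one (by positivity)]; linarith
  have heS : e * S = η / 2 := by rw [he]; field_simp
  set h' : Option W → U → ℝ := fun o => o.elim (fun _ => e) fun w u => (1 - e) * h w u with hh'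
  have hV : ∑ o, infoV p (h' o) = (1 - e) * S := by
    simp only [Fintype.sum_option, hh', Option.elim, infoV_const hp, infoV_smul, zero_add,
      ← Finset.mul_sum, hS]
  have hU : ∑ o, infoU p (h' o) = (1 - e) * ∑ w, infoU p (h w) := by
    simp only [Fintype.sum_option, hh', Option.elim, infoU_const hp, infoU_smul, zero_add,
      ← Finset.mul_sum]
  have hcap : (1 - e) * capacity Ch < capacity Ch := by
    have : 0 < capacity Ch := by
      by_contra hc
      have : τ * (capacity Ch * log 2) ≤ 0 :=
        mul_nonpos_of_nonneg_of_nonpos hτ.le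
          (mul_nonpos_of_nonpos_of_nonneg (not_lt.1 hc) hl.le)
      linarith
    nlinarith
  obtain ⟨q, hq, hqc⟩ := exists_lt_chanInfo hCh
    (mul_nonneg (by linarith) (capacity_nonneg hCh)) hcap
  obtain ⟨k, n, hk, hn, f, hf, hfV⟩ := exists_block_encoder hp (h := h') (η := η / 2)
    (fun o u => by
      cases o with
      | none => exact he0.le
      | some w => exact mul_nonneg (by linarith) (hh w u))
    (by
      funext u
      have := congrFun hsum u
      rw [Finset.sum_apply] at this
      simp only [Finset.sum_apply, Fintype.sum_option, hh', Option.elim, ← Finset.mul_sum, this,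
        Pi.one_apply]
      ring) hq hCh hτ (half_pos hη)
    (by
      rw [hU]
      calc (1 - e) * ∑ w, infoU p (h w) ≤ (1 - e) * (τ * (capacity Ch * log 2)) := by
            gcongr
        _ = τ * ((1 - e) * capacity Ch * log 2) := by ring
        _ < _ := by gcongr)
    (by
      rw [hV]
      exact mul_pos (by linarith) hS0)
  refine ⟨k, n, hk, hn, f, hf, le_trans ?_ hfV⟩
  rw [hV]
  exact mul_le_mul_of_nonneg_right (by linarith) (Nat.cast_nonneg k)

end SingleLetter

/-- Converse: the block information is single-letterized with a small auxiliary alphabet. -/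
theorem exists_kernel_of_block_encoder {U V Z X Y : Type} [Fintype U] [Fintype V] [Fintype Z]
    [Fintype X] [Fintype Y] {p : U → V → Z → ℝ} (hp : IsSource p) {Ch : X → Y → ℝ}
    (hCh : IsKernel Ch) {τ : ℝ} {k n : ℕ} (hk : 1 ≤ k) (hn : (n : ℝ) ≤ τ * k)
    {f : (Fin k → U) → (Fin n → X) → ℝ} (hf : IsKernel f) :
    ∃ h : Fin (Fintype.card U + 4) → U → ℝ, (∀ w u, 0 ≤ h w u) ∧ ∑ w, h w = 1 ∧
      ∑ w, infoU p (h w) ≤ τ * (capacity Ch * log 2) ∧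
      ∑ y, infoV (powSource p k) (chanLik f Ch y) ≤ k * ∑ w, infoV p (h w) := by
  have hk0 : (0 : ℝ) < k := by exact_mod_cast hk
  obtain ⟨W, _, h₀, hh₀, hs₀, hU₀, hV₀⟩ := exists_singleLetter hp k _ (chanLik f Ch)
    (chanLik_nonneg hf hCh) (sum_chanLik hf hCh)
  obtain ⟨h, hh, hs, hU, hV⟩ := exists_small_kernel hp hh₀ hk0 hs₀
  refine ⟨h, hh, hs, ?_, hV ▸ hV₀⟩
  have h1 := sum_infoU_chanLik_le (hp.pow k) hf hCh
  have hc := mul_nonneg (capacity_nonneg hCh) (log_pos one_lt_two).le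
  refine le_of_mul_le_mul_left ?_ hk0
  calc k * ∑ w, infoU p (h w) ≤ n * (capacity Ch * log 2) := by rw [hU, hU₀]; exact h1
    _ ≤ τ * k * (capacity Ch * log 2) := by gcongr
    _ = _ := by ring

section Translation

variable {U V Z X Y W : Type} [Fintype U] [Fintype V] [Fintype Z] [Fintype X] [Fintype Y]
  [Fintype W]

lemma isSource_of_isTACI {P Q : U × V × Z → ℝ} (hP : IsPMF P) (hQpos : ∀ x, 0 < Q x)
    (hTACI : ∀ x : U × V × Z,
      Q x = (∑ v, P (x.1, v, x.2.2)) * (∑ u, P (u, x.2.1, x.2.2)) /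
        (∑ u, ∑ v, P (u, v, x.2.2))) : IsSource fun u v z => P (u, v, z) := by
  have htot : ∑ u, ∑ v, ∑ z, P (u, v, z) = 1 := by
    simpa only [Fintype.sum_prod_type] using hP.2
  have hne : Nonempty U ∧ Nonempty V ∧ Nonempty Z := by
    refine ⟨?_, ?_, ?_⟩ <;> by_contra hc <;> rw [not_nonempty_iff] at hc <;> simp at htot
  obtain ⟨⟨u₀⟩, ⟨v₀⟩, -⟩ := hne
  have h1 : ∀ u z, 0 ≤ ∑ v, P (u, v, z) := fun u z => Finset.sum_nonneg fun _ _ => hP.1 _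
  have h2 : ∀ v z, 0 ≤ ∑ u, P (u, v, z) := fun v z => Finset.sum_nonneg fun _ _ => hP.1 _
  have hne' : ∀ u v z, (∑ v, P (u, v, z)) ≠ 0 ∧ (∑ u, P (u, v, z)) ≠ 0 := fun u v z => by
    have hq := hTACI (u, v, z) ▸ (hQpos (u, v, z)).ne'
    simp only [ne_eq, div_eq_zero_iff, mul_eq_zero, not_or] at hq
    exact hq.1
  exact ⟨fun u v z => hP.1 _, fun u z => (h1 u z).lt_of_ne' (hne' u v₀ z).1,
    fun v z => (h2 v z).lt_of_ne' (hne' u₀ v z).2, htot⟩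

lemma inducedDist_eq_outVZ (R : U × V × Z → ℝ) (Ch : X → Y → ℝ) (k n : ℕ)
    (f : Fin 1 → (Fin k → U) → (Fin n → X) → ℝ)
    (x : (Fin 1 → Fin n → Y) × (Fin k → V) × (Fin k → Z)) :
    inducedDist (L := 1) (U := fun _ => U) (X := fun _ => X) (Y := fun _ => Y)
      (fun x => R (x.1 0, x.2.1, x.2.2)) (fun _ => Ch) k n f x =
    outVZ (powSource (fun u v z => R (u, v, z)) k) (chanLik (f 0) Ch (x.1 0)) x.2.1 x.2.2 := by
  simp only [inducedDist, outVZ, chanLik, Finset.mul_sum, powSource]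
  refine Fintype.sum_equiv (Equiv.funUnique (Fin 1) _) _ _ fun u => ?_
  refine Fintype.sum_equiv (Equiv.funUnique (Fin 1) _) _ _ fun w => ?_
  simp

lemma outVZ_powSource_of_isTACI {p q : U → V → Z → ℝ}
    (hq : ∀ u v z, q u v z = margUZ p u z * margVZ p v z / margZ p z) (k : ℕ)
    (h : (Fin k → U) → ℝ) (v : Fin k → V) (z : Fin k → Z) :
    outVZ (powSource q k) h v z =
      margVZ (powSource p k) v z * outZ (powSource p k) h z / margZ (powSource p k) z := by
  have : ∀ u, powSource q k u v z = margUZ (powSource p k) u z * margVZ (powSource p k) v z /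
      margZ (powSource p k) z := fun u => by
    rw [margUZ_powSource, margVZ_powSource, margZ_powSource]
    simp only [powSource, hq, Finset.prod_div_distrib, Finset.prod_mul_distrib]
  simp only [outVZ, outZ, this, Finset.mul_sum, Finset.sum_div]
  exact Finset.sum_congr rfl fun u _ => by ring

lemma klDiv_inducedDist {P Q : U × V × Z → ℝ} (hTACI : ∀ x : U × V × Z,
      Q x = (∑ v, P (x.1, v, x.2.2)) * (∑ u, P (u, x.2.1, x.2.2)) /
        (∑ u, ∑ v, P (u, v, x.2.2))) (Ch : X → Y → ℝ) (k n : ℕ)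
    (f : Fin 1 → (Fin k → U) → (Fin n → X) → ℝ) :
    klDiv (inducedDist (L := 1) (U := fun _ => U) (X := fun _ => X) (Y := fun _ => Y)
        (fun x => P (x.1 0, x.2.1, x.2.2)) (fun _ => Ch) k n f)
      (inducedDist (L := 1) (U := fun _ => U) (X := fun _ => X) (Y := fun _ => Y)
        (fun x => Q (x.1 0, x.2.1, x.2.2)) (fun _ => Ch) k n f) =
    (∑ y, infoV (powSource (fun u v z => P (u, v, z)) k) (chanLik (f 0) Ch y)) / log 2 := by
  simp only [klDiv, inducedDist_eq_outVZ]
  rw [Fintype.sum_prod_type, Finset.sum_div]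
  refine Fintype.sum_equiv (Equiv.funUnique (Fin 1) _) _ _ fun y => ?_
  simp only [Fintype.sum_prod_type, infoV, Finset.sum_div]
  refine Finset.sum_congr rfl fun v _ => Finset.sum_congr rfl fun z _ => ?_
  rw [outVZ_powSource_of_isTACI (p := fun u v z => P (u, v, z)) (fun u v z => hTACI (u, v, z)),
    div_div_eq_mul_div]
  exact (mul_div_assoc _ _ _).symm

variable {p : U → V → Z → ℝ} {h : W → U → ℝ}

lemma miUW_Z_kernel (hp : IsSource p) (hsum : ∑ w, h w = 1) :
    miUW_Z (fun x : (U × V × Z) × W => p x.1.1 x.1.2.1 x.1.2.2 * h x.2 x.1.1) =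
      (∑ w, infoU p (h w)) / log 2 := by
  have hs : ∀ u, ∑ w, h w u = 1 := fun u => by
    have := congrFun hsum u
    rwa [Finset.sum_apply] at this
  simp only [miUW_Z, condMI, Fintype.sum_prod_type, ← Finset.sum_mul, ← Finset.mul_sum, hs,
    mul_one]
  rw [Finset.sum_comm, Finset.sum_div]
  simp only [infoU, Finset.sum_div]
  refine Finset.sum_congr rfl fun w _ => Finset.sum_congr rfl fun u _ =>
    Finset.sum_congr rfl fun z _ => ?_
  change margUZ p u z * h w u * logb 2 (margUZ p u z * h w u * margZ p z /
    (margUZ p u z * outZ p (h w) z)) = _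
  rw [mul_assoc (margUZ p u z) (h w u) (margZ p z), mul_div_mul_left _ _ (hp.posUZ u z).ne']
  exact (mul_div_assoc _ _ _).symm

lemma miVW_Z_kernel (hsum : ∑ w, h w = 1) :
    miVW_Z (fun x : (U × V × Z) × W => p x.1.1 x.1.2.1 x.1.2.2 * h x.2 x.1.1) =
      (∑ w, infoV p (h w)) / log 2 := by
  change ∑ x : V × W × Z, outVZ p (h x.2.1) x.1 x.2.2 * logb 2 (outVZ p (h x.2.1) x.1 x.2.2 *
    (∑ a, ∑ b, outVZ p (h b) a x.2.2) / ((∑ b, outVZ p (h b) x.1 x.2.2) *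
      ∑ a, outVZ p (h x.2.1) a x.2.2)) = _
  simp only [Fintype.sum_prod_type, sum_outVZ_likelihood hsum, sum_outVZ,
    ← margZ_eq_sum_margVZ]
  rw [Finset.sum_comm, Finset.sum_div]
  simp only [infoV, Finset.sum_div, logb, mul_div_assoc]

lemma auxiliary_of_kernel {P : U × V × Z → ℝ} (hP : IsPMF P) (hh : ∀ w u, 0 ≤ h w u)
    (hsum : ∑ w, h w = 1) :
    IsPMF (fun x : (U × V × Z) × W => P x.1 * h x.2 x.1.1) ∧
      (∀ x, ∑ w, P x * h w x.1 = P x) ∧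
      MarkovZVUW (fun x : (U × V × Z) × W => P x.1 * h x.2 x.1.1) := by
  have hs : ∀ u, ∑ w, h w u = 1 := fun u => by
    have := congrFun hsum u
    rwa [Finset.sum_apply] at this
  have hm : ∀ x, ∑ w, P x * h w x.1 = P x := fun x => by
    rw [← Finset.mul_sum, hs, mul_one]
  refine ⟨⟨fun x => mul_nonneg (hP.1 _) (hh _ _), ?_⟩, hm, fun a u w => ?_⟩
  · rw [Fintype.sum_prod_type]
    simp only [hm]
    exact hP.2
  · simp only [← Finset.mul_sum, ← Finset.sum_mul, hs, mul_one]
    ring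

lemma exists_kernel_of_auxiliary {P : U × V × Z → ℝ} (hp : IsSource fun u v z => P (u, v, z))
    {J : (U × V × Z) × W → ℝ} (hJ : IsPMF J) (hm : ∀ x, ∑ w, J (x, w) = P x)
    (hM : MarkovZVUW J) :
    ∃ h : W → U → ℝ, (∀ w u, 0 ≤ h w u) ∧ ∑ w, h w = 1 ∧ J = fun x => P x.1 * h x.2 x.1.1 := by
  have hpos : ∀ u, 0 < ∑ a : Z × V, P (u, a.2, a.1) := fun u => by
    have := hp.nonempty.2.2
    rw [Fintype.sum_prod_type]
    exact Finset.sum_pos (fun z _ => hp.posUZ u z) Finset.univ_nonempty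
  refine ⟨fun w u => (∑ a : Z × V, J ((u, a.2, a.1), w)) / ∑ a : Z × V, P (u, a.2, a.1),
    fun w u => div_nonneg (Finset.sum_nonneg fun _ _ => hJ.1 _) (hpos u).le, ?_, ?_⟩
  · funext u
    rw [Finset.sum_apply, Pi.one_apply, ← Finset.sum_div, Finset.sum_comm]
    simp only [hm]
    exact div_self (hpos u).ne'
  · funext ⟨⟨u, v, z⟩, w⟩
    have := hM (z, v) u w
    simp only [hm] at this
    rw [← mul_div_assoc, eq_div_iff (hpos u).ne', this]

end Translation

end DHT

/-- For the single-observer (`L = 1`) TACI problem with bandwidth ratio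
`τ > 0`, `θ(τ) = sup_W I(V;W|Z)` over all auxiliary `W` (on an alphabet of size `|𝒰|+4`)
with `(Z,V) − U − W` a Markov chain and `I(U;W|Z) ≤ τ·C`. -/
theorem statement_12 {Uu Xx Yy V Z : Type}
    [Fintype Uu] [Fintype Xx] [Fintype Yy] [Fintype V] [Fintype Z]
    (P Q : Uu × V × Z → ℝ) (hP : IsPMF P) (hQ : IsPMF Q) (hQpos : ∀ x, 0 < Q x)
    (hTACI : ∀ x : Uu × V × Z,
      Q x = (∑ v, P (x.1, v, x.2.2)) * (∑ u, P (u, x.2.1, x.2.2)) /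
        (∑ u, ∑ v, P (u, v, x.2.2)))
    (Ch : Xx → Yy → ℝ) (hCh : IsKernel Ch) (τ : ℝ) (hτ : 0 < τ) :
    theta (L := 1) (U := fun _ => Uu) (X := fun _ => Xx) (Y := fun _ => Yy)
        (fun x => P (x.1 0, x.2.1, x.2.2)) (fun x => Q (x.1 0, x.2.1, x.2.2))
        (fun _ => Ch) τ =
      sSup {i | ∃ J : (Uu × V × Z) × Fin (Fintype.card Uu + 4) → ℝ,
        IsPMF J ∧ (∀ x, (∑ w, J (x, w)) = P x) ∧ MarkovZVUW J ∧
        miUW_Z J ≤ τ * capacity Ch ∧ i = miVW_Z J} := by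
  have hl := log_pos one_lt_two
  have hp := isSource_of_isTACI hP hQpos hTACI
  set p : Uu → V → Z → ℝ := fun u v z => P (u, v, z) with hp_def
  have hset : {i | ∃ J : (Uu × V × Z) × Fin (Fintype.card Uu + 4) → ℝ,
      IsPMF J ∧ (∀ x, (∑ w, J (x, w)) = P x) ∧ MarkovZVUW J ∧
      miUW_Z J ≤ τ * capacity Ch ∧ i = miVW_Z J} =
      {i | ∃ h : Fin (Fintype.card Uu + 4) → Uu → ℝ, (∀ w u, 0 ≤ h w u) ∧ ∑ w, h w = 1 ∧
        ∑ w, infoU p (h w) ≤ τ * (capacity Ch * log 2) ∧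
        i = (∑ w, infoV p (h w)) / log 2} := by
    ext i
    constructor
    · rintro ⟨J, hJ, hm, hM, hI, rfl⟩
      obtain ⟨h, hh, hs, rfl⟩ := exists_kernel_of_auxiliary hp hJ hm hM
      refine ⟨h, hh, hs, ?_, miVW_Z_kernel (p := p) hs⟩
      have := (miUW_Z_kernel hp hs).symm.trans_le hI
      rwa [div_le_iff₀ hl, mul_assoc] at this
    · rintro ⟨h, hh, hs, hI, rfl⟩
      obtain ⟨h1, h2, h3⟩ := auxiliary_of_kernel hP hh hs
      refine ⟨_, h1, h2, h3, (miUW_Z_kernel hp hs).trans_le ?_, (miVW_Z_kernel (p := p) hs).symm⟩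
      rwa [div_le_iff₀ hl, mul_assoc]
  rw [hset]
  set S := {i | ∃ h : Fin (Fintype.card Uu + 4) → Uu → ℝ, (∀ w u, 0 ≤ h w u) ∧ ∑ w, h w = 1 ∧
    ∑ w, infoU p (h w) ≤ τ * (capacity Ch * log 2) ∧ i = (∑ w, infoV p (h w)) / log 2} with hS
  have hSbdd : BddAbove S := by
    refine ⟨τ * capacity Ch, ?_⟩
    rintro i ⟨h, hh, -, hI, rfl⟩
    rw [div_le_iff₀ hl, mul_assoc]
    exact (Finset.sum_le_sum fun w _ => infoV_le_infoU hp (hh w)).trans hI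
  have hblock : ∀ k n : ℕ, 1 ≤ k → (n : ℝ) ≤ τ * k → ∀ f : (Fin k → Uu) → (Fin n → Xx) → ℝ,
      IsKernel f → (∑ y, infoV (powSource p k) (chanLik f Ch y)) / log 2 / k ≤ sSup S := by
    intro k n hk hn f hf
    obtain ⟨h, hh, hs, hU, hV⟩ := exists_kernel_of_block_encoder hp hCh hk hn hf
    refine le_csSup_of_le hSbdd ⟨h, hh, hs, hU, rfl⟩ ?_
    have hk0 : (0 : ℝ) < k := by exact_mod_cast hk
    rw [div_right_comm]
    gcongr
    rwa [div_le_iff₀' hk0]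
  have hS0 : 0 ≤ sSup S := by
    have := hblock 1 0 le_rfl (by simpa using hτ.le) _ (isKernel_empty_word _)
    rwa [sum_infoV_empty_word (hp.pow 1), zero_div, zero_div] at this
  have hd : ∀ (k : ℕ), 1 ≤ k → ∀ d, (∃ n : ℕ, (n : ℝ) ≤ τ * k ∧
      ∃ f : (l : Fin 1) → (Fin k → Uu) → (Fin n → Xx) → ℝ, (∀ l, IsKernel (f l)) ∧
      d = klDiv (inducedDist (L := 1) (U := fun _ => Uu) (X := fun _ => Xx) (Y := fun _ => Yy)
          (fun x => P (x.1 0, x.2.1, x.2.2)) (fun _ => Ch) k n f)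
        (inducedDist (L := 1) (U := fun _ => Uu) (X := fun _ => Xx) (Y := fun _ => Yy)
          (fun x => Q (x.1 0, x.2.1, x.2.2)) (fun _ => Ch) k n f) / k) → d ≤ sSup S := by
    rintro k hk d ⟨n, hn, f, hf, rfl⟩
    rw [klDiv_inducedDist hTACI]
    exact hblock k n hk hn (f 0) (hf 0)
  have hK : ∀ k : ℕ, 1 ≤ k → thetaK (L := 1) (U := fun _ => Uu) (X := fun _ => Xx)
      (Y := fun _ => Yy) (fun x => P (x.1 0, x.2.1, x.2.2)) (fun x => Q (x.1 0, x.2.1, x.2.2))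
      (fun _ => Ch) τ k ≤ sSup S := fun k hk => Real.sSup_le (hd k hk) hS0
  have hT : ∀ d, (∃ k : ℕ, 1 ≤ k ∧ d = thetaK (L := 1) (U := fun _ => Uu) (X := fun _ => Xx)
      (Y := fun _ => Yy) (fun x => P (x.1 0, x.2.1, x.2.2)) (fun x => Q (x.1 0, x.2.1, x.2.2))
      (fun _ => Ch) τ k) → d ≤ sSup S := by
    rintro d ⟨k, hk, rfl⟩
    exact hK k hk
  refine le_antisymm (Real.sSup_le hT hS0) (csSup_le ?_ ?_)
  · obtain ⟨h, hh, hs, hU, -⟩ := exists_kernel_of_block_encoder hp hCh le_rfl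
      (show ((0 : ℕ) : ℝ) ≤ τ * (1 : ℕ) by simpa using hτ.le) (isKernel_empty_word _)
    exact ⟨_, h, hh, hs, hU, rfl⟩
  · rintro i ⟨h, hh, hs, hU, rfl⟩
    refine le_of_forall_pos_le_add fun η hη => ?_
    obtain ⟨k, n, hk, hn, f, hf, hV⟩ :=
      exists_block_encoder_of_le hp hh hs hCh hτ (mul_pos hη hl) hU
    have hk0 : (0 : ℝ) < k := by exact_mod_cast hk
    rw [← sub_le_iff_le_add]
    refine le_trans ?_ (le_csSup ⟨_, hT⟩ ⟨k, hk, rfl⟩)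
    refine le_csSup_of_le ⟨_, hd k hk⟩ ⟨n, hn, fun _ => f, fun _ => hf, rfl⟩ ?_
    rw [klDiv_inducedDist hTACI, div_right_comm, le_div_iff₀ hl, le_div_iff₀ hk0, sub_mul,
      div_mul_cancel₀ _ hl.ne']
    exact hV
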